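/- Boundary Harnack-type bound: let ε ∈ (0,1], x₀ ∈ Γ, r > 0, and let X₀ ∈ Ω satisfy |X₀ − x₀| ≤ r and δ(X₀) ≥ ε r (a corkscrew point). Let u ∈ W_r(B(x₀, 2r)) be a nonnegative, not identically zero, solution of Lu = 0 in B(x₀, 2r) ∖ Γ such that Tu = 0 σ-almost everywhere on Γ ∩ B(x₀, 2r). Then, for the continuous representative of u on Ω, u(X) ≤ C u(X₀) for every X ∈ B(x₀, r) ∖ Γ, where C > 0 depends only on n, d, C₀, C₁, and ε. -/

import Mathlib

open MeasureTheory Metric Set Filter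
open scoped ENNReal NNReal Topology

noncomputable section

/-- Euclidean space `ℝⁿ`. -/
abbrev Euc (n : ℕ) := EuclideanSpace ℝ (Fin n)

/-- `Γ ⊆ ℝⁿ` is `d`-Ahlfors regular with constant `C₀`. -/
def AhlforsRegular (n : ℕ) (d C₀ : ℝ) (Γ : Set (Euc n)) : Prop :=
  ∀ x ∈ Γ, ∀ r : ℝ, 0 < r →
    ENNReal.ofReal (C₀⁻¹ * r ^ d) ≤ μH[d] (Γ ∩ ball x r) ∧
      μH[d] (Γ ∩ ball x r) ≤ ENNReal.ofReal (C₀ * r ^ d)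

/-- The weight `w(x) = dist(x, Γ) ^ (d + 1 - n)`. -/
def weightW (n : ℕ) (d : ℝ) (Γ : Set (Euc n)) (x : Euc n) : ℝ :=
  infDist x Γ ^ (d + 1 - (n : ℝ))

/-- The measure `m` with density `w` with respect to Lebesgue measure. -/
def measW (n : ℕ) (d : ℝ) (Γ : Set (Euc n)) : Measure (Euc n) :=
  volume.withDensity fun x => ENNReal.ofReal (weightW n d Γ x)

/-- `v` is a distributional gradient of `u` on the open set `E`: for every smooth
compactly supported test function `φ` with support in `E`, `∫_E u ∇φ = -∫_E φ v`. -/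
def IsDistribGradOn {n : ℕ} (u : Euc n → ℝ) (v : Euc n → Euc n) (E : Set (Euc n)) : Prop :=
  ∀ φ : Euc n → ℝ, ContDiff ℝ (⊤ : ℕ∞) φ → HasCompactSupport φ → tsupport φ ⊆ E →
    ∫ x in E, u x • gradient φ x = -∫ x in E, φ x • v x

/-- The averages of `u` over small balls centered at `x` converge to `t`. -/
def HasTraceAt {n : ℕ} (u : Euc n → ℝ) (x : Euc n) (t : ℝ) : Prop :=
  Tendsto (fun ρ : ℝ => ⨍ y in ball x ρ, u y) (𝓝[>] (0 : ℝ)) (𝓝 t)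

/-- `u` belongs to the weighted Sobolev space `W = Ẇ^{1,2}_w(Ω)`, `Ω = Γᶜ`, with
distributional gradient `v` on `Ω` lying in `L²(Ω, m)`. -/
structure MemW (n : ℕ) (d : ℝ) (Γ : Set (Euc n)) (u : Euc n → ℝ) (v : Euc n → Euc n) :
    Prop where
  locInt : LocallyIntegrableOn u Γᶜ volume
  gradLocInt : LocallyIntegrableOn v Γᶜ volume
  isGrad : IsDistribGradOn u v Γᶜ
  l2 : ∫⁻ x in Γᶜ, ENNReal.ofReal (‖v x‖ ^ 2) ∂(measW n d Γ) < ⊤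

/-- `u` belongs to the local space `W_r(E)`: `u ∈ L¹_loc(E)` and `φ u` (extended by `0`)
belongs to `W` for every smooth compactly supported `φ` with support in `E`. -/
def MemWrOn (n : ℕ) (d : ℝ) (Γ : Set (Euc n)) (E : Set (Euc n)) (u : Euc n → ℝ) : Prop :=
  LocallyIntegrableOn u E volume ∧
    ∀ φ : Euc n → ℝ, ContDiff ℝ (⊤ : ℕ∞) φ → HasCompactSupport φ → tsupport φ ⊆ E →
      ∃ vφ : Euc n → Euc n, MemW n d Γ (fun x => φ x * u x) vφ

/-- Degenerate ellipticity and boundedness conditions for the matrix `A`. -/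
def EllipticOn (n : ℕ) (d : ℝ) (Γ : Set (Euc n)) (A : Euc n → Euc n →L[ℝ] Euc n)
    (C₁ : ℝ) : Prop :=
  ∀ x, x ∉ Γ →
    (∀ ξ ζ : Euc n, |∑ i, A x ξ i * ζ i| ≤ C₁ * weightW n d Γ x * ‖ξ‖ * ‖ζ‖) ∧
      ∀ ξ : Euc n, C₁⁻¹ * weightW n d Γ x * ‖ξ‖ ^ 2 ≤ ∑ i, A x ξ i * ξ i

/-- `u`, with gradient `v`, is a weak subsolution of `- div A ∇u = 0` on `U ⊆ Ω = Γᶜ`. -/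
def SubsolOn {n : ℕ} (Γ : Set (Euc n)) (A : Euc n → Euc n →L[ℝ] Euc n)
    (v : Euc n → Euc n) (U : Set (Euc n)) : Prop :=
  ∀ φ : Euc n → ℝ, ContDiff ℝ (⊤ : ℕ∞) φ → HasCompactSupport φ → tsupport φ ⊆ U →
    (∀ x, 0 ≤ φ x) → ∫ x in Γᶜ, ∑ i, A x (v x) i * gradient φ x i ≤ 0

/-- `u`, with gradient `v`, is a weak supersolution of `- div A ∇u = 0` on `U ⊆ Ω = Γᶜ`. -/
def SupersolOn {n : ℕ} (Γ : Set (Euc n)) (A : Euc n → Euc n →L[ℝ] Euc n)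
    (v : Euc n → Euc n) (U : Set (Euc n)) : Prop :=
  ∀ φ : Euc n → ℝ, ContDiff ℝ (⊤ : ℕ∞) φ → HasCompactSupport φ → tsupport φ ⊆ U →
    (∀ x, 0 ≤ φ x) → 0 ≤ ∫ x in Γᶜ, ∑ i, A x (v x) i * gradient φ x i

/-- `u`, with gradient `v`, is a weak solution of `- div A ∇u = 0` on `U ⊆ Ω = Γᶜ`. -/
def SolOn {n : ℕ} (Γ : Set (Euc n)) (A : Euc n → Euc n →L[ℝ] Euc n)
    (v : Euc n → Euc n) (U : Set (Euc n)) : Prop :=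
  ∀ φ : Euc n → ℝ, ContDiff ℝ (⊤ : ℕ∞) φ → HasCompactSupport φ → tsupport φ ⊆ U →
    ∫ x in Γᶜ, ∑ i, A x (v x) i * gradient φ x i = 0

set_option linter.all false

section
open ENNReal (ofReal ofReal_add ofReal_add_le ofReal_coe_nnreal ofReal_div_of_pos ofReal_eq_zero ofReal_inv_of_pos ofReal_le_ofReal ofReal_le_ofReal_iff ofReal_lt_top ofReal_mul ofReal_ne_top ofReal_ofNat ofReal_one ofReal_pow ofReal_rpow_of_nonneg ofReal_sub ofReal_toReal ofReal_zero)
open Real (rpow_add rpow_neg mul_rpow rpow_le_rpow_of_nonpos rpow_natCast rpow_mul norm_eq_abs norm_of_nonneg coe_toNNReal toNNReal log arctan)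
local notation "pz" => (by positivity)
variable {E : Type*} [NormedAddCommGroup E] [InnerProductSpace ℝ E] [FiniteDimensional ℝ E]
  [MeasurableSpace E] [BorelSpace E]
local notation "nz" => (by norm_num)
local notation "lz" => (by linarith)
local notation "fz" => (by fun_prop)
local notation "sz" => (by simp)
local notation "dimE" => Module.finrank ℝ E
local notation "offs" => image_eq_zero_of_notMem_tsupport
local notation "Sm" => ContDiff ℝ (⊤ : ℕ∞)
local notation "dst" => infDist
local notation "Hcs" => HasCompactSupport
local notation "Lip" => LipschitzWith
local notation "msb" => measurableSet_ball
local notation "ole" => ofReal_le_ofReal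
local notation "mlr" => mul_le_mul_right
local notation "ont" => ofReal_ne_top
local notation "rnp" => rpow_le_rpow_of_nonpos
local notation "aoa" => ae_of_all
local notation "iom" => indicator_of_mem
local notation "ion" => indicator_of_notMem
local notation "lcm" => lintegral_const_mul'
local notation "mln" => mul_le_mul_of_nonneg_left
local notation "mrn" => mul_le_mul_of_nonneg_right
local notation "abn" => abs_of_nonneg
local notation "bsb" => ball_subset_ball
local notation "bsc" => ball_subset_closedBall
theorem trans_tendsto {g : E → E} (hg : MemLp g 2 volume) :
    Tendsto (fun t : E => eLpNorm (fun x => g (x - t) - g x) 2 volume) (𝓝 0) (𝓝 0) := by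
  have hm : ∀ t : E, MeasurePreserving (fun x : E => x - t) volume volume :=
    fun t => measurePreserving_sub_right volume t
  let T : E → C(E, E) := fun t => ⟨fun x => x - t, by fun_prop⟩
  have hT : Continuous T := by
    apply ContinuousMap.continuous_of_continuous_uncurry
    show Continuous fun p : E × E => p.2 - p.1
    fun_prop
  have hgm : ∀ t, MeasurePreserving (T t) volume volume := hm
  have := ((tendsto_const_nhds (x := hg.toLp g) (f := 𝓝 (0 : E))).compMeasurePreservingLp
    (hT.tendsto 0) hgm (hgm 0) nz)
  rw [tendsto_iff_edist_tendsto_0] at this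
  refine this.congr fun t => ?_
  rw [Lp.edist_def]
  apply eLpNorm_congr_ae
  have h1 := Lp.coeFn_compMeasurePreserving (hg.toLp g) (hgm t)
  have h2 := Lp.coeFn_compMeasurePreserving (hg.toLp g) (hgm 0)
  have h3 := (hgm t).quasiMeasurePreserving.ae_eq_comp hg.coeFn_toLp
  have h4 := (hgm 0).quasiMeasurePreserving.ae_eq_comp hg.coeFn_toLp
  filter_upwards [h1, h2, h3, h4] with x e1 e2 e3 e4
  simp only [Pi.sub_apply]
  rw [e1, e2, e3, e4]
  simp [T]

theorem moll_jensen {η : E → ℝ} (h0 : ∀ x, 0 ≤ η x) (hη : Continuous η)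
    (hi : ∫ x, η x = 1) (hint : Integrable η)
    {g : E → E} (hgm : StronglyMeasurable g) {c : ℝ≥0∞}
    (hc : ∀ t, η t ≠ 0 → eLpNorm (fun x => g (x - t) - g x) 2 volume ≤ c)
    {h : E → E} (hh : ∀ x, h x = ∫ t, η t • g (x - t))
    (hex : ∀ x, Integrable (fun t => η t • g (x - t))) :
    eLpNorm (fun x => h x - g x) 2 volume ≤ c := by
  have hη1 : ∫⁻ t, ofReal (η t) = 1 := by
    rw [← ofReal_integral_eq_lintegral_ofReal hint (aoa _ h0), hi, ofReal_one]
  have hηm : Measurable fun t => ofReal (η t) := by fun_prop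
  set P : Measure (E) := volume.withDensity (fun t => ofReal (η t)) with hP
  have : IsProbabilityMeasure P := ⟨by rw [hP, withDensity_apply _ MeasurableSet.univ]; simpa⟩
  have hD : Measurable fun p : E × E => ‖g (p.1 - p.2) - g p.1‖ₑ := by
    have h1 : StronglyMeasurable fun p : E × E => g (p.1 - p.2) :=
      hgm.comp_measurable fz
    have h2 : StronglyMeasurable fun p : E × E => g p.1 :=
      hgm.comp_measurable fz
    exact (h1.sub h2).enorm
  have key : ∀ x, ‖h x - g x‖ₑ ^ (2:ℝ) ≤ ∫⁻ t, ‖g (x - t) - g x‖ₑ ^ (2:ℝ) ∂P := by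
    intro x
    have e1 : h x - g x = ∫ t, η t • (g (x - t) - g x) := by
      simp_rw [smul_sub]
      rw [integral_sub (hex x) (hint.smul_const _), integral_smul_const, hi, one_smul, hh]
    have hsx : StronglyMeasurable fun t => g (x - t) - g x :=
      (hgm.comp_measurable (measurable_const.sub measurable_id)).sub stronglyMeasurable_const
    have hmx : Measurable fun t => ‖g (x - t) - g x‖ₑ := hsx.enorm
    have e2 : ‖h x - g x‖ₑ ≤ ∫⁻ t, ‖g (x - t) - g x‖ₑ ∂P := by
      rw [e1]
      refine (enorm_integral_le_lintegral_enorm _).trans ?_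
      rw [hP, lintegral_withDensity_eq_lintegral_mul _ hηm hmx]
      apply lintegral_mono
      intro t
      simp [enorm_smul, Real.enorm_eq_ofReal (h0 t)]
    have e3 := ENNReal.rpow_le_rpow e2 (by norm_num : (0:ℝ) ≤ 2)
    refine e3.trans ?_
    have e4 := eLpNorm_le_eLpNorm_of_exponent_le (p := 1) (q := 2) (μ := P) nz
      (f := fun t => g (x - t) - g x) hsx.aestronglyMeasurable
    rw [eLpNorm_one_eq_lintegral_enorm, eLpNorm_eq_lintegral_rpow_enorm_toReal nz nz] at e4
    have e5 := ENNReal.rpow_le_rpow e4 (by norm_num : (0:ℝ) ≤ 2)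
    rw [← ENNReal.rpow_mul] at e5
    simpa using e5
  rw [eLpNorm_eq_lintegral_rpow_enorm_toReal nz nz]
  have hc2 : ∫⁻ x, ‖h x - g x‖ₑ ^ (2:ℝ) ≤ c ^ (2:ℝ) := by
    calc ∫⁻ x, ‖h x - g x‖ₑ ^ (2:ℝ) ≤ ∫⁻ x, ∫⁻ t, ‖g (x - t) - g x‖ₑ ^ (2:ℝ) ∂P := lintegral_mono key
      _ = ∫⁻ t, (∫⁻ x, ‖g (x - t) - g x‖ₑ ^ (2:ℝ)) ∂P := by
          apply lintegral_lintegral_swap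
          exact (hD.pow_const _).aemeasurable
      _ ≤ ∫⁻ t, c ^ (2:ℝ) ∂P := by
          apply lintegral_mono_ae
          have : ∀ᵐ t ∂P, η t ≠ 0 := by
            rw [hP, ae_withDensity_iff hηm]
            refine aoa _ fun t ht h => ht (by simp [h])
          filter_upwards [this] with t ht
          have := hc t ht
          rw [eLpNorm_eq_lintegral_rpow_enorm_toReal nz nz] at this
          have e5 := ENNReal.rpow_le_rpow this (by norm_num : (0:ℝ) ≤ 2)
          rw [← ENNReal.rpow_mul] at e5
          simpa using e5
      _ = c ^ (2:ℝ) := by simp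
  have := ENNReal.rpow_le_rpow hc2 (by norm_num : (0:ℝ) ≤ 1/2)
  rw [← ENNReal.rpow_mul] at this
  simpa using this

structure WG (K : Set (E)) (f : E → ℝ) (g : E → E) : Prop where
  cont : Continuous f
  zero : ∀ x, x ∉ K → f x = 0
  mem : MemLp g 2 volume
  gzero : ∀ᵐ x, x ∉ K → g x = 0
  weak : ∀ ψ : E → ℝ, Sm ψ → Hcs ψ →
    ∫ x, f x • gradient ψ x = -∫ x, ψ x • g x

theorem grad_comp_sub {φ : E → ℝ} (hφ : Sm φ) (x s : E) :
    gradient (fun s => φ (x - s)) s = - gradient φ (x - s) := by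
  have h1 : HasFDerivAt (fun s => φ (x - s)) (-(fderiv ℝ φ (x - s))) s := by
    have h2 : HasFDerivAt (fun s : E => x - s) (-(ContinuousLinearMap.id ℝ (E))) s :=
      (hasFDerivAt_id s).const_sub x
    have h3 := ((hφ.differentiable sz) (x - s)).hasFDerivAt.comp s h2
    have e : -(fderiv ℝ φ (x - s)) = (fderiv ℝ φ (x - s)).comp
        (-(ContinuousLinearMap.id ℝ E)) := by ext y; simp
    rw [e]; exact h3
  unfold gradient
  rw [h1.fderiv]; simp

theorem moll_grad {K : Set (E)} {f : E → ℝ} {g : E → E}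
    (h : WG K f g) {φ : E → ℝ} (hφ : Sm φ) (hc : Hcs φ)
    (x : E) :
    gradient (convolution φ f (ContinuousLinearMap.lsmul ℝ ℝ) volume) x =
      ∫ t, φ t • g (x - t) := by
  have hl : LocallyIntegrable f volume := h.cont.locallyIntegrable
  have hd := hc.hasFDerivAt_convolution_left (ContinuousLinearMap.lsmul ℝ ℝ) (hφ.of_le sz) hl x
  have hgl : LocallyIntegrable g volume := h.mem.locallyIntegrable nz
  have hw := h.weak (fun s => φ (x - s)) (hφ.comp (contDiff_const.sub contDiff_id))
    (hc.comp_homeomorph (Homeomorph.subLeft x))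
  have e2 : ∫ t, φ t • g (x - t) = ∫ s, φ (x - s) • g s := by
    rw [← integral_sub_left_eq_self _ volume x]; simp
  have e3 : ∫ s, f s • gradient (fun s => φ (x - s)) s = - ∫ t, f (x - t) • gradient φ t := by
    simp_rw [grad_comp_sub hφ, smul_neg]
    rw [integral_neg, ← integral_sub_left_eq_self _ volume x]; simp
  rw [e2, ← neg_eq_iff_eq_neg.mpr hw, e3, neg_neg]
  have hgc : Continuous (gradient φ) := by
    unfold gradient
    exact (LinearIsometryEquiv.continuous _).comp (hφ.continuous_fderiv sz)
  have hgs : Hcs (gradient φ) := by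
    unfold gradient
    exact (hc.fderiv ℝ).comp_left sz
  have hint : Integrable (fun t => f (x - t) • gradient φ t) :=
    Continuous.integrable_of_hasCompactSupport
      ((h.cont.comp (continuous_const.sub continuous_id)).smul hgc) hgs.smul_left
  refine ext_inner_right ℝ fun y => ?_
  rw [inner_gradient_left, hd.fderiv, real_inner_comm, ← integral_inner hint y]
  have hcs : Hcs (fderiv ℝ φ) := hc.fderiv ℝ
  have hex := hcs.convolutionExists_left ((ContinuousLinearMap.lsmul ℝ ℝ).precompL (E))
    (hφ.continuous_fderiv sz) hl x
  unfold convolution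
  rw [ContinuousLinearMap.integral_apply hex]
  apply integral_congr_ae (aoa _ fun t => ?_)
  simp [ContinuousLinearMap.precompL_apply, inner_smul_right, mul_comm]

theorem WG.congr {K : Set E} {f : E → ℝ} {g g' : E → E} (h : WG K f g) (e : g =ᵐ[volume] g') :
    WG K f g' := by
  refine ⟨h.cont, h.zero, (memLp_congr_ae e).1 h.mem, ?_, fun ψ h1 h2 => ?_⟩
  · filter_upwards [e, h.gzero] with x e1 e2 hx
    rw [← e1, e2 hx]
  · rw [h.weak ψ h1 h2]
    congr 1
    apply integral_congr_ae
    filter_upwards [e] with x e1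
    rw [e1]

theorem WG.mono {K K' : Set E} {f : E → ℝ} {g : E → E} (h : WG K f g) (hK : K ⊆ K') :
    WG K' f g :=
  ⟨h.cont, fun x hx => h.zero x fun h => hx (hK h), h.mem, h.gzero.mono fun x h1 hx => h1 fun h => hx (hK h), h.weak⟩

theorem WG.hcs {K : Set E} (hK : IsCompact K) {f : E → ℝ} {g : E → E} (h : WG K f g) : Hcs f :=
  HasCompactSupport.intro hK h.zero

theorem WG.approx {K K' : Set E} (hK : IsCompact K) {f : E → ℝ} {g : E → E}
    (h : WG K f g) (hKK : K ⊆ interior K') :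
    ∃ F : ℕ → E → ℝ, (∀ k, Sm (F k)) ∧ (∀ k, tsupport (F k) ⊆ K') ∧
      TendstoUniformly F f atTop ∧
      Tendsto (fun k => eLpNorm (fun x => gradient (F k) x - g x) 2 volume) atTop (𝓝 0) := by
  obtain ⟨r0, hr0, hr⟩ := hK.exists_cthickening_subset_open isOpen_interior hKK
  wlog hgm : StronglyMeasurable g generalizing g
  · obtain ⟨g', hg', e⟩ := h.mem.1
    obtain ⟨F, h1, h2, h3, h4⟩ := this (h.congr e) hg'
    refine ⟨F, h1, h2, h3, h4.congr fun k => eLpNorm_congr_ae ?_⟩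
    filter_upwards [e] with x e1
    rw [e1]
  let φ : ℕ → ContDiffBump (0 : E) := fun k =>
    ⟨r0 / (k + 2), r0 / (k + 1), by positivity, by gcongr; norm_num⟩
  let η : ℕ → E → ℝ := fun k => (φ k).normed volume
  have hη0 : ∀ k t, η k t ≠ 0 → ‖t‖ < r0 / (k + 1) := by
    intro k t ht
    have : t ∈ Function.support (η k) := ht
    rw [ContDiffBump.support_normed_eq] at this
    simpa using this
  have hlim : Tendsto (fun k : ℕ => r0 / ((k : ℝ) + 1)) atTop (𝓝 0) := by
    have := (tendsto_one_div_add_atTop_nhds_zero_nat (𝕜 := ℝ)).const_mul r0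
    simpa [div_eq_mul_inv] using this
  have hle : ∀ k : ℕ, r0 / ((k : ℝ) + 1) ≤ r0 := fun k =>
    div_le_self hr0.le (by linarith [Nat.cast_nonneg (α := ℝ) k])
  have hηs : ∀ k, Sm (η k) := fun k => ContDiffBump.contDiff_normed _
  have hηc : ∀ k, Hcs (η k) := fun k => ContDiffBump.hasCompactSupport_normed _
  have hfl : LocallyIntegrable f volume := h.cont.locallyIntegrable
  refine ⟨fun k => convolution (η k) f (ContinuousLinearMap.lsmul ℝ ℝ) volume, fun k => ?_,
    fun k => ?_, ?_, ?_⟩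
  · exact (hηc k).contDiff_convolution_left _ (hηs k) hfl
  · refine Subset.trans ?_ (hr.trans interior_subset)
    refine closure_minimal ?_ isClosed_cthickening
    intro x hx
    by_contra hn
    apply hx
    show convolution (η k) f _ volume x = 0
    rw [convolution_def]
    refine integral_eq_zero_of_ae (aoa _ fun t => ?_)
    by_cases ht : η k t = 0
    · simp [ht]
    · have hz : f (x - t) = 0 := by
        apply h.zero
        intro hxt
        apply hn
        apply mem_cthickening_of_dist_le x (x - t) _ _ hxt
        have := hη0 k t ht
        have := hle k
        simp; linarith
      simp [hz]
  · have huc : UniformContinuous f := (h.hcs hK).uniformContinuous_of_continuous h.cont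
    rw [Metric.tendstoUniformly_iff]
    intro e he
    obtain ⟨s, hs, hs2⟩ := Metric.uniformContinuous_iff.1 huc (e / 2) pz
    filter_upwards [hlim.eventually (gt_mem_nhds hs)] with k hk x
    rw [dist_comm]
    refine lt_of_le_of_lt ((φ k).dist_normed_convolution_le h.cont.aestronglyMeasurable
      (ε := e / 2) fun y hy => (hs2 ?_).le) lz
    exact lt_trans hy hk
  · rw [ENNReal.tendsto_nhds_zero]
    intro c hc
    have h1 := (ENNReal.tendsto_nhds_zero.1 (trans_tendsto h.mem)) c hc
    obtain ⟨s, hs, hs2⟩ := Metric.eventually_nhds_iff.1 h1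
    filter_upwards [hlim.eventually (gt_mem_nhds hs)] with k hk
    refine moll_jensen (η := η k) (fun x => (φ k).nonneg_normed x) (hηs k).continuous
      (φ k).integral_normed ((hηs k).continuous.integrable_of_hasCompactSupport (hηc k)) hgm
      (fun t ht => hs2 ?_) (fun x => moll_grad h (hηs k) (hηc k) x) fun x => ?_
    · have := hη0 k t ht
      simp; linarith
    · exact (hηc k).convolutionExists_left (ContinuousLinearMap.lsmul ℝ ℝ) (hηs k).continuous (h.mem.locallyIntegrable nz) x

theorem tendsto_int_L2 {X F F' : Type*} [MeasurableSpace X] {μ : Measure X} [NormedAddCommGroup F] [NormedSpace ℝ F]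
    [NormedAddCommGroup F'] {a : ℕ → X → F} {b : X → F} {ψ : X → ℝ} {h : ℕ → X → F'}
    (hψ : MemLp ψ 2 μ) (hh : ∀ k, AEStronglyMeasurable (h k) μ)
    (ht : Tendsto (fun k => eLpNorm (h k) 2 μ) atTop (𝓝 0)) (hb : Integrable b μ)
    (ha : ∀ k, Integrable (a k) μ) (hab : ∀ k, ∀ᵐ x ∂μ, ‖a k x - b x‖ ≤ ‖ψ x‖ * ‖h k x‖) :
    Tendsto (fun k => ∫ x, a k x ∂μ) atTop (𝓝 (∫ x, b x ∂μ)) := by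
  apply tendsto_integral_of_L1' b hb.1 (Eventually.of_forall ha)
  have hfin : eLpNorm ψ 2 μ ≠ ⊤ := hψ.2.ne
  have h0 : Tendsto (fun k => eLpNorm ψ 2 μ * eLpNorm (h k) 2 μ) atTop (𝓝 0) := by
    have := ENNReal.Tendsto.const_mul (a := eLpNorm ψ 2 μ) ht (Or.inr hfin)
    simpa using this
  refine tendsto_of_tendsto_of_tendsto_of_le_of_le tendsto_const_nhds h0 (fun _ => zero_le) fun k => ?_
  have h1 : eLpNorm (a k - b) 1 μ ≤ eLpNorm (fun x => ‖ψ x‖ * ‖h k x‖) 1 μ := by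
    apply eLpNorm_mono_ae
    filter_upwards [hab k] with x hx
    simpa using hx
  refine h1.trans ?_
  have := eLpNorm_le_eLpNorm_mul_eLpNorm_of_nnnorm (p := 2) (q := 2) (r := 1) (μ := μ) (f := ψ) (g := h k) hψ.1 (hh k)
    (fun u v => ‖u‖ * ‖v‖) 1 (aoa _ fun x => by simp)
  simpa using this

theorem unif_L2 {X : Type*} [MeasurableSpace X] {μ : Measure X} {K : Set X} (hK : MeasurableSet K)
    (hKm : μ K ≠ ⊤) {F' : Type*} [NormedAddCommGroup F'] {f : ℕ → X → F'} {f0 : X → F'} (hz : ∀ k, ∀ x ∉ K, f k x = 0)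
    (hz0 : ∀ x ∉ K, f0 x = 0) (hu : TendstoUniformly f f0 atTop) :
    Tendsto (fun k => eLpNorm (fun x => f k x - f0 x) 2 μ) atTop (𝓝 0) := by
  rw [ENNReal.tendsto_nhds_zero]
  intro c hc
  set M := μ K ^ (1 / (2:ℝ)) with hM
  have hMf : M ≠ ⊤ := ENNReal.rpow_ne_top_of_nonneg nz hKm
  obtain ⟨e, he, hec⟩ : ∃ e : ℝ≥0, 0 < e ∧ M * e ≤ c := by
    obtain ⟨e, he, h2⟩ := ENNReal.exists_nnreal_pos_mul_lt hMf hc.ne'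
    exact ⟨e, he, by rw [mul_comm]; exact h2.le⟩
  filter_upwards [Metric.tendstoUniformly_iff.1 hu e (by exact_mod_cast he)] with k hk
  have h1 : eLpNorm (fun x => f k x - f0 x) 2 μ = eLpNorm (fun x => f k x - f0 x) 2 (μ.restrict K) := by
    rw [← eLpNorm_indicator_eq_eLpNorm_restrict hK]
    congr 1
    ext x
    by_cases hx : x ∈ K
    · simp [hx]
    · simp [hx, hz k x hx, hz0 x hx]
  rw [h1]
  refine (eLpNorm_le_of_ae_bound (C := e) (aoa _ fun x => ?_)).trans ?_
  · have := (hk x).le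
    rw [dist_comm, dist_eq_norm] at this
    exact this
  · simpa [hM] using hec

theorem grad_cont {ψ : E → ℝ} (h : Sm ψ) : Continuous (gradient ψ) := by
  unfold gradient
  exact (LinearIsometryEquiv.continuous _).comp (h.continuous_fderiv sz)

theorem grad_hcs {ψ : E → ℝ} (h : Hcs ψ) : Hcs (gradient ψ) := by
  unfold gradient
  exact (h.fderiv ℝ).comp_left sz

theorem cc_memLp {F : Type*} [NormedAddCommGroup F] {ψ : E → F} (h : Continuous ψ) (hc : Hcs ψ) (p : ℝ≥0∞) :
    MemLp ψ p volume := h.memLp_of_hasCompactSupport hc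

theorem WG.of_tendsto {K : Set E} (hK : IsCompact K) {f : ℕ → E → ℝ} {g : ℕ → E → E}
    {f0 : E → ℝ} {g0 : E → E} (h : ∀ k, WG K (f k) (g k)) (hu : TendstoUniformly f f0 atTop)
    (hg0 : MemLp g0 2 volume)
    (hg : Tendsto (fun k => eLpNorm (fun x => g k x - g0 x) 2 volume) atTop (𝓝 0)) :
    WG K f0 g0 := by
  have hc : Continuous f0 := hu.continuous (Frequently.of_forall fun k => (h k).cont)
  have hz : ∀ x ∉ K, f0 x = 0 := fun x hx => by
    have h1 := hu.tendsto_at x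
    simp_rw [(h _).zero x hx] at h1
    exact tendsto_nhds_unique h1 tendsto_const_nhds
  refine ⟨hc, hz, hg0, ?_, fun ψ hψ hψc => ?_⟩
  · have h1 : eLpNorm (Kᶜ.indicator g0) 2 volume = 0 := by
      refine le_antisymm (ge_of_tendsto' hg fun k => ?_) zero_le
      apply eLpNorm_mono_ae
      filter_upwards [(h k).gzero] with x hx
      by_cases hxK : x ∈ K
      · simp [hxK]
      · simp [hxK, hx hxK]
    rw [eLpNorm_eq_zero_iff (hg0.1.indicator hK.measurableSet.compl) nz] at h1
    filter_upwards [h1] with x hx hxK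
    simpa [hxK] using hx
  · have hψm := cc_memLp hψ.continuous hψc 2
    have hgm := cc_memLp (grad_cont hψ) (grad_hcs hψc) 2
    have hi : ∀ (g : E → E), MemLp g 2 volume → Integrable (fun x => ψ x • g x) := fun g hg => memLp_one_iff_integrable.1 (hg.smul hψm)
    have hi2 : ∀ (f : E → ℝ), Continuous f → Integrable (fun x => f x • gradient ψ x) := fun f hf =>
      (hf.smul (grad_cont hψ)).integrable_of_hasCompactSupport (grad_hcs hψc).smul_left
    have t1 := tendsto_int_L2 (a := fun k x => ψ x • g k x) (b := fun x => ψ x • g0 x) hψm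
      (fun k => (h k).mem.1.sub hg0.1) hg (hi _ hg0) (fun k => hi _ (h k).mem)
      (fun k => aoa _ fun x => by rw [← smul_sub, norm_smul]; rfl)
    have t2 := tendsto_int_L2 (a := fun k x => f k x • gradient ψ x) (b := fun x => f0 x • gradient ψ x)
      hgm.norm
      (fun k => ((h k).cont.sub hc).aestronglyMeasurable)
      (unif_L2 hK.measurableSet hK.measure_lt_top.ne (fun k => (h k).zero) hz hu) (hi2 _ hc) (fun k => hi2 _ (h k).cont)
      (fun k => aoa _ fun x => by rw [← sub_smul, norm_smul, mul_comm]; simp)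
    simp_rw [(h _).weak ψ hψ hψc] at t2
    exact tendsto_nhds_unique t2 t1.neg

theorem WG.lip {K : Set E} (hK : IsCompact K) {ζ : E → ℝ} {C : ℝ≥0} (hL : Lip C ζ)
    (hz : ∀ x ∉ K, ζ x = 0) : WG K ζ (gradient ζ) := by
  have hcs : Hcs ζ := HasCompactSupport.intro hK hz
  have hgz : ∀ x ∉ K, gradient ζ x = 0 := by
    intro x hx
    have : ζ =ᶠ[𝓝 x] fun _ => 0 := by
      filter_upwards [hK.isClosed.isOpen_compl.mem_nhds hx] with y hy using hz y hy
    unfold gradient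
    rw [this.fderiv_eq]; simp
  have hgm : Measurable (gradient ζ) := by
    unfold gradient
    exact (LinearIsometryEquiv.continuous _).measurable.comp (measurable_fderiv ℝ ζ)
  have hgb : ∀ x, ‖gradient ζ x‖ ≤ C := fun x => by
    unfold gradient
    rw [LinearIsometryEquiv.norm_map]
    exact norm_fderiv_le_of_lipschitz ℝ hL
  have hmem : MemLp (gradient ζ) 2 volume := by
    have h1 : gradient ζ = K.indicator (gradient ζ) := by
      ext1 x
      by_cases hx : x ∈ K
      · simp [hx]
      · simp [hx, hgz x hx]
    rw [h1, memLp_indicator_iff_restrict hK.measurableSet]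
    have : IsFiniteMeasure (volume.restrict K) := ⟨by simpa using hK.measure_lt_top⟩
    exact MemLp.of_bound hgm.aestronglyMeasurable C (aoa _ hgb)
  refine ⟨hL.continuous, hz, hmem, aoa _ hgz, fun ψ hψ hψc => ?_⟩
  obtain ⟨D, hD⟩ := ContDiff.lipschitzWith_of_hasCompactSupport hψc hψ sz
  have i1 : Integrable (fun x => ζ x • gradient ψ x) :=
    (hL.continuous.smul (grad_cont hψ)).integrable_of_hasCompactSupport (grad_hcs hψc).smul_left
  have i2 : Integrable (fun x => ψ x • gradient ζ x) :=
    memLp_one_iff_integrable.1 (hmem.smul (cc_memLp hψ.continuous hψc 2))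
  refine ext_inner_left ℝ fun y => ?_
  rw [inner_neg_right, ← integral_inner i1, ← integral_inner i2]
  have := hL.integral_lineDeriv_mul_eq (μ := volume) hD hψc y
  rw [← integral_neg]
  have e1 : ∫ x, lineDeriv ℝ ζ x y * ψ x = ∫ x, inner ℝ y (ψ x • gradient ζ x) := by
    apply integral_congr_ae
    filter_upwards [hL.ae_differentiableAt (μ := volume)] with x hx
    rw [hx.lineDeriv_eq_fderiv, inner_smul_right, ← inner_gradient_left, real_inner_comm, mul_comm]
  have e2 : ∫ x, lineDeriv ℝ ψ x (-y) * ζ x = ∫ x, - inner ℝ y (ζ x • gradient ψ x) := by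
    congr 1; ext x
    rw [((hψ.differentiable sz) x).lineDeriv_eq_fderiv, inner_smul_right, ← inner_gradient_left, real_inner_comm, mul_comm, inner_neg_left]
    ring
  rw [e1, e2, integral_neg] at this
  rw [integral_neg, this, neg_neg]

theorem WG.smooth {K : Set E} (hK : IsCompact K) {f : E → ℝ} (hf : Sm f) (hs : tsupport f ⊆ K) :
    WG K f (gradient f) := by
  have hz : ∀ x ∉ K, f x = 0 := fun x hx => offs fun h => hx (hs h)
  obtain ⟨D, hD⟩ := ContDiff.lipschitzWith_of_hasCompactSupport (HasCompactSupport.intro hK hz) hf sz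
  exact WG.lip hK hD hz

theorem WG.shrink {K K' : Set E} {f : E → ℝ} {g : E → E} (h : WG K' f g)
    (hf : ∀ x ∉ K, f x = 0) (hg : ∀ᵐ x, x ∉ K → g x = 0) : WG K f g :=
  ⟨h.cont, hf, h.mem, hg, h.weak⟩

theorem WG.bdd {K : Set E} (hK : IsCompact K) {f : E → ℝ} {g : E → E} (h : WG K f g) :
    ∃ M : ℝ, 0 ≤ M ∧ ∀ x, |f x| ≤ M := by
  obtain ⟨M, hM⟩ := (h.hcs hK).exists_bound_of_continuous h.cont
  exact ⟨M, (norm_nonneg _).trans (hM 0), hM⟩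

theorem unif_mul_L2 {a : ℕ → E → ℝ} {a0 : E → ℝ} {g : ℕ → E → E} {g0 : E → E} {M : ℝ}
    (hu : TendstoUniformly a a0 atTop) (hb : ∀ x, |a0 x| ≤ M) (ha : ∀ k, Continuous (a k)) (ha0 : Continuous a0)
    (hgm : ∀ k, MemLp (g k) 2 volume) (hg0 : MemLp g0 2 volume)
    (hg : Tendsto (fun k => eLpNorm (fun x => g k x - g0 x) 2 volume) atTop (𝓝 0)) :
    Tendsto (fun k => eLpNorm (fun x => a k x • g k x - a0 x • g0 x) 2 volume) atTop (𝓝 0) := by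
  rw [ENNReal.tendsto_nhds_zero]
  intro c hc
  have hc2 : c / 2 ≠ 0 := (ENNReal.half_pos hc.ne').ne'
  obtain ⟨e, he, h2⟩ := ENNReal.exists_nnreal_pos_mul_lt hg0.2.ne hc2
  have h3 : Tendsto (fun k => ofReal (M + 1) * eLpNorm (fun x => g k x - g0 x) 2 volume) atTop (𝓝 0) := by
    have := ENNReal.Tendsto.const_mul (a := ofReal (M + 1)) hg (Or.inr ont)
    simpa using this
  filter_upwards [Metric.tendstoUniformly_iff.1 hu e (by exact_mod_cast he),
    Metric.tendstoUniformly_iff.1 hu 1 one_pos,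
    ENNReal.tendsto_nhds_zero.1 h3 (c / 2) (ENNReal.half_pos hc.ne')] with k h4 h5 h6
  have e1 : (fun x => a k x • g k x - a0 x • g0 x) =
      (fun x => a k x • (g k x - g0 x)) + fun x => (a k x - a0 x) • g0 x := by
    ext1 x; simp [smul_sub, sub_smul]
  rw [e1]
  refine (eLpNorm_add_le ((ha k).aestronglyMeasurable.smul ((hgm k).1.sub hg0.1))
    (((ha k).sub ha0).aestronglyMeasurable.smul hg0.1) nz).trans ?_
  rw [← ENNReal.add_halves c]
  refine add_le_add (le_trans ?_ h6) (le_trans ?_ h2.le)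
  · apply eLpNorm_le_mul_eLpNorm_of_ae_le_mul
    refine aoa _ fun x => ?_
    show ‖a k x • (g k x - g0 x)‖ ≤ _
    rw [norm_smul]
    gcongr
    have := h5 x
    rw [dist_comm, Real.dist_eq] at this
    have h7 := hb x
    have := abs_add_le (a k x - a0 x) (a0 x)
    simp only [sub_add_cancel] at this
    rw [norm_eq_abs]; linarith
  · have : (e : ℝ≥0∞) = ofReal e := by simp
    rw [this]
    apply eLpNorm_le_mul_eLpNorm_of_ae_le_mul
    refine aoa _ fun x => ?_
    show ‖(a k x - a0 x) • g0 x‖ ≤ _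
    rw [norm_smul]
    gcongr
    have := (h4 x).le
    rwa [dist_comm, Real.dist_eq] at this

theorem unif_comp {f : ℕ → E → ℝ} {f0 : E → ℝ} {M : ℝ} (hb : ∀ x, |f0 x| ≤ M)
    (hu : TendstoUniformly f f0 atTop) {F : ℝ → ℝ} (hF : Continuous F) :
    TendstoUniformly (fun k x => F (f k x)) (fun x => F (f0 x)) atTop := by
  have hc : UniformContinuousOn F (Icc (-M - 1) (M + 1)) :=
    isCompact_Icc.uniformContinuousOn_of_continuous hF.continuousOn
  refine hc.comp_tendstoUniformly_eventually ?_ ?_ hu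
  · filter_upwards [Metric.tendstoUniformly_iff.1 hu 1 one_pos] with k h5 x
    have h1 := h5 x
    have h2 := hb x
    rw [Real.dist_eq, abs_lt] at h1
    rw [abs_le] at h2
    constructor <;> linarith
  · intro x
    have h2 := hb x
    rw [abs_le] at h2
    constructor <;> linarith

theorem unif_mul {f g : ℕ → E → ℝ} {f0 g0 : E → ℝ} {M N : ℝ} (hb : ∀ x, |f0 x| ≤ M)  (hN : ∀ x, |g0 x| ≤ N)
    (hu : TendstoUniformly f f0 atTop) (hv : TendstoUniformly g g0 atTop) :
    TendstoUniformly (fun k x => f k x * g k x) (fun x => f0 x * g0 x) atTop := by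
  have h1 := unif_comp (M := M + N) (F := fun t => t ^ 2 / 4) (fun x => ?_) (hu.add hv) fz
  have h2 := unif_comp (M := M + N) (F := fun t => t ^ 2 / 4) (fun x => ?_) (hu.sub hv) fz
  have h3 := h1.sub h2
  · convert h3 using 1
    · ext k x; simp; ring
    · ext x; simp; ring
  · exact (abs_sub _ _).trans (add_le_add (hb x) (hN x))
  · exact (abs_add_le _ _).trans (add_le_add (hb x) (hN x))

theorem grad_mul {f g : E → ℝ} {x : E} (hf : DifferentiableAt ℝ f x) (hg : DifferentiableAt ℝ g x) :
    gradient (fun x => f x * g x) x = f x • gradient g x + g x • gradient f x := by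
  unfold gradient
  rw [fderiv_fun_mul hf hg]; simp

theorem grad_comp {f : E → ℝ} {F : ℝ → ℝ} {x : E} (hf : DifferentiableAt ℝ f x) (hF : DifferentiableAt ℝ F (f x)) :
    gradient (fun x => F (f x)) x = deriv F (f x) • gradient f x := by
  unfold gradient
  have : HasFDerivAt (fun x => F (f x)) (deriv F (f x) • fderiv ℝ f x) x := hF.hasDerivAt.comp_hasFDerivAt x hf.hasFDerivAt
  rw [this.fderiv]; simp

theorem WG.mul {K₁ K₂ : Set E} (hK₁ : IsCompact K₁) (hK₂ : IsCompact K₂) {f₁ f₂ : E → ℝ} {g₁ g₂ : E → E}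
    (h₁ : WG K₁ f₁ g₁) (h₂ : WG K₂ f₂ g₂) :
    WG K₁ (fun x => f₁ x * f₂ x) (fun x => f₁ x • g₂ x + f₂ x • g₁ x) := by
  have ht : ∀ K : Set E, K ⊆ interior (cthickening 1 K) := fun K =>
    (self_subset_thickening one_pos K).trans (thickening_subset_interior_cthickening _ _)
  obtain ⟨F, a1, a2, a3, a4⟩ := h₁.approx hK₁ (ht K₁)
  obtain ⟨G, b1, b2, b3, b4⟩ := h₂.approx hK₂ (ht K₂)
  obtain ⟨M, hM, hMb⟩ := h₁.bdd hK₁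
  obtain ⟨N, hN, hNb⟩ := h₂.bdd hK₂
  have hC₁ := hK₁.cthickening (r := 1)
  have hC₂ := hK₂.cthickening (r := 1)
  have m1 : ∀ k, MemLp (gradient (F k)) 2 volume := fun k => (WG.smooth hC₁ (a1 k) (a2 k)).mem
  have m2 : ∀ k, MemLp (gradient (G k)) 2 volume := fun k => (WG.smooth hC₂ (b1 k) (b2 k)).mem
  have s1 := unif_mul_L2 a3 hMb (fun k => (a1 k).continuous) h₁.cont m2 h₂.mem b4
  have s2 := unif_mul_L2 b3 hNb (fun k => (b1 k).continuous) h₂.cont m1 h₁.mem a4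
  have mb : ∀ {a : E → ℝ} {g : E → E} {M : ℝ}, Continuous a → (∀ x, |a x| ≤ M) → MemLp g 2 volume → MemLp (fun x => a x • g x) 2 volume := by
    intro a g M ha hb hg
    exact MemLp.of_le_mul (c := M) hg (ha.aestronglyMeasurable.smul hg.1) (aoa _ fun x => by
      rw [norm_smul]; gcongr; exact hb x)
  have mem := (mb h₁.cont hMb h₂.mem).add (mb h₂.cont hNb h₁.mem)
  have main : WG (cthickening 1 K₁) (fun x => f₁ x * f₂ x) (fun x => f₁ x • g₂ x + f₂ x • g₁ x) := by
    refine WG.of_tendsto hC₁ (f := fun k x => F k x * G k x)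
      (g := fun k x => F k x • gradient (G k) x + G k x • gradient (F k) x) (fun k => ?_)
      (unif_mul hMb hNb a3 b3) mem ?_
    · have := WG.smooth hC₁ ((a1 k).mul (b1 k)) ((closure_mono (Function.support_mul_subset_left _ _)).trans (a2 k))
      refine this.congr (aoa _ fun x => ?_)
      exact grad_mul ((a1 k).differentiable sz x) ((b1 k).differentiable sz x)
    · have := s1.add s2
      rw [add_zero] at this
      refine tendsto_of_tendsto_of_tendsto_of_le_of_le tendsto_const_nhds this (fun _ => zero_le) fun k => ?_
      refine le_trans (le_of_eq ?_) (eLpNorm_add_le (((a1 k).continuous.aestronglyMeasurable.smul (m2 k).1).sub (h₁.cont.aestronglyMeasurable.smul h₂.mem.1))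
        (((b1 k).continuous.aestronglyMeasurable.smul (m1 k).1).sub (h₂.cont.aestronglyMeasurable.smul h₁.mem.1)) nz)
      congr 1
      ext1 x
      simp only [Pi.add_apply, Pi.sub_apply, Pi.smul_apply']
      abel
  refine main.shrink (fun x hx => by simp [h₁.zero x hx]) ?_
  filter_upwards [h₁.gzero] with x h hx
  simp [h hx, h₁.zero x hx]

theorem WG.comp {K : Set E} (hK : IsCompact K) {f : E → ℝ} {g : E → E}
    (h : WG K f g) {F : ℝ → ℝ} (hF : Sm F) (hF0 : F 0 = 0) :
    WG K (fun x => F (f x)) (fun x => deriv F (f x) • g x) := by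
  have ht : ∀ K : Set E, K ⊆ interior (cthickening 1 K) := fun K =>
    (self_subset_thickening one_pos K).trans (thickening_subset_interior_cthickening _ _)
  obtain ⟨G, a1, a2, a3, a4⟩ := h.approx hK (ht K)
  obtain ⟨M, hM, hMb⟩ := h.bdd hK
  have hC := hK.cthickening (r := 1)
  have m1 : ∀ k, MemLp (gradient (G k)) 2 volume := fun k => (WG.smooth hC (a1 k) (a2 k)).mem
  have hdF : Continuous (deriv F) := hF.continuous_deriv sz
  obtain ⟨N, hN⟩ := (isCompact_Icc (a := -M) (b := M)).exists_bound_of_continuousOn hdF.continuousOn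
  have hNb : ∀ x, |deriv F (f x)| ≤ N := fun x => hN _ (abs_le.1 (hMb x))
  have hc : Continuous fun x => deriv F (f x) := hdF.comp h.cont
  have s1 := unif_mul_L2 (unif_comp hMb a3 hdF) hNb (fun k => hdF.comp (a1 k).continuous) hc m1 h.mem a4
  have main : WG (cthickening 1 K) (fun x => F (f x)) (fun x => deriv F (f x) • g x) := by
    refine WG.of_tendsto hC (f := fun k x => F (G k x)) (fun k => ?_)
      (unif_comp hMb a3 hF.continuous) ?_ s1
    · have := WG.smooth hC (f := fun x => F (G k x)) (hF.comp (a1 k)) ((closure_mono fun x hx => ?_).trans (a2 k))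
      · refine this.congr (aoa _ fun x => ?_)
        exact grad_comp ((a1 k).differentiable sz x) (hF.differentiable sz _)
      · intro h0
        exact hx (by simp [h0, hF0])
    · exact MemLp.of_le_mul (c := N) h.mem (hc.aestronglyMeasurable.smul h.mem.1) (aoa _ fun x => by
        rw [norm_smul]; gcongr; exact hNb x)
  refine main.shrink (fun x hx => by simp [h.zero x hx, hF0]) ?_
  filter_upwards [h.gzero] with x h hx
  simp [h hx]

def wt (d : ℝ) (Γ : Set E) (x : E) : ℝ := dst x Γ ^ (d + 1 - (dimE : ℝ))

structure Core (d cB : ℝ) (Γ : Set E) (A : E → E →L[ℝ] E) (B : Set E) (U : E → ℝ) (G : E → E) : Prop where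
  closed : IsClosed Γ
  ne : Γ.Nonempty
  cont : ContinuousOn U Γᶜ
  nonneg : ∀ x, 0 ≤ U x
  zeroΓ : ∀ x ∈ Γ, U x = 0
  cs : ∃ K, IsCompact K ∧ ∀ x ∉ K, U x = 0
  integ : Integrable U volume
  trace : ∀ᵐ z ∂(μH[d].restrict Γ), Tendsto (fun ρ : ℝ => ⨍ y in ball z ρ, U y) (𝓝[>] (0 : ℝ)) (𝓝 0)
  Gm : AEStronglyMeasurable G volume
  Gfin : ∫⁻ x, ofReal (‖G x‖ ^ 2 * wt d Γ x) < ⊤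
  weak : ∀ φ : E → ℝ, Sm φ → Hcs φ → tsupport φ ⊆ Γᶜ →
    ∫ x, U x • gradient φ x = -∫ x, φ x • G x
  C1 : 1 ≤ cB
  Am : AEStronglyMeasurable A volume
  bd : ∀ x ∉ Γ, ∀ ξ ζ, |inner ℝ (A x ξ) ζ| ≤ cB * wt d Γ x * ‖ξ‖ * ‖ζ‖
  ell : ∀ x ∉ Γ, ∀ ξ, cB⁻¹ * wt d Γ x * ‖ξ‖ ^ 2 ≤ inner ℝ (A x ξ) ξ
  Bo : IsOpen B
  sol : ∀ φ : E → ℝ, Sm φ → Hcs φ → tsupport φ ⊆ B \ Γ →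
    ∫ x, inner ℝ (A x (G x)) (gradient φ x) = 0

theorem dl_pos {Γ : Set E} (hc : IsClosed Γ) (hne : Γ.Nonempty) {x : E} (hx : x ∉ Γ) : 0 < dst x Γ :=
  (hc.notMem_iff_infDist_pos hne).1 hx

theorem wt_pos {d : ℝ} {Γ : Set E} (hc : IsClosed Γ) (hne : Γ.Nonempty) {x : E} (hx : x ∉ Γ) : 0 < wt d Γ x :=
  Real.rpow_pos_of_pos (dl_pos hc hne hx) _

theorem wt_nonneg {d : ℝ} {Γ : Set E} (x : E) : 0 ≤ wt d Γ x := Real.rpow_nonneg infDist_nonneg _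

theorem wt_meas {d : ℝ} {Γ : Set E} : Measurable (wt d Γ) := by
  unfold wt
  exact (measurable_infDist).pow_const _

theorem wt_cont {d : ℝ} {Γ : Set E} (hc : IsClosed Γ) (hne : Γ.Nonempty) : ContinuousOn (wt d Γ) Γᶜ := by
  unfold wt
  exact (continuous_infDist_pt Γ).continuousOn.rpow_const fun x hx => Or.inl (dl_pos hc hne hx).ne'

theorem wt_bounds {d : ℝ} {Γ K : Set E} (hc : IsClosed Γ) (hne : Γ.Nonempty) (hK : IsCompact K) (hKΓ : K ⊆ Γᶜ) :
    ∃ a b : ℝ, 0 < a ∧ 0 < b ∧ ∀ x ∈ K, a ≤ wt d Γ x ∧ wt d Γ x ≤ b := by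
  rcases K.eq_empty_or_nonempty with rfl | hKn
  · exact ⟨1, 1, one_pos, one_pos, by simp⟩
  obtain ⟨x, hx, h1⟩ := hK.exists_isMinOn hKn ((wt_cont (d := d) hc hne).mono hKΓ)
  obtain ⟨y, hy, h2⟩ := hK.exists_isMaxOn hKn ((wt_cont (d := d) hc hne).mono hKΓ)
  exact ⟨wt d Γ x, wt d Γ y, wt_pos hc hne (hKΓ hx), wt_pos hc hne (hKΓ hy), fun z hz => ⟨h1 hz, h2 hz⟩⟩

theorem exists_cutoff {K V : Set E} (hK : IsCompact K) (hV : IsOpen V) (hKV : K ⊆ V) :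
    ∃ χ : E → ℝ, Sm χ ∧ Hcs χ ∧ tsupport χ ⊆ V ∧ (∀ᶠ x in 𝓝ˢ K, χ x = 1) ∧
      ∀ x, χ x ∈ Icc (0 : ℝ) 1 := by
  obtain ⟨K', hK', h1, h2⟩ := exists_compact_between hK hV hKV
  obtain ⟨f, f1, f2, f3⟩ := exists_contMDiffMap_one_nhds_of_subset_interior (n := (⊤ : ℕ∞)) (modelWithCornersSelf ℝ E) hK.isClosed h1
  have ht : tsupport f ⊆ K' := closure_minimal (fun x hx => by
    by_contra h; exact hx (f2 x h)) hK'.isClosed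
  exact ⟨f, contMDiff_iff_contDiff.1 f.contMDiff, HasCompactSupport.intro hK' f2, ht.trans h2, f1, f3⟩

namespace Core
variable {d cB : ℝ} {Γ B : Set E} {A : E → E →L[ℝ] E} {U : E → ℝ} {G : E → E}

theorem memG (h : Core d cB Γ A B U G) {K : Set E} (hK : IsCompact K) (hKΓ : K ⊆ Γᶜ) : MemLp (K.indicator G) 2 volume := by
  obtain ⟨a, b, ha, hb, hab⟩ := wt_bounds (d := d) h.closed h.ne hK hKΓ
  refine ⟨h.Gm.indicator hK.measurableSet, ?_⟩
  rw [eLpNorm_lt_top_iff_lintegral_rpow_enorm_lt_top nz nz]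
  have h1 : ∫⁻ x, ‖K.indicator G x‖ₑ ^ (2:ℝ) ≤ ∫⁻ x, ofReal a⁻¹ * ofReal (‖G x‖ ^ 2 * wt d Γ x) := by
    apply lintegral_mono
    intro x
    by_cases hx : x ∈ K
    · simp only [iom hx]
      rw [← ofReal_norm, ofReal_rpow_of_nonneg (norm_nonneg _) nz, ← ofReal_mul pz]
      apply ole
      have := (hab x hx).1
      have h2 : 1 ≤ a⁻¹ * wt d Γ x := by rw [inv_mul_eq_div, le_div_iff₀ ha]; linarith
      have h3 : 0 ≤ ‖G x‖ ^ 2 := by positivity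
      rw [Real.rpow_two]
      nlinarith
    · simp [hx]
  have h2 : (2:ℝ≥0∞).toReal = 2 := by simp
  rw [h2]
  refine lt_of_le_of_lt h1 ?_
  rw [lcm _ _ ont]
  exact ENNReal.mul_lt_top ofReal_lt_top h.Gfin

theorem loc (h : Core d cB Γ A B U G) {χ : E → ℝ} (hχ : Sm χ) (hc : Hcs χ)
    (hs : tsupport χ ⊆ Γᶜ) : WG (tsupport χ) (fun x => χ x * U x) (fun x => U x • gradient χ x + χ x • G x) := by
  have hz : ∀ x ∉ tsupport χ, χ x = 0 := fun x hx => offs hx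
  have hgz : ∀ x ∉ tsupport χ, gradient χ x = 0 := fun x hx => by
    unfold gradient
    rw [image_eq_zero_of_notMem_tsupport (f := fderiv ℝ χ) fun h => hx (tsupport_fderiv_subset ℝ h)]; simp
  have hK : IsCompact (tsupport χ) := hc
  have cU : Continuous fun x => χ x * U x := by
    rw [continuous_iff_continuousAt]
    intro x
    by_cases hx : x ∈ Γ
    · have : (fun x => χ x * U x) =ᶠ[𝓝 x] fun _ => 0 := by
        filter_upwards [(isClosed_tsupport χ).isOpen_compl.mem_nhds fun h => hs h hx] with y hy
        simp [hz y hy]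
      exact this.continuousAt
    · exact hχ.continuous.continuousAt.mul (h.cont.continuousAt (h.closed.isOpen_compl.mem_nhds hx))
  have cG : Continuous fun x => U x • gradient χ x := by
    rw [continuous_iff_continuousAt]
    intro x
    by_cases hx : x ∈ Γ
    · have : (fun x => U x • gradient χ x) =ᶠ[𝓝 x] fun _ => 0 := by
        filter_upwards [(isClosed_tsupport χ).isOpen_compl.mem_nhds fun h => hs h hx] with y hy
        simp [hgz y hy]
      exact this.continuousAt
    · exact (h.cont.continuousAt (h.closed.isOpen_compl.mem_nhds hx)).smul (grad_cont hχ).continuousAt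
  have sG : Hcs fun x => U x • gradient χ x := (grad_hcs hc).smul_left
  obtain ⟨M, hM⟩ := hc.exists_bound_of_continuous hχ.continuous
  have m2 : MemLp (fun x => χ x • G x) 2 volume := by
    refine MemLp.of_le_mul (c := M) (h.memG hK hs) (hχ.continuous.aestronglyMeasurable.smul h.Gm) (aoa _ fun x => ?_)
    by_cases hx : x ∈ tsupport χ
    · simp only [iom hx]
      show ‖χ x • G x‖ ≤ _
      rw [norm_smul]; gcongr; exact hM x
    · simp [hx, hz x hx]
  refine ⟨cU, fun x hx => by simp [hz x hx], (cc_memLp cG sG 2).add m2,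
    aoa _ fun x hx => by simp [hz x hx, hgz x hx], fun ψ hψ hψc => ?_⟩
  have hw := h.weak (fun x => χ x * ψ x) (hχ.mul hψ) hc.mul_right ((closure_mono (Function.support_mul_subset_left _ _)).trans hs)
  have e1 : ∀ x, U x • gradient (fun x => χ x * ψ x) x = (χ x * U x) • gradient ψ x + ψ x • (U x • gradient χ x) := fun x => by
    rw [grad_mul (hχ.differentiable sz x) (hψ.differentiable sz x), smul_add, smul_smul, smul_smul, smul_smul, mul_comm (U x), mul_comm (U x)]
  simp_rw [e1] at hw
  have i1 : Integrable fun x => (χ x * U x) • gradient ψ x :=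
    (cU.smul (grad_cont hψ)).integrable_of_hasCompactSupport (grad_hcs hψc).smul_left
  have i2 : Integrable fun x => ψ x • (U x • gradient χ x) :=
    (hψ.continuous.smul cG).integrable_of_hasCompactSupport sG.smul_left
  have i3 : Integrable fun x => ψ x • (χ x • G x) := memLp_one_iff_integrable.1 (m2.smul (cc_memLp hψ.continuous hψc 2))
  rw [integral_add i1 i2] at hw
  simp_rw [smul_add]
  rw [integral_add i2 i3, eq_sub_of_add_eq hw, neg_add, sub_eq_add_neg, add_comm]
  congr 3; ext x; rw [smul_smul, mul_comm]

theorem comp (h : Core d cB Γ A B U G) {K : Set E} (hK : IsCompact K) (hKΓ : K ⊆ Γᶜ) {ζ : E → ℝ} {L : ℝ≥0}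
    (hL : Lip L ζ) (hz : ∀ x ∉ K, ζ x = 0) {F : ℝ → ℝ} (hF : Sm F) :
    WG K (fun x => ζ x * F (U x)) (fun x => F (U x) • gradient ζ x + (ζ x * deriv F (U x)) • G x) := by
  obtain ⟨χ, c1, c2, c3, c4, c5⟩ := exists_cutoff hK h.closed.isOpen_compl hKΓ
  have w1 := h.loc c1 c2 c3
  have w2 := w1.comp c2 (F := fun t => F t - F 0) (hF.sub contDiff_const) sz
  have w0 := WG.lip hK hL hz
  have w3 := w0.mul hK c2 w2
  have hKn : ∀ x ∈ K, χ =ᶠ[𝓝 x] fun _ => 1 := fun x hx => eventually_nhdsSet_iff_forall.1 c4 x hx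
  have w4 : WG K (fun x => F 0 * ζ x) (fun x => F 0 • gradient ζ x) := by
    have hLL : Lip (‖F 0‖₊ * L) (fun x => F 0 * ζ x) := by
      have := (lipschitzWith_smul (F 0)).comp hL
      exact this
    refine (WG.lip hK hLL (fun x hx => by simp [hz x hx])).congr (by
      filter_upwards [hL.ae_differentiableAt (μ := volume)] with x hx
      unfold gradient
      rw [fderiv_const_mul hx]; simp)
  have hu : ∀ x, ζ x * F (U x) = F 0 * ζ x + ζ x * (F (χ x * U x) - F 0) := fun x => by
    by_cases hx : x ∈ K
    · rw [(hKn x hx).eq_of_nhds]; simp; ring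
    · simp [hz x hx]
  have hd : ∀ t, deriv (fun t => F t - F 0) t = deriv F t := fun t => by simp
  have w5 : WG K (fun x => F 0 * ζ x + ζ x * (F (χ x * U x) - F 0)) (fun x => F 0 • gradient ζ x + (ζ x • deriv (fun t => F t - F 0) (χ x * U x) • (U x • gradient χ x + χ x • G x) + (F (χ x * U x) - F 0) • gradient ζ x)) := by
    refine ⟨w4.cont.add w3.cont, fun x hx => by simp [hz x hx], w4.mem.add w3.mem, ?_, fun ψ h1 h2 => ?_⟩
    · filter_upwards [w4.gzero, w3.gzero] with x a b hx
      have := a hx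
      have h3 := b hx
      rw [this, h3, add_zero]
    · have ig : ∀ f : E → ℝ, Continuous f → Integrable fun x => f x • gradient ψ x := fun f hf =>
        (hf.smul (grad_cont h1)).integrable_of_hasCompactSupport (grad_hcs h2).smul_left
      have iq : ∀ g : E → E, MemLp g 2 volume → Integrable fun x => ψ x • g x := fun g hg =>
        memLp_one_iff_integrable.1 (hg.smul (cc_memLp h1.continuous h2 2))
      simp_rw [add_smul, smul_add (ψ _) (F 0 • gradient ζ _)]
      rw [integral_add (ig _ w4.cont) (ig _ w3.cont), integral_add (iq _ w4.mem) (iq _ w3.mem), w4.weak ψ h1 h2, w3.weak ψ h1 h2, neg_add]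
  have w6 := w5.congr (g' := fun x => F (U x) • gradient ζ x + (ζ x * deriv F (U x)) • G x) (by
    filter_upwards [w0.gzero] with x hx0
    by_cases hx : x ∈ K
    · have e2 : gradient χ x = 0 := by
        unfold gradient
        rw [(hKn x hx).fderiv_eq]; simp
      rw [(hKn x hx).eq_of_nhds, e2, hd]
      simp only [one_mul, smul_zero, zero_add, one_smul, sub_smul, smul_smul]
      abel
    · simp [hz x hx, hx0 hx])
  simpa only [hu] using w6
end Core

theorem dct_L2 {X F : Type*} [MeasurableSpace X] {μ : Measure X} [NormedAddCommGroup F] {g : ℕ → X → F} {g0 : X → F} {b : X → ℝ}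
    (hm : ∀ k, AEStronglyMeasurable (g k) μ) (hb : MemLp b 2 μ) (hgb : ∀ k, ∀ᵐ x ∂μ, ‖g k x‖ ≤ b x)
    (ht : ∀ᵐ x ∂μ, Tendsto (fun k => g k x) atTop (𝓝 (g0 x))) :
    MemLp g0 2 μ ∧ Tendsto (fun k => eLpNorm (fun x => g k x - g0 x) 2 μ) atTop (𝓝 0) := by
  have hm0 := aestronglyMeasurable_of_tendsto_ae atTop hm ht
  have hb0 : ∀ᵐ x ∂μ, ‖g0 x‖ ≤ b x := by
    filter_upwards [ht, ae_all_iff.2 hgb] with x h1 h2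
    exact le_of_tendsto h1.norm (Eventually.of_forall h2)
  have hM : MemLp g0 2 μ := MemLp.of_le hb hm0 (by filter_upwards [hb0] with x hx using hx.trans (le_abs_self _))
  refine ⟨hM, ?_⟩
  simp_rw [eLpNorm_eq_lintegral_rpow_enorm_toReal (p := 2) nz nz, ENNReal.toReal_ofNat]
  have h2b := (hb.const_mul 2)
  have := (eLpNorm_lt_top_iff_lintegral_rpow_enorm_lt_top nz nz).1 h2b.2
  have key : Tendsto (fun k => ∫⁻ x, ‖g k x - g0 x‖ₑ ^ (2:ℝ) ∂μ) atTop (𝓝 (∫⁻ x, 0 ∂μ)) := by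
    refine tendsto_lintegral_of_dominated_convergence' (fun x => ‖2 * b x‖ₑ ^ (2:ℝ))
      (fun k => ((hm k).sub hm0).enorm.pow_const _) (fun k => ?_) ?_ ?_
    · filter_upwards [hb0, hgb k] with x h1 h2
      have h3 : ‖g k x - g0 x‖ₑ ≤ ‖2 * b x‖ₑ := by
        rw [enorm_le_iff_norm_le]
        refine (norm_sub_le _ _).trans ((add_le_add h2 h1).trans ?_)
        rw [← two_mul]; exact le_abs_self _
      exact ENNReal.rpow_le_rpow h3 nz
    · simpa using this.ne
    · filter_upwards [ht] with x hx
      have h4 : Tendsto (fun k => ‖g k x - g0 x‖ₑ) atTop (𝓝 0) := by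
        have := (hx.sub_const (g0 x)).enorm
        simpa using this
      simpa using h4.ennrpow_const 2
  simp only [lintegral_zero] at key
  simpa using key.ennrpow_const (1/2)

theorem lip_mul {X : Type*} [PseudoMetricSpace X] {f g : X → ℝ} {L L' : ℝ≥0} {M N : ℝ≥0} (hf : Lip L f) (hg : Lip L' g)
    (hM : ∀ x, |f x| ≤ M) (hN : ∀ x, |g x| ≤ N) : Lip (M * L' + N * L) fun x => f x * g x := by
  refine LipschitzWith.of_dist_le_mul fun x y => ?_
  have h1 := hf.dist_le_mul x y
  have h2 := hg.dist_le_mul x y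
  rw [Real.dist_eq] at *
  have : f x * g x - f y * g y = f x * (g x - g y) + g y * (f x - f y) := by ring
  rw [this]
  refine (abs_add_le _ _).trans ?_
  rw [abs_mul, abs_mul]
  push_cast
  have := mul_le_mul (hM x) h2 (abs_nonneg _) M.2
  have := mul_le_mul (hN y) h1 (abs_nonneg _) N.2
  linarith

theorem lip_bdd {K : Set E} (hK : IsCompact K) {ζ : E → ℝ} {L : ℝ≥0}
    (hL : Lip L ζ) (hz : ∀ x ∉ K, ζ x = 0) : ∃ M : ℝ≥0, ∀ x, |ζ x| ≤ M := by
  obtain ⟨M, h0, hM⟩ := (WG.lip hK hL hz).bdd hK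
  exact ⟨⟨M, h0⟩, hM⟩

theorem abs_one_of_sq {s : ℝ} (hs : s ^ 2 = 1) : |s| = 1 :=
  (pow_eq_one_iff_of_nonneg (abs_nonneg s) two_ne_zero).1 (by rw [sq_abs]; exact hs)

def Ch (Γ : Set E) (U : E → ℝ) (G : E → E) (F H : ℝ → ℝ) : Prop :=
  ∀ K, IsCompact K → K ⊆ Γᶜ → ∀ (ζ : E → ℝ) (L : ℝ≥0), Lip L ζ → (∀ x ∉ K, ζ x = 0) →
    WG K (fun x => ζ x * F (U x)) (fun x => F (U x) • gradient ζ x + (ζ x * H (U x)) • G x)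

namespace Core
variable {d cB : ℝ} {Γ B : Set E} {A : E → E →L[ℝ] E} {U : E → ℝ} {G : E → E}

theorem ch (h : Core d cB Γ A B U G) {F : ℝ → ℝ} (hF : Sm F) : Ch Γ U G F (deriv F) :=
  fun K hK hKΓ ζ L hL hz => h.comp hK hKΓ hL hz hF

theorem ch_lim (h : Core d cB Γ A B U G) {F : ℕ → ℝ → ℝ} {H : ℕ → ℝ → ℝ} {F0 H0 : ℝ → ℝ}
    (hF : ∀ k, Ch Γ U G (F k) (H k)) (hu : TendstoUniformly F F0 atTop) (hH : ∀ t, Tendsto (fun k => H k t) atTop (𝓝 (H0 t)))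
    (hb : ∀ k t, |H k t| ≤ 1) (hFb : ∀ k t, |F k t - F0 t| ≤ 1) (hF0 : Continuous F0) : Ch Γ U G F0 H0 := by
  intro K hK hKΓ ζ L hL hz
  have w := fun k => hF k K hK hKΓ ζ L hL hz
  have wl := WG.lip hK hL hz
  obtain ⟨M, hM⟩ := lip_bdd hK hL hz
  obtain ⟨N, hN⟩ : ∃ N : ℝ, ∀ x ∈ K, |F0 (U x)| ≤ N := by
    obtain ⟨N, hN⟩ := hK.exists_bound_of_continuousOn (hF0.comp_continuousOn (h.cont.mono hKΓ))
    exact ⟨N, hN⟩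
  have hb2 : MemLp (fun x => (N + 1) * ‖gradient ζ x‖ + M * ‖K.indicator G x‖) 2 volume :=
    (wl.mem.norm.const_mul (N+1)).add ((h.memG hK hKΓ).norm.const_mul (M:ℝ))
  have key := dct_L2 (g0 := fun x => F0 (U x) • gradient ζ x + (ζ x * H0 (U x)) • G x) (fun k => (w k).mem.1) hb2 (fun k => ?_) ?_
  · refine WG.of_tendsto hK w ?_ key.1 key.2
    rw [Metric.tendstoUniformly_iff] at hu ⊢
    intro ε hε
    filter_upwards [hu (ε / (M + 1)) pz] with k hk x
    have := hk (U x)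
    rw [Real.dist_eq] at *
    rw [← mul_sub, abs_mul]
    rw [lt_div_iff₀ pz] at this
    have h1 := hM x
    have h2 := abs_nonneg (F0 (U x) - F k (U x))
    have := mrn h1 h2
    nlinarith
  · filter_upwards [wl.gzero] with x hx
    by_cases hxK : x ∈ K
    · rw [iom hxK]
      refine (norm_add_le _ _).trans ?_
      rw [norm_smul, norm_smul, norm_eq_abs, norm_eq_abs, abs_mul]
      have h1 := hFb k (U x)
      have h2 : |F k (U x)| ≤ N + 1 := by
        have := abs_sub_abs_le_abs_sub (F k (U x)) (F0 (U x))
        linarith [hN x hxK]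
      have h3 := mul_le_mul (hM x) (hb k (U x)) (abs_nonneg _) M.2
      gcongr
      simpa using h3
    · simp [hxK, hx hxK, hz x hxK]
  · refine aoa _ fun x => ?_
    exact ((hu.tendsto_at (U x)).smul_const _).add (((hH (U x)).const_mul (ζ x)).smul_const _)

theorem ch_pos (h : Core d cB Γ A B U G) {s k : ℝ} (hs : s ^ 2 = 1) :
    Ch Γ U G (fun t => max (s * (t - k)) 0) (fun t => (s + SignType.sign (t - k)) / 2) := by
  let e : ℕ → ℝ := fun m => 1 / ((m:ℝ) + 1)
  have he : ∀ m, 0 < e m := fun m => by positivity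
  have he1 : ∀ m, e m ≤ 1 := fun m => by
    show 1 / ((m:ℝ) + 1) ≤ 1
    rw [div_le_one pz]; simp
  have het : Tendsto e atTop (𝓝 0) := tendsto_one_div_add_atTop_nhds_zero_nat
  have hq : ∀ m t, 0 < (t - k) ^ 2 + e m ^ 2 := fun m t => by have := he m; positivity
  let F : ℕ → ℝ → ℝ := fun m t => (s * (t - k) + √((t - k) ^ 2 + e m ^ 2)) / 2
  have hF : ∀ m, Sm (F m) := fun m => by
    have : Sm fun t => √((t - k) ^ 2 + e m ^ 2) :=
      ContDiff.sqrt fz fun t => (hq m t).ne'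
    show Sm fun t => (s * (t - k) + √((t - k) ^ 2 + e m ^ 2)) / 2
    fun_prop
  have hd : ∀ m t, deriv (F m) t = (s + (t - k) / √((t - k) ^ 2 + e m ^ 2)) / 2 := fun m t => by
    have h1 : HasDerivAt (fun t => (t - k) ^ 2 + e m ^ 2) (2 * (t - k)) t := by
      have := (((hasDerivAt_id t).sub_const k).pow 2).add_const (e m ^ 2)
      simpa using this
    have h2 := ((((hasDerivAt_id t).sub_const k).const_mul s).add (h1.sqrt (hq m t).ne')).div_const 2
    refine h2.deriv.trans ?_
    have := Real.sqrt_pos.2 (hq m t)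
    field_simp
  have hmx : ∀ t, max (s * (t - k)) 0 = (s * (t - k) + |t - k|) / 2 := fun t => by
    have : |t - k| = |s * (t - k)| := by
      rw [abs_mul, (abs_one_of_sq hs), one_mul]
    rw [this]
    rcases le_total 0 (s * (t - k)) with h | h
    · rw [max_eq_left h, abn h]; ring
    · rw [max_eq_right h, abs_of_nonpos h]; ring
  have hFd : ∀ m t, |F m t - max (s * (t - k)) 0| ≤ e m := fun m t => by
    rw [hmx, show F m t - (s * (t - k) + |t - k|) / 2 = (√((t - k) ^ 2 + e m ^ 2) - |t - k|) / 2 by simp only [F]; ring]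
    have h1 : |t - k| ≤ √((t - k) ^ 2 + e m ^ 2) := Real.abs_le_sqrt (by nlinarith [he m])
    have h2 : √((t - k) ^ 2 + e m ^ 2) ≤ |t - k| + e m := by
      rw [Real.sqrt_le_left (by have := he m; positivity)]
      nlinarith [sq_abs (t - k), mul_nonneg (abs_nonneg (t-k)) (he m).le]
    rw [abn lz]
    linarith [he m]
  refine h.ch_lim (F := F) (H := fun m => deriv (F m)) (fun m => h.ch (hF m)) ?_ (fun t => ?_) (fun m t => ?_) (fun m t => (hFd m t).trans (he1 m)) fz
  · rw [Metric.tendstoUniformly_iff]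
    intro ε hε
    filter_upwards [het.eventually (gt_mem_nhds hε)] with m hm t
    rw [dist_comm, Real.dist_eq]
    exact (hFd m t).trans_lt hm
  · simp_rw [hd]
    refine (Tendsto.const_add s ?_).div_const 2
    rcases eq_or_ne (t - k) 0 with h0 | h0
    · simp [h0]
    · have h1 : Tendsto (fun m => √((t - k) ^ 2 + e m ^ 2)) atTop (𝓝 |t - k|) := by
        rw [← Real.sqrt_sq_eq_abs]
        have := ((het.pow 2).const_add ((t - k) ^ 2)).sqrt
        simpa using this
      have h2 := (tendsto_const_nhds (x := t - k)).div h1 (abs_ne_zero.2 h0)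
      have : (t - k) / |t - k| = ((SignType.sign (t - k) : SignType) : ℝ) := by
        rw [div_eq_iff (abs_ne_zero.2 h0), mul_comm, abs_mul_sign]
      rw [← this]; exact h2
  · rw [hd]
    have h0 := Real.sqrt_pos.2 (hq m t)
    have h1 : |(t - k) / √((t - k) ^ 2 + e m ^ 2)| ≤ 1 := by
      rw [abs_div, abs_of_pos h0, div_le_one h0]
      exact Real.abs_le_sqrt (by nlinarith [he m])
    have h2 : |s| = 1 := abs_one_of_sq hs
    rw [abs_div, abs_two, div_le_one nz]
    exact (abs_add_le _ _).trans lz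
end Core

theorem Ch.neg {Γ : Set E} {U : E → ℝ} {G : E → E} {F H : ℝ → ℝ} (h : Ch Γ U G F H) :
    Ch Γ U G (fun t => - F t) (fun t => - H t) := by
  intro K hK hKΓ ζ L hL hz
  have := h K hK hKΓ (fun x => - ζ x) L hL.neg (fun x hx => by simp [hz x hx])
  have e : ∀ x, gradient (fun x => - ζ x) x = - gradient ζ x := fun x => by
    unfold gradient; rw [fderiv_fun_neg]; simp
  simp_rw [e] at this
  convert this using 2 <;> simp

theorem Ch.sq {Γ : Set E} {U : E → ℝ} {G : E → E} {F H : ℝ → ℝ} (hΓ : IsClosed Γ) (h : Ch Γ U G F H) :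
    Ch Γ U G (fun t => F t ^ 2) (fun t => 2 * F t * H t) := by
  intro K hK hKΓ ζ L hL hz
  obtain ⟨χ, c1, c2, c3, c4, c5⟩ := exists_cutoff hK hΓ.isOpen_compl hKΓ
  obtain ⟨L', hL'⟩ := ContDiff.lipschitzWith_of_hasCompactSupport c2 c1 sz
  have w1 := h K hK hKΓ ζ L hL hz
  have w2 := h (tsupport χ) c2 c3 χ L' hL' (fun x hx => offs hx)
  have hKn : ∀ x ∈ K, χ =ᶠ[𝓝 x] fun _ => 1 := fun x hx => eventually_nhdsSet_iff_forall.1 c4 x hx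
  have w3 := w1.mul hK c2 w2
  have e : ∀ x, ζ x * F (U x) ^ 2 = ζ x * F (U x) * (χ x * F (U x)) := fun x => by
    by_cases hx : x ∈ K
    · rw [(hKn x hx).eq_of_nhds]; ring
    · simp [hz x hx]
  simp_rw [e]
  refine w3.congr ?_
  filter_upwards [(WG.lip hK hL hz).gzero] with x hx0
  by_cases hx : x ∈ K
  · have e2 : gradient χ x = 0 := by
      unfold gradient
      rw [(hKn x hx).fderiv_eq]; simp
    rw [(hKn x hx).eq_of_nhds, e2]
    module
  · simp [hz x hx, hx0 hx]

namespace Core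
variable {d cB : ℝ} {Γ B : Set E} {A : E → E →L[ℝ] E} {U : E → ℝ} {G : E → E}

theorem AG_meas (h : Core d cB Γ A B U G) : AEStronglyMeasurable (fun x => A x (G x)) volume :=
  (isBoundedBilinearMap_apply (𝕜 := ℝ) (E := E) (F := E)).continuous.comp_aestronglyMeasurable₂ (g := fun a b => a b) h.Am h.Gm

theorem sol_WG (h : Core d cB Γ A B U G) {K : Set E} (hK : IsCompact K) (hKB : K ⊆ B \ Γ) {f : E → ℝ} {g : E → E}
    (w : WG K f g) : Integrable (fun x => inner ℝ (A x (G x)) (g x)) volume ∧ ∫ x, inner ℝ (A x (G x)) (g x) = 0 := by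
  have ho : IsOpen (B \ Γ) := h.Bo.sdiff h.closed
  obtain ⟨K', hK', h1, h2⟩ := exists_compact_between hK ho hKB
  have hK'Γ : K' ⊆ Γᶜ := fun x hx => (h2 hx).2
  obtain ⟨a, b, ha, hb, hab⟩ := wt_bounds (d := d) h.closed h.ne hK' hK'Γ
  have C0 := h.C1
  let ψ : E → ℝ := fun x => cB * b * ‖K'.indicator G x‖
  have hψ : MemLp ψ 2 volume := (h.memG hK' hK'Γ).norm.const_mul _
  have bnd : ∀ x ∈ K', ∀ y, |inner ℝ (A x (G x)) y| ≤ ‖ψ x‖ * ‖y‖ := fun x hx y => by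
    refine (h.bd x (hK'Γ hx) _ _).trans ?_
    simp only [ψ, iom hx]
    rw [norm_of_nonneg pz]
    have := (hab x hx).2
    gcongr
  have hint : ∀ q : E → E, MemLp q 2 volume → (∀ᵐ x, x ∉ K' → q x = 0) → Integrable (fun x => inner ℝ (A x (G x)) (q x)) volume := by
    intro q hq hz
    have : Integrable (fun x => ψ x * ‖q x‖) := memLp_one_iff_integrable.1 (hq.norm.smul hψ)
    refine this.mono (h.AG_meas.inner hq.1) ?_
    filter_upwards [hz] with x hx
    by_cases hxK : x ∈ K'
    · simpa using bnd x hxK (q x)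
    · simp [hx hxK]
  obtain ⟨F, f1, f2, f3, f4⟩ := w.approx hK h1
  have hF : ∀ k x, x ∉ K' → gradient (F k) x = 0 := fun k x hx => by
    unfold gradient
    rw [image_eq_zero_of_notMem_tsupport (f := fderiv ℝ (F k)) fun h => hx (f2 k (tsupport_fderiv_subset ℝ h))]; simp
  have hFc : ∀ k, Hcs (F k) := fun k => HasCompactSupport.intro hK' fun x hx => offs fun h => hx (f2 k h)
  have hgz : ∀ᵐ x, x ∉ K' → g x = 0 := by
    filter_upwards [w.gzero] with x hx hxK using hx fun h => hxK (interior_subset (h1 h))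
  have hFm := fun k => cc_memLp (grad_cont (f1 k)) (grad_hcs (hFc k)) 2
  refine ⟨hint g w.mem hgz, ?_⟩
  refine tendsto_nhds_unique (tendsto_int_L2 hψ (fun k => ((hFm k).sub w.mem).1) f4 (hint g w.mem hgz)
    (fun k => hint _ (hFm k) (aoa _ fun x => hF k x)) fun k => ?_) ?_
  · filter_upwards [hgz] with x hx
    by_cases hxK : x ∈ K'
    · rw [← inner_sub_right]; exact bnd x hxK _
    · simp only [hx hxK, hF k x hxK, inner_zero_right, sub_zero, norm_zero]; positivity
  · simp_rw [h.sol _ (f1 _) (hFc _) ((f2 _).trans h2)]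
    exact tendsto_const_nhds

theorem cacc (h : Core d cB Γ A B U G) {F H N : ℝ → ℝ} (hc : Ch Γ U G F H) (hH : ∀ t, 0 ≤ t → 0 ≤ H t)
    (hFN : ∀ t, 0 ≤ t → F t ^ 2 ≤ H t * N t ^ 2) (hN : Measurable N) {K : Set E} (hK : IsCompact K) (hKB : K ⊆ B \ Γ)
    {ζ : E → ℝ} {L : ℝ≥0} (hL : Lip L ζ) (hz : ∀ x ∉ K, ζ x = 0) :
    ∫⁻ x, ofReal (ζ x ^ 2 * H (U x) * ‖G x‖ ^ 2 * wt d Γ x) ≤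
      ofReal (4 * cB ^ 4) * ∫⁻ x, ofReal (N (U x) ^ 2 * ‖gradient ζ x‖ ^ 2 * wt d Γ x) := by
  have hKΓ : K ⊆ Γᶜ := fun x hx => (hKB hx).2
  obtain ⟨M, hM⟩ := lip_bdd hK hL hz
  have w := hc K hK hKΓ _ _ (lip_mul hL hL hM hM) (fun x hx => by simp [hz x hx])
  obtain ⟨hi, h0⟩ := h.sol_WG hK hKB w
  have wl := WG.lip hK hL hz
  have C0 := h.C1
  have Cp : 0 < cB := by linarith
  set i := fun x => inner ℝ (A x (G x)) (F (U x) • gradient (fun x => ζ x * ζ x) x + (ζ x * ζ x * H (U x)) • G x) with hidef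
  set b := fun x => N (U x) ^ 2 * ‖gradient ζ x‖ ^ 2 * wt d Γ x with hb
  have hb0 : ∀ x, 0 ≤ b x := fun x => mul_nonneg pz (wt_nonneg x)
  have hpt : ∀ᵐ x, ζ x ^ 2 * H (U x) * ‖G x‖ ^ 2 * wt d Γ x ≤ 2 * cB * i x + 4 * cB ^ 4 * b x := by
    filter_upwards [hL.ae_differentiableAt (μ := volume), wl.gzero] with x hx hx0
    by_cases hxK : x ∈ K
    · have hw := wt_pos (d := d) h.closed h.ne (hKΓ hxK)
      have e1 := h.ell x (hKΓ hxK) (G x)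
      have e2 := h.bd x (hKΓ hxK) (G x) (gradient ζ x)
      simp only [hidef, hb]
      rw [grad_mul hx hx, inner_add_right, inner_smul_right, inner_smul_right, inner_add_right, inner_smul_right]
      generalize inner ℝ (A x (G x)) (G x) = p at *
      generalize inner ℝ (A x (G x)) (gradient ζ x) = q at *
      have hU := h.nonneg x
      have f1 := hH _ hU
      have f2 := hFN _ hU
      generalize F (U x) = f at *
      generalize H (U x) = hh at *
      generalize N (U x) = nn at *
      generalize wt d Γ x = ww at *
      have g1 := norm_nonneg (G x)
      have g2 := norm_nonneg (gradient ζ x)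
      generalize ‖G x‖ = a at *
      generalize ‖gradient ζ x‖ = c at *
      generalize ζ x = z at *
      have k1 : cB⁻¹ * ww * a ^ 2 * cB = ww * a ^ 2 := by field_simp
      have k2 : ww * a ^ 2 ≤ p * cB := by rw [← k1]; gcongr
      have k3 : z ^ 2 * hh * (ww * a ^ 2) ≤ z ^ 2 * hh * (p * cB) := by gcongr
      have k4 : -(f * z * q) ≤ |f| * |z| * (cB * ww * a * c) := by
        refine (neg_le_abs _).trans ?_
        rw [abs_mul, abs_mul]; gcongr
      have k5 : |f| ≤ √hh * |nn| := by
        rw [← Real.sqrt_sq_eq_abs, ← Real.sqrt_sq_eq_abs nn, ← Real.sqrt_mul f1]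
        exact Real.sqrt_le_sqrt f2
      have k6 : |f| * |z| * (cB * ww * a * c) ≤ √hh * |nn| * |z| * (cB * ww * a * c) := by gcongr
      have k7 : 4 * cB * (√hh * |nn| * |z| * (cB * ww * a * c)) ≤ (z ^ 2 * hh * a ^ 2 + 4 * cB ^ 4 * (nn ^ 2 * c ^ 2)) * ww := by
        have : 0 ≤ (√hh * |z| * a - 2 * cB ^ 2 * |nn| * c) ^ 2 * ww := by positivity
        have s1 := Real.sq_sqrt f1
        have s2 := sq_abs z
        have s3 := sq_abs nn
        rw [← s2, ← s3]
        nth_rw 2 [← s1]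
        linarith
      nlinarith
    · simp only [hidef, hb]
      rw [grad_mul hx hx]
      simp [hz x hxK, hx0 hxK]
  by_cases hfin : ∫⁻ x, ofReal (b x) = ⊤
  · rw [hfin, ENNReal.mul_top (by simp; positivity)]; exact le_top
  have hUm : AEMeasurable U volume := h.integ.1.aemeasurable
  have hbm : AEStronglyMeasurable b volume := by
    refine (AEMeasurable.mul (AEMeasurable.mul ((hN.comp_aemeasurable hUm).pow_const 2) (wl.mem.1.norm.aemeasurable.pow_const 2)) (wt_meas).aemeasurable).aestronglyMeasurable
  have hbi : Integrable b volume := by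
    refine ⟨hbm, ?_⟩
    rw [hasFiniteIntegral_iff_ofReal (aoa _ hb0)]
    exact lt_top_iff_ne_top.2 hfin
  have hsum : Integrable (fun x => 2 * cB * i x + 4 * cB ^ 4 * b x) volume := (hi.const_mul _).add (hbi.const_mul _)
  have hnn : 0 ≤ᵐ[volume] fun x => 2 * cB * i x + 4 * cB ^ 4 * b x := by
    filter_upwards [hpt] with x hx
    exact le_trans (mul_nonneg (mul_nonneg (mul_nonneg (sq_nonneg _) (hH _ (h.nonneg x))) (sq_nonneg _)) (wt_nonneg x)) hx
  refine (lintegral_mono_ae (by filter_upwards [hpt] with x hx using ole hx)).trans ?_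
  rw [← ofReal_integral_eq_lintegral_ofReal hsum hnn, integral_add (hi.const_mul _) (hbi.const_mul _), integral_const_mul, integral_const_mul, h0,
    ← ofReal_integral_eq_lintegral_ofReal hbi (aoa _ hb0), ← ofReal_mul pz]
  simp
end Core

theorem dyadic {μ : Measure E} {z : E} {R l C m p : ℝ} (hR : 0 < R) (hl : 0 < l) (hC : 0 ≤ C) (hp : 0 ≤ p)
    (hμ : ∀ j : ℕ, μ (closedBall z (2 * (R * l ^ j))) ≤ ofReal (C * (R * l ^ j) ^ m))
    (hcov : ∀ᵐ x ∂μ, ∃ j : ℕ, R * l ^ j ≤ dist x z ∧ dist x z ≤ 2 * (R * l ^ j)) (hq : l ^ (m - p) < 1) :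
    ∫⁻ x, ofReal (dist x z ^ (-p)) ∂μ ≤ ofReal (C * (1 - l ^ (m - p))⁻¹ * R ^ (m - p)) := by
  have hq0 : 0 < l ^ (m - p) := Real.rpow_pos_of_pos hl _
  calc ∫⁻ x, ofReal (dist x z ^ (-p)) ∂μ
      ≤ ∫⁻ x, ∑' j : ℕ, (closedBall z (2 * (R * l ^ j))).indicator (fun _ => ofReal ((R * l ^ j) ^ (-p))) x ∂μ := by
        refine lintegral_mono_ae ?_
        filter_upwards [hcov] with x ⟨j, h1, h2⟩
        refine le_trans ?_ (ENNReal.le_tsum j)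
        rw [iom (show x ∈ closedBall z (2 * (R * l ^ j)) from h2)]
        exact ole (rnp pz h1 lz)
    _ = ∑' j : ℕ, ofReal ((R * l ^ j) ^ (-p)) * μ (closedBall z (2 * (R * l ^ j))) := by
        rw [lintegral_tsum fun j => (measurable_const.indicator isClosed_closedBall.measurableSet).aemeasurable]
        congr 1; ext j
        rw [lintegral_indicator_const isClosed_closedBall.measurableSet]
    _ ≤ ∑' j : ℕ, ofReal (C * R ^ (m - p)) * ofReal (l ^ (m - p)) ^ j := by
        refine ENNReal.tsum_le_tsum fun j => ?_
        refine (mlr (hμ j) _).trans (le_of_eq ?_)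
        rw [← ofReal_mul pz, ← ofReal_pow hq0.le, ← ofReal_mul pz]
        congr 1
        have h0 : 0 < R * l ^ j := by positivity
        rw [← rpow_natCast (l ^ (m - p)), ← rpow_mul hl.le, mul_comm (m - p), rpow_mul hl.le, rpow_natCast, mul_assoc C,
          ← mul_rpow hR.le pz, mul_left_comm, ← rpow_add h0]
        ring_nf
    _ = _ := by
        rw [ENNReal.tsum_mul_left, ENNReal.tsum_geometric, ← ofReal_one, ← ofReal_sub _ hq0.le,
          ← ofReal_inv_of_pos lz, ← ofReal_mul pz]
        congr 1; ring

structure AR (d cA : ℝ) (Γ : Set E) : Prop where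
  closed : IsClosed Γ
  ne : Γ.Nonempty
  d0 : 0 < d
  dn : d < (dimE : ℝ) - 1
  C0 : 1 ≤ cA
  reg : ∀ x ∈ Γ, ∀ r : ℝ, 0 < r → ofReal (cA⁻¹ * r ^ d) ≤ μH[d] (Γ ∩ ball x r) ∧
      μH[d] (Γ ∩ ball x r) ≤ ofReal (cA * r ^ d)

def vb (E : Type*) [NormedAddCommGroup E] [InnerProductSpace ℝ E] [FiniteDimensional ℝ E]
  [MeasurableSpace E] [BorelSpace E] : ℝ := (volume (ball (0 : E) 1)).toReal

theorem vb_pos : 0 < vb E := ENNReal.toReal_pos (measure_ball_pos _ _ one_pos).ne' measure_ball_lt_top.ne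

theorem vol_cb (z : E) {r : ℝ} (hr : 0 ≤ r) : volume (closedBall z r) = ofReal (vb E * r ^ dimE) := by
  rw [Measure.addHaar_closedBall _ _ hr, mul_comm, ofReal_mul vb_pos.le, vb, ofReal_toReal measure_ball_lt_top.ne]

theorem vol_b (z : E) {r : ℝ} (hr : 0 < r) : volume (ball z r) = ofReal (vb E * r ^ dimE) := by
  rw [← vol_cb z hr.le, Measure.addHaar_closedBall _ _ hr.le, Measure.addHaar_ball_of_pos _ _ hr]

theorem kernel_ball {p : ℝ} (hp0 : 0 ≤ p) (hp : p < dimE) :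
    ∃ C : ℝ, 0 < C ∧ ∀ (z : E) (R : ℝ), 0 < R → ∫⁻ x in ball z R, ofReal (dist x z ^ (-p)) ≤
      ofReal (C * R ^ ((dimE : ℝ) - p)) := by
  set n := dimE with hn
  have hq : ((1/2 : ℝ)) ^ ((n:ℝ) - p) < 1 := Real.rpow_lt_one nz nz lz
  have hv := vb_pos (E := E)
  have : 0 < (1 - ((1/2 : ℝ)) ^ ((n:ℝ) - p))⁻¹ := inv_pos.2 lz
  refine ⟨vb E * 2 ^ n * (1 - (1/2 : ℝ) ^ ((n:ℝ) - p))⁻¹ * (1 / 2) ^ ((n:ℝ) - p), by positivity, fun z R hR => ?_⟩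
  have hn0 : 0 < n := by
    rcases Nat.eq_zero_or_pos n with h | h
    · rw [h] at hp; simp at hp; linarith
    · exact h
  haveI : Nontrivial E := Module.nontrivial_of_finrank_pos (R := ℝ) hn0
  refine (dyadic (μ := volume.restrict (ball z R)) (z := z) (R := R / 2) (l := 1 / 2) (C := vb E * 2 ^ n) (m := n) (p := p) pz nz pz hp0
    (fun j => ?_) ?_ hq).trans (le_of_eq ?_)
  · refine (Measure.restrict_apply_le _ _).trans ?_
    rw [vol_cb z pz, rpow_natCast, mul_pow 2, ← mul_assoc]
  · have h0 : ∀ᵐ x ∂(volume.restrict (ball z R)), x ≠ z := by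
      refine ae_restrict_of_ae ?_
      simp [ae_iff]
    filter_upwards [h0, ae_restrict_mem msb] with x hx hxR
    have hd : 0 < dist x z := dist_pos.2 hx
    obtain ⟨j, h1, h2⟩ := exists_nat_pow_near_of_lt_one (x := dist x z / R) (y := (1/2:ℝ)) pz (by rw [div_le_one hR]; exact (mem_ball.1 hxR).le) nz nz
    rw [lt_div_iff₀ hR] at h1
    rw [div_le_iff₀ hR] at h2
    exact ⟨j, by rw [pow_succ] at h1; linarith, by linarith⟩
  · rw [div_eq_mul_one_div R, mul_rpow hR.le nz]
    congr 1; ring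

namespace AR
variable {d cA : ℝ} {Γ : Set E}

theorem n2 (h : AR d cA Γ) : 2 ≤ dimE := by
  have h1 := h.d0
  have h2 := h.dn
  have : (1:ℝ) < dimE := by linarith
  have : 1 < dimE := by exact_mod_cast this
  omega

theorem near (h : AR d cA Γ) (x : E) : ∃ p ∈ Γ, dst x Γ = dist x p := h.closed.exists_infDist_eq_dist h.ne x

theorem up (h : AR d cA Γ) {x : E} {r : ℝ} (hr : dst x Γ ≤ r) (hr0 : 0 < r) :
    μH[d] (Γ ∩ closedBall x r) ≤ ofReal (cA * (3 * r) ^ d) := by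
  obtain ⟨p, hp, hpx⟩ := h.near x
  refine le_trans (measure_mono (inter_subset_inter_right _ fun y hy => ?_)) (h.reg p hp (3 * r) pz).2
  rw [mem_closedBall] at hy
  rw [mem_ball]
  have := dist_triangle y x p
  linarith

theorem vol0 (h : AR d cA Γ) : volume Γ = 0 := by
  obtain ⟨p, hp⟩ := h.ne
  have h1 : ∀ k : ℕ, volume (Γ ∩ ball p (k + 1)) = 0 := fun k => by
    have hf : μH[d] (Γ ∩ ball p (k + 1)) ≠ ⊤ := ((h.reg p hp (k + 1) pz).2.trans_lt ofReal_lt_top).ne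
    have h0 := (Measure.hausdorffMeasure_zero_or_top (by linarith [h.dn] : d < (dimE : ℝ)) (Γ ∩ ball p (k + 1))).resolve_right hf
    haveI := isAddHaarMeasure_hausdorffMeasure (E := E)
    rw [Measure.isAddLeftInvariant_eq_smul (volume : Measure E) (μH[(dimE : ℝ)])]
    simp [h0]
  have : Γ = ⋃ k : ℕ, Γ ∩ ball p (k + 1) := by
    rw [← inter_iUnion, eq_comm, inter_eq_left]
    intro y hy
    obtain ⟨k, hk⟩ := exists_nat_gt (dist y p)
    exact mem_iUnion.2 ⟨k, by rw [mem_ball]; linarith⟩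
  rw [this, measure_iUnion_null_iff]
  exact h1

theorem aeΩ (h : AR d cA Γ) : ∀ᵐ x : E, x ∉ Γ := measure_eq_zero_iff_ae_notMem.1 h.vol0

theorem sfin (h : AR d cA Γ) : SigmaFinite ((μH[d] : Measure E).restrict Γ) := by
  obtain ⟨p, hp⟩ := h.ne
  refine ⟨⟨⟨fun k => ball p (k + 1), fun _ => trivial, fun k => ?_, ?_⟩⟩⟩
  · rw [Measure.restrict_apply msb, inter_comm]
    exact (h.reg p hp (k + 1) pz).2.trans_lt ofReal_lt_top
  · refine eq_univ_of_forall fun y => ?_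
    obtain ⟨k, hk⟩ := exists_nat_gt (dist y p)
    exact mem_iUnion.2 ⟨k, by rw [mem_ball]; linarith⟩

theorem ker_low (h : AR d cA Γ) {p : ℝ} (hp : 0 ≤ p) {x : E} (hx : x ∉ Γ) :
    ofReal (dst x Γ ^ (d - p)) ≤ ofReal (cA * 2 ^ p) *
      ∫⁻ z in Γ ∩ closedBall x (2 * dst x Γ), ofReal (dist x z ^ (-p)) ∂μH[d] := by
  obtain ⟨q, hq, hqx⟩ := h.near x
  have hd := dl_pos h.closed h.ne hx
  set δ := dst x Γ with hδ
  have hC := h.C0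
  have hsub : Γ ∩ ball q δ ⊆ Γ ∩ closedBall x (2 * δ) := inter_subset_inter_right _ fun y hy => by
    rw [mem_ball] at hy
    rw [mem_closedBall]
    have := dist_triangle y q x
    rw [dist_comm q x] at this
    linarith
  have h1 : ofReal ((2 * δ) ^ (-p)) * μH[d] (Γ ∩ ball q δ) ≤ ∫⁻ z in Γ ∩ closedBall x (2 * δ), ofReal (dist x z ^ (-p)) ∂μH[d] := by
    refine le_trans ?_ (lintegral_mono_set hsub)
    rw [← setLIntegral_const]
    refine setLIntegral_mono_ae' (h.closed.measurableSet.inter msb) (aoa _ fun y hy => ?_)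
    have h2 : dist x y ≤ 2 * δ := by rw [dist_comm]; exact (hsub hy).2
    have h3 : 0 < dist x y := dist_pos.2 fun e => hx (e ▸ hy.1)
    exact ole (rnp h3 h2 lz)
  refine le_trans ?_ (mlr h1 _)
  refine le_trans ?_ (mlr (mlr (h.reg q hq δ hd).1 _) _)
  rw [← ofReal_mul pz, ← ofReal_mul pz]
  apply le_of_eq; congr 1
  rw [mul_rpow nz hd.le, Real.rpow_sub hd, rpow_neg nz, rpow_neg hd.le]
  field_simp

theorem ker_up (h : AR d cA Γ) {p : ℝ} (hp : d < p) {x : E} (hx : x ∉ Γ) :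
    ∫⁻ z in Γ, ofReal (dist z x ^ (-p)) ∂μH[d] ≤
      ofReal (cA * 6 ^ d * (1 - 2 ^ (d - p))⁻¹ * dst x Γ ^ (d - p)) := by
  have hd := dl_pos h.closed h.ne hx
  have hC := h.C0
  have hd0 := h.d0
  refine dyadic (m := d) hd two_pos pz lz (fun j => ?_) ?_ (Real.rpow_lt_one_of_one_lt_of_neg one_lt_two lz)
  · rw [Measure.restrict_apply isClosed_closedBall.measurableSet, inter_comm]
    have h1 : (1:ℝ) ≤ 2 ^ j := one_le_pow₀ nz
    refine (h.up (r := 2 * (dst x Γ * 2 ^ j)) (by nlinarith) pz).trans (le_of_eq ?_)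
    rw [mul_assoc, ← mul_rpow nz pz]; ring_nf
  · filter_upwards [ae_restrict_mem h.closed.measurableSet] with z hz
    have h1 : dst x Γ ≤ dist z x := by rw [dist_comm]; exact infDist_le_dist_of_mem hz
    obtain ⟨j, h2, h3⟩ := exists_nat_pow_near (x := dist z x / dst x Γ) (y := (2:ℝ)) (by rw [le_div_iff₀ hd]; linarith) nz
    rw [le_div_iff₀ hd] at h2
    rw [div_lt_iff₀ hd, pow_succ] at h3
    exact ⟨j, by linarith, by linarith⟩
end AR

theorem wt_int (d cA q : ℝ) (hd0 : 0 < d) (hC0 : 1 ≤ cA) (hq0 : 0 ≤ q) (hq : q < dimE - d) :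
    ∃ C : ℝ, 0 < C ∧ ∀ {Γ : Set E}, AR d cA Γ → ∀ (Y : E) (R : ℝ), 0 < R →
      ∫⁻ x in ball Y R, ofReal (dst x Γ ^ (-q)) ≤ ofReal (C * R ^ dimE * max (dst Y Γ) R ^ (-q)) := by
  obtain ⟨K, hK, hker⟩ := kernel_ball (E := E) (p := d + q) lz lz
  set n := dimE with hn
  have hv := vb_pos (E := E)
  set C := vb E * 2 ^ q + cA * 2 ^ (d + q) * (K * 10 ^ ((n:ℝ) - (d + q))) * (cA * 21 ^ d) * 2 ^ q with hCdef
  refine ⟨C, by positivity, fun {Γ} h Y R hR => ?_⟩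
  rcases le_or_gt (2 * R) (dst Y Γ) with hY | hY
  · have hm : max (dst Y Γ) R = dst Y Γ := max_eq_left lz
    have hYp : 0 < dst Y Γ := by linarith
    have h1 : ∀ x ∈ ball Y R, ofReal (dst x Γ ^ (-q)) ≤ ofReal ((dst Y Γ / 2) ^ (-q)) := fun x hx => by
      have := infDist_le_infDist_add_dist (s := Γ) (x := Y) (y := x)
      rw [dist_comm] at this
      have h2 := mem_ball.1 hx
      exact ole (rnp lz lz lz)
    refine (setLIntegral_mono_ae' msb (aoa _ h1)).trans ?_
    rw [setLIntegral_const, vol_b Y hR, ← ofReal_mul pz, hm]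
    apply ole
    rw [Real.div_rpow hYp.le nz, rpow_neg (by norm_num : (0:ℝ) ≤ 2) q, div_inv_eq_mul]
    have h3 : vb E * 2 ^ q ≤ C := by rw [hCdef]; simp only [le_add_iff_nonneg_right]; positivity
    calc _ = vb E * 2 ^ q * R ^ n * dst Y Γ ^ (-q) := by ring
      _ ≤ _ := by gcongr
  · set S := Γ ∩ closedBall Y (7 * R) with hS
    have hSm : MeasurableSet S := h.closed.measurableSet.inter isClosed_closedBall.measurableSet
    have hSf : μH[d] S ≤ ofReal (cA * (3 * (7 * R)) ^ d) := h.up lz pz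
    haveI : IsFiniteMeasure ((μH[d] : Measure E).restrict S) := ⟨by
      rw [Measure.restrict_apply_univ]; exact hSf.trans_lt ofReal_lt_top⟩
    have h1 : ∀ x ∈ ball Y R, x ∉ Γ → ofReal (dst x Γ ^ (-q)) ≤ ofReal (cA * 2 ^ (d + q)) * ∫⁻ z in S, ofReal (dist x z ^ (-(d + q))) ∂μH[d] := fun x hx hxΓ => by
      have h2 := h.ker_low (p := d + q) lz hxΓ
      rw [show d - (d + q) = - q by ring] at h2
      refine h2.trans (mlr (lintegral_mono_set (inter_subset_inter_right _ fun y hy => ?_)) _)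
      rw [mem_closedBall] at *
      rw [mem_ball] at hx
      have h3 := infDist_le_infDist_add_dist (s := Γ) (x := x) (y := Y)
      have h4 := dist_triangle y x Y
      linarith
    have hmeas : Measurable (Function.uncurry fun (x z : E) => ofReal (dist x z ^ (-(d + q)))) := by
      apply Measurable.ennreal_ofReal
      exact (measurable_dist).pow_const _
    calc _ ≤ ∫⁻ x in ball Y R, ofReal (cA * 2 ^ (d + q)) * ∫⁻ z in S, ofReal (dist x z ^ (-(d + q))) ∂μH[d] := by
          refine setLIntegral_mono_ae' msb ?_
          filter_upwards [h.aeΩ] with x hxΓ hx using h1 x hx hxΓ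
      _ = ofReal (cA * 2 ^ (d + q)) * ∫⁻ z in S, (∫⁻ x in ball Y R, ofReal (dist x z ^ (-(d + q)))) ∂μH[d] := by
          rw [lcm _ _ ont, lintegral_lintegral_swap hmeas.aemeasurable]
      _ ≤ ofReal (cA * 2 ^ (d + q)) * ∫⁻ z in S, ofReal (K * (10 * R) ^ ((n:ℝ) - (d + q))) ∂μH[d] := by
          refine mlr (setLIntegral_mono_ae' hSm (aoa _ fun z hz => ?_)) _
          refine le_trans (lintegral_mono_set fun x hx => ?_) (hker z (10 * R) pz)
          have h5 := mem_closedBall.1 hz.2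
          rw [mem_ball] at *
          have := dist_triangle x Y z
          rw [dist_comm z Y] at h5
          linarith
      _ ≤ ofReal (cA * 2 ^ (d + q)) * (ofReal (K * (10 * R) ^ ((n:ℝ) - (d + q))) * ofReal (cA * (3 * (7 * R)) ^ d)) := by
          rw [setLIntegral_const]; gcongr
      _ ≤ _ := by
          rw [← ofReal_mul pz, ← ofReal_mul pz]
          apply ole
          have hm : max (dst Y Γ) R ≤ 2 * R := max_le hY.le lz
          have hm0 : 0 < max (dst Y Γ) R := lt_max_of_lt_right hR
          have h6 : (2 * R) ^ (-q) ≤ max (dst Y Γ) R ^ (-q) := rnp hm0 hm lz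
          have h7 : cA * 2 ^ (d + q) * (K * 10 ^ ((n:ℝ) - (d + q))) * (cA * 21 ^ d) * 2 ^ q ≤ C := by
            rw [hCdef]; simp only [le_add_iff_nonneg_left]; positivity
          have h8 : R ^ ((n:ℝ) - (d + q)) * R ^ d = R ^ n * R ^ (-q) := by
            rw [← rpow_natCast R n, ← rpow_add hR, ← rpow_add hR]; congr 1; ring
          calc _ = cA * 2 ^ (d + q) * (K * 10 ^ ((n:ℝ) - (d + q))) * (cA * 21 ^ d) * (R ^ ((n:ℝ) - (d + q)) * R ^ d) := by
                rw [mul_rpow nz hR.le, show 3 * (7 * R) = 21 * R by ring, mul_rpow nz hR.le]; ring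
            _ = cA * 2 ^ (d + q) * (K * 10 ^ ((n:ℝ) - (d + q))) * (cA * 21 ^ d) * 2 ^ q * R ^ n * (2 * R) ^ (-q) := by
                rw [h8, mul_rpow nz hR.le, rpow_neg (by norm_num : (0:ℝ) ≤ 2)]; field_simp
            _ ≤ _ := by gcongr

theorem lint_le_of_int0 {X : Type*} [MeasurableSpace X] {μ : Measure X} {i a b : X → ℝ} (hi : Integrable i μ) (h0 : ∫ x, i x ∂μ = 0)
    (ha : ∀ᵐ x ∂μ, 0 ≤ a x) (hb : ∀ x, 0 ≤ b x) (hbm : AEMeasurable b μ) (hab : ∀ᵐ x ∂μ, a x ≤ i x + b x) :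
    ∫⁻ x, ofReal (a x) ∂μ ≤ ∫⁻ x, ofReal (b x) ∂μ := by
  by_cases hfin : ∫⁻ x, ofReal (b x) ∂μ = ⊤
  · rw [hfin]; exact le_top
  have hbi : Integrable b μ := by
    refine ⟨hbm.aestronglyMeasurable, ?_⟩
    rw [hasFiniteIntegral_iff_ofReal (aoa _ hb)]
    exact lt_top_iff_ne_top.2 hfin
  refine (lintegral_mono_ae (by filter_upwards [hab] with x hx using ole hx)).trans ?_
  have hs : Integrable (fun x => i x + b x) μ := hi.add hbi
  rw [← ofReal_integral_eq_lintegral_ofReal hs (by filter_upwards [hab, ha] with x h1 h2 using h2.trans h1), integral_add hi hbi, h0, zero_add,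
    ofReal_integral_eq_lintegral_ofReal hbi (aoa _ hb)]

theorem base_id {K : Set E} (hK : IsCompact K) {k : E → ℝ} {g : E → E} (w : WG K k g) {z : E} (hz : z ∉ K) {ρ : ℝ} (hρ : 0 < ρ)
    (hn : 1 ≤ dimE) :
    Integrable (fun x => k x * (dist x z ^ (dimE - 1) * (dist x z + ρ) ^ 2)⁻¹ -
      (dist x z ^ (dimE) * (dist x z + ρ))⁻¹ * inner ℝ (x - z) (g x)) volume ∧
    ∫ x, (k x * (dist x z ^ (dimE - 1) * (dist x z + ρ) ^ 2)⁻¹ -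
      (dist x z ^ (dimE) * (dist x z + ρ))⁻¹ * inner ℝ (x - z) (g x)) = 0 := by
  set n := dimE with hnn
  obtain ⟨χ, c1, c2, c3, c4, c5⟩ := exists_cutoff hK isOpen_compl_singleton (show K ⊆ {z}ᶜ from fun x hx h => hz (h ▸ hx))
  have hKn : ∀ x ∈ K, χ =ᶠ[𝓝 x] fun _ => 1 := fun x hx => eventually_nhdsSet_iff_forall.1 c4 x hx
  let Φ : ℝ → ℝ := fun s => (s ^ n * (s + ρ))⁻¹
  let b := stdOrthonormalBasis ℝ E
  let p : Fin n → E → ℝ := fun i x => Φ (dist x z) * inner ℝ (b i) (x - z)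
  let ψ : Fin n → E → ℝ := fun i x => χ x * p i x
  have hps : ∀ i x, x ≠ z → ContDiffAt ℝ (⊤ : ℕ∞) (p i) x := fun i x hx => by
    have h1 : ContDiffAt ℝ (⊤ : ℕ∞) (fun x => dist x z) x := by
      simp_rw [dist_eq_norm]
      exact (contDiffAt_id.sub contDiffAt_const).norm ℝ (sub_ne_zero.2 hx)
    have hd : 0 < dist x z := dist_pos.2 hx
    have h2 : ContDiffAt ℝ (⊤ : ℕ∞) (fun x => Φ (dist x z)) x :=
      ((h1.pow n).mul (h1.add contDiffAt_const)).inv pz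
    exact h2.mul (contDiffAt_const.inner ℝ (contDiffAt_id.sub contDiffAt_const))
  have hψ : ∀ i, Sm (ψ i) := fun i => by
    rw [contDiff_iff_contDiffAt]
    intro x
    by_cases hx : x ∈ tsupport χ
    · exact c1.contDiffAt.mul (hps i x fun h => c3 hx h)
    · have : ψ i =ᶠ[𝓝 x] fun _ => 0 := by
        filter_upwards [(isClosed_tsupport χ).isOpen_compl.mem_nhds hx] with y hy
        simp [ψ, offs hy]
      exact contDiffAt_const.congr_of_eventuallyEq this
  have hψc : ∀ i, Hcs (ψ i) := fun i => c2.mul_right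
  have i1 : ∀ i, Integrable fun x => k x • gradient (ψ i) x := fun i =>
    (w.cont.smul (grad_cont (hψ i))).integrable_of_hasCompactSupport (grad_hcs (hψc i)).smul_left
  have i2 : ∀ i, Integrable fun x => ψ i x • g x := fun i =>
    memLp_one_iff_integrable.1 (w.mem.smul (cc_memLp (hψ i).continuous (hψc i) 2))
  have j1 : ∀ i, Integrable fun x => inner ℝ (b i) (k x • gradient (ψ i) x) := fun i => (i1 i).const_inner _
  have j2 : ∀ i, Integrable fun x => inner ℝ (b i) (ψ i x • g x) := fun i => (i2 i).const_inner _
  have key : ∫ x, ∑ i, (inner ℝ (b i) (k x • gradient (ψ i) x) + inner ℝ (b i) (ψ i x • g x)) = 0 := by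
    have j3 : ∀ i, Integrable fun x => inner ℝ (b i) (k x • gradient (ψ i) x) + inner ℝ (b i) (ψ i x • g x) := fun i => (j1 i).add (j2 i)
    rw [integral_finsetSum _ fun i _ => j3 i]
    refine Finset.sum_eq_zero fun i _ => ?_
    rw [integral_add (j1 i) (j2 i), integral_inner (i1 i), integral_inner (i2 i), w.weak _ (hψ i) (hψc i), inner_neg_right, neg_add_cancel]
  have keyi : Integrable fun x => ∑ i, (inner ℝ (b i) (k x • gradient (ψ i) x) + inner ℝ (b i) (ψ i x • g x)) :=
    integrable_finsetSum _ fun i _ => (j1 i).add (j2 i)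
  have hpt : ∀ᵐ x, ∑ i, (inner ℝ (b i) (k x • gradient (ψ i) x) + inner ℝ (b i) (ψ i x • g x)) =
      -(k x * (dist x z ^ (n - 1) * (dist x z + ρ) ^ 2)⁻¹ -
      (dist x z ^ n * (dist x z + ρ))⁻¹ * inner ℝ (x - z) (g x)) := by
    filter_upwards [w.gzero] with x hg
    by_cases hx : x ∈ K
    · have hxz : x ≠ z := fun h => hz (h ▸ hx)
      have hs : 0 < dist x z := dist_pos.2 hxz
      rw [Finset.sum_add_distrib]
      have e2 : ∑ i, inner ℝ (b i) (ψ i x • g x) = (dist x z ^ n * (dist x z + ρ))⁻¹ * inner ℝ (x - z) (g x) := by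
        rw [← b.sum_inner_mul_inner, Finset.mul_sum]
        refine Finset.sum_congr rfl fun i _ => ?_
        rw [inner_smul_right]
        simp only [ψ, p, Φ, (hKn x hx).eq_of_nhds]
        rw [real_inner_comm (x - z)]; ring
      have e1 : ∀ i, inner ℝ (b i) (k x • gradient (ψ i) x) = k x * (-((n:ℝ) * dist x z ^ (n - 1) * (dist x z + ρ) + dist x z ^ n) / (dist x z ^ n * (dist x z + ρ)) ^ 2 * (inner ℝ (b i) (x - z) / dist x z) * inner ℝ (b i) (x - z) + Φ (dist x z)) := fun i => by
        rw [inner_smul_right]; congr 1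
        have q1 : HasFDerivAt (fun y : E => y - z) (ContinuousLinearMap.id ℝ E) x := (hasFDerivAt_id x).sub_const z
        have q2 : HasFDerivAt (fun y : E => dist y z) ((dist x z)⁻¹ • innerSL ℝ (x - z)) x := by
          simp_rw [dist_eq_norm]
          have := (q1.norm_sq).sqrt (by rw [← dist_eq_norm]; positivity)
          simp only [Real.sqrt_sq (norm_nonneg _)] at this
          refine this.congr_fderiv ?_
          ext v
          simp
          field_simp
        have q3 : HasDerivAt Φ (-((n:ℝ) * dist x z ^ (n - 1) * (dist x z + ρ) + dist x z ^ n) / (dist x z ^ n * (dist x z + ρ)) ^ 2) (dist x z) := by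
          have := ((hasDerivAt_pow n (dist x z)).mul ((hasDerivAt_id (dist x z)).add_const ρ)).inv (by simp only [Pi.mul_apply, id]; positivity)
          refine HasDerivAt.congr_deriv (f := Φ) this ?_
          simp
        have q4 : HasFDerivAt (fun y : E => inner ℝ (b i) (y - z)) (innerSL ℝ (b i)) x := by
          have := (innerSL ℝ (b i)).hasFDerivAt.comp x q1
          exact this
        have q5 := (q3.comp_hasFDerivAt x q2).mul q4
        have q6 : ψ i =ᶠ[𝓝 x] p i := by
          filter_upwards [hKn x hx] with y hy
          simp [ψ, hy]
        have q7 := (q5.congr_of_eventuallyEq q6).fderiv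
        unfold gradient
        rw [real_inner_comm, InnerProductSpace.toDual_symm_apply, q7]
        simp only [add_apply, ContinuousLinearMap.add_apply, ContinuousLinearMap.smul_apply, innerSL_apply_apply, smul_eq_mul]
        rw [real_inner_self_eq_norm_sq, b.orthonormal.1 i, real_inner_comm (x - z)]
        simp only [Function.comp]
        ring
      simp_rw [e1]
      rw [e2, ← Finset.mul_sum, Finset.sum_add_distrib]
      have e3 : ∑ i, inner ℝ (b i) (x - z) * inner ℝ (b i) (x - z) = dist x z ^ 2 := by
        rw [dist_eq_norm, ← real_inner_self_eq_norm_sq, ← b.sum_inner_mul_inner]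
        refine Finset.sum_congr rfl fun i _ => ?_
        rw [real_inner_comm (x - z)]
      have e4 : ∀ c : ℝ, ∑ i, c * (inner ℝ (b i) (x - z) / dist x z) * inner ℝ (b i) (x - z) = c * dist x z := fun c => by
        have : ∀ i, c * (inner ℝ (b i) (x - z) / dist x z) * inner ℝ (b i) (x - z) = c / dist x z * (inner ℝ (b i) (x - z) * inner ℝ (b i) (x - z)) := fun i => by ring
        simp_rw [this]
        rw [← Finset.mul_sum, e3]; field_simp
      rw [e4]
      simp only [Finset.sum_const, Finset.card_univ, Fintype.card_fin, nsmul_eq_mul, Φ]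
      obtain ⟨m, hm⟩ : ∃ m, n = m + 1 := ⟨n - 1, by omega⟩
      rw [hm]
      generalize inner ℝ (x - z) (g x) = t
      generalize dist x z = s at *
      simp only [Nat.add_sub_cancel]
      have hm' : (dimE : ℝ) = m + 1 := by rw [← hnn, hm]; push_cast; ring
      push_cast
      field_simp
      rw [hm']
      ring
    · simp [w.zero x hx, hg hx]
  constructor
  · exact (keyi.congr hpt).neg.congr (aoa _ fun x => by simp)
  · rw [integral_congr_ae hpt, integral_neg, neg_eq_zero] at key
    exact key

def clp (f : E → ℝ) (x : E) : ℝ := max 0 (min 1 (f x))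

theorem clp_lip {f : E → ℝ} {L : ℝ≥0} (h : Lip L f) : Lip L (clp f) := (h.const_min 1).const_max 0
theorem clp0 (f : E → ℝ) (x : E) : 0 ≤ clp f x := le_max_left _ _
theorem clp1 (f : E → ℝ) (x : E) : clp f x ≤ 1 := max_le zero_le_one (min_le_left _ _)
theorem clp_abs (f : E → ℝ) (x : E) : |clp f x| ≤ (1 : ℝ≥0) := by rw [abn (clp0 f x)]; exact_mod_cast clp1 f x
theorem clp_eq1 {f : E → ℝ} {x : E} (h : 1 ≤ f x) : clp f x = 1 := by simp [clp, h]
theorem clp_eq0 {f : E → ℝ} {x : E} (h : f x ≤ 0) : clp f x = 0 := by simp [clp, h]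

theorem norm_grad_le {f : E → ℝ} {L : ℝ≥0} (h : Lip L f) (x : E) : ‖gradient f x‖ ≤ L := by
  unfold gradient; rw [LinearIsometryEquiv.norm_map]; exact norm_fderiv_le_of_lipschitz ℝ h

theorem grad_loc_const {f : E → ℝ} {c : ℝ} {x : E} (h : f =ᶠ[𝓝 x] fun _ => c) : gradient f x = 0 := by
  unfold gradient; rw [h.fderiv_eq]; simp

theorem clp_grad1 {f : E → ℝ} (hf : Continuous f) {x : E} (h : 1 < f x) : gradient (clp f) x = 0 := by
  refine grad_loc_const (c := 1) ?_
  filter_upwards [hf.continuousAt.eventually (lt_mem_nhds h)] with y hy using clp_eq1 hy.le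

theorem clp_grad0 {f : E → ℝ} (hf : Continuous f) {x : E} (h : f x < 0) : gradient (clp f) x = 0 := by
  refine grad_loc_const (c := 0) ?_
  filter_upwards [hf.continuousAt.eventually (gt_mem_nhds h)] with y hy using clp_eq0 hy.le

theorem lip_aff {f : E → ℝ} (h : Lip 1 f) (a : ℝ≥0) (b : ℝ) : Lip a fun x => a * f x - b := by
  refine LipschitzWith.of_dist_le_mul fun x y => ?_
  rw [Real.dist_eq, show a * f x - b - (a * f y - b) = a * (f x - f y) by ring, abs_mul, NNReal.abs_eq]
  have := h.dist_le_mul x y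
  rw [NNReal.coe_one, one_mul, Real.dist_eq] at this
  exact mln this a.coe_nonneg

theorem norm_grad_mul {f g : E → ℝ} {L L' : ℝ≥0} (hf : Lip L f) (hg : Lip L' g) :
    ∀ᵐ x, ‖gradient (fun x => f x * g x) x‖ ≤ |f x| * ‖gradient g x‖ + |g x| * ‖gradient f x‖ := by
  filter_upwards [hf.ae_differentiableAt (μ := volume), hg.ae_differentiableAt (μ := volume)] with x h1 h2
  rw [grad_mul h1 h2]
  refine (norm_add_le _ _).trans ?_
  rw [norm_smul, norm_smul, norm_eq_abs, norm_eq_abs]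

theorem fatou {X : Type*} [MeasurableSpace X] {μ : Measure X} {F : ℕ → X → ℝ≥0∞} {F0 : X → ℝ≥0∞} {c : ℕ → ℝ≥0∞} {c0 : ℝ≥0∞}
    (hm : ∀ k, AEMeasurable (F k) μ) (ht : ∀ᵐ x ∂μ, Tendsto (fun k => F k x) atTop (𝓝 (F0 x))) (hc : Tendsto c atTop (𝓝 c0))
    (h : ∀ k, ∫⁻ x, F k x ∂μ ≤ c k) : ∫⁻ x, F0 x ∂μ ≤ c0 := by
  have h1 : ∫⁻ x, F0 x ∂μ = ∫⁻ x, liminf (fun k => F k x) atTop ∂μ :=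
    lintegral_congr_ae (by filter_upwards [ht] with x hx using hx.liminf_eq.symm)
  rw [h1]
  refine (lintegral_liminf_le' hm).trans ?_
  rw [← hc.liminf_eq]
  exact liminf_le_liminf (Eventually.of_forall h)

theorem AR.layer {d cA : ℝ} {Γ : Set E} (h : AR d cA Γ) {K0 : Set E} (hK : Bornology.IsBounded K0) {c : ℝ} (hc : 0 < c) :
    ∀ᶠ η in 𝓝[>] (0:ℝ), volume (K0 ∩ {x | dst x Γ ≤ 2 * η}) ≤ ofReal (c * η) := by
  have hdn := h.dn
  set γ := (dimE : ℝ) - 1 - d with hγ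
  obtain ⟨C, hC, hint⟩ := wt_int (E := E) d cA (1 + γ / 2) h.d0 h.C0 lz lz
  obtain ⟨R, hR0, hR⟩ := hK.subset_ball_lt 0 0
  have h1 := hint h 0 R hR0
  set M := C * R ^ dimE * max (dst 0 Γ) R ^ (-(1 + γ / 2)) with hM
  have hMp : 0 < M := by have : 0 < max (dst 0 Γ) R := lt_max_of_lt_right hR0
                         positivity
  have h2 : Tendsto (fun η : ℝ => (2 * η) ^ (γ / 2) * (2 * M)) (𝓝[>] 0) (𝓝 0) := by
    have : Tendsto (fun η : ℝ => (2 * η) ^ (γ / 2) * (2 * M)) (𝓝 0) (𝓝 ((2 * 0) ^ (γ / 2) * (2 * M))) := by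
      refine Continuous.tendsto ?_ 0
      exact ((continuous_const.mul continuous_id).rpow_const fun x => Or.inr lz).mul continuous_const
    rw [mul_zero, Real.zero_rpow lz, zero_mul] at this
    exact this.mono_left nhdsWithin_le_nhds
  filter_upwards [h2.eventually (gt_mem_nhds hc), self_mem_nhdsWithin] with η hη h0
  have h0 : 0 < η := h0
  have h3 : volume (K0 ∩ {x | dst x Γ ≤ 2 * η}) ≤ ∫⁻ x in ball 0 R, ofReal ((2 * η) ^ (1 + γ / 2)) * ofReal (dst x Γ ^ (-(1 + γ / 2))) := by
    have hmeas : MeasurableSet {x : E | dst x Γ ≤ 2 * η} := (isClosed_le (continuous_infDist_pt _) continuous_const).measurableSet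
    calc _ ≤ volume (ball 0 R ∩ {x : E | dst x Γ ≤ 2 * η}) := measure_mono (inter_subset_inter_left _ hR)
      _ = ∫⁻ x in ball 0 R, indicator {x : E | dst x Γ ≤ 2 * η} 1 x := by
        rw [lintegral_indicator_one hmeas, Measure.restrict_apply hmeas, inter_comm]
      _ ≤ _ := by
        refine lintegral_mono_ae (ae_restrict_of_ae ?_)
        filter_upwards [h.aeΩ] with x hx
        by_cases hxd : dst x Γ ≤ 2 * η
        · have hp := dl_pos h.closed h.ne hx
          rw [iom (by exact hxd), ← ofReal_mul pz, Pi.one_apply, ← ofReal_one]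
          apply ole
          rw [rpow_neg hp.le, ← div_eq_mul_inv, one_le_div pz]
          exact Real.rpow_le_rpow hp.le hxd lz
        · rw [ion (by exact hxd)]; exact zero_le
  refine h3.trans ?_
  rw [lcm _ _ ont]
  refine (mlr h1 _).trans ?_
  rw [← ofReal_mul pz]
  apply ole
  rw [rpow_add pz, Real.rpow_one]
  nlinarith

structure HF (d : ℝ) (Γ K0 : Set E) (f : E → ℝ) (g : E → E) : Prop where
  cpt : IsCompact K0
  fm : AEStronglyMeasurable f volume
  bd : ∃ M : ℝ, 0 < M ∧ ∀ x, f x ^ 2 ≤ M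
  zero : ∀ x ∉ K0, f x = 0
  gm : AEStronglyMeasurable g volume
  wg : ∀ η : ℝ, 0 < η → ∀ (χ : E → ℝ) (L : ℝ≥0), Lip L χ → (∀ x, |χ x| ≤ 1) → (∀ x, dst x Γ < η → χ x = 0) →
    WG (K0 ∩ {x | η ≤ dst x Γ}) (fun x => χ x * f x ^ 2) (fun x => f x ^ 2 • gradient χ x + (2 * χ x * f x) • g x)
  trace : ∀ᵐ z ∂(μH[d].restrict Γ), ∀ c > (0:ℝ), ∀ᶠ t in 𝓝[>] (0:ℝ), ∫⁻ x in ball z t, ofReal (f x ^ 2) ≤ ofReal (c * t ^ dimE)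

theorem hardy_eps {d cA : ℝ} {Γ : Set E} (h : AR d cA Γ) {K0 : Set E} {f : E → ℝ} {g : E → E} (H : HF d Γ K0 f g) {z : E} (hz : z ∈ Γ)
    (tr : ∀ c > (0:ℝ), ∀ᶠ t in 𝓝[>] (0:ℝ), ∫⁻ x in ball z t, ofReal (f x ^ 2) ≤ ofReal (c * t ^ dimE))
    {ε : ℝ} (hε : 0 < ε) :
    ∃ χ : E → ℝ, Continuous χ ∧ (∀ x, χ x ≤ 1) ∧ (∀ x, 0 ≤ χ x) ∧ (∀ x, 2 * ε ≤ dst x Γ → χ x = 1) ∧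
      ∫⁻ x, ofReal (2⁻¹ * (χ x * f x ^ 2 * (dist x z ^ (dimE - 1) * (dist x z + ε) ^ 2)⁻¹)) ≤
        ofReal (2 * ε) + ∫⁻ x, ofReal (2 * (‖g x‖ ^ 2 * (dist x z ^ (dimE - 1))⁻¹)) := by
  obtain ⟨M, hM, hfM⟩ := H.bd
  have hn2 := h.n2
  set n := dimE with hnn
  obtain ⟨t, ht, hte, ht0⟩ := ((tr (ε ^ 2 / 3 ^ n) pz).and ((Ioo_mem_nhdsGT (show (0:ℝ) < 3 * ε by positivity)))).exists
  set τ := t / 3 with hτ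
  have hτ0 : 0 < τ := by positivity
  obtain ⟨η, hη, hη0, hηe⟩ := ((h.layer H.cpt.isBounded (c := ε * (M * (ε⁻¹ * (τ ^ (n - 1))⁻¹))⁻¹) pz).and ((Ioo_mem_nhdsGT hε))).exists
  have hd1 : Lip 1 (fun x : E => dst x Γ) := lipschitz_infDist_pt Γ
  have hd2 : Lip 1 (fun x : E => dist x z) := LipschitzWith.dist_left z
  let aη : ℝ≥0 := ⟨η⁻¹, by positivity⟩
  let aτ : ℝ≥0 := ⟨τ⁻¹, by positivity⟩
  have haη : (aη : ℝ) = η⁻¹ := rfl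
  have haτ : (aτ : ℝ) = τ⁻¹ := rfl
  have l1 := lip_aff hd1 aη 1
  have l2 := lip_aff hd2 aτ 1
  set p := fun x : E => aη * dst x Γ - 1 with hp
  set q := fun x : E => aτ * dist x z - 1 with hq
  have lp := clp_lip l1
  have lq := clp_lip l2
  have lm := lip_mul lp lq (clp_abs p) (clp_abs q)
  have pη : ∀ x, dst x Γ ≤ η → p x ≤ 0 := fun x hx => by
    simp only [hp, haη]; rw [sub_nonpos, inv_mul_le_iff₀ hη0]; linarith
  have pη' : ∀ x, 2 * η ≤ dst x Γ → 1 ≤ p x := fun x hx => by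
    simp only [hp, haη]; rw [le_sub_iff_add_le, le_inv_mul_iff₀ hη0]; linarith
  have pη2 : ∀ x, 2 * η < dst x Γ → 1 < p x := fun x hx => by
    simp only [hp, haη]; rw [lt_sub_iff_add_lt, lt_inv_mul_iff₀ hη0]; linarith
  have qτ : ∀ x, dist x z ≤ τ → q x ≤ 0 := fun x hx => by
    simp only [hq, haτ]; rw [sub_nonpos, inv_mul_le_iff₀ hτ0]; linarith
  have qτ' : ∀ x, 2 * τ ≤ dist x z → 1 ≤ q x := fun x hx => by
    simp only [hq, haτ]; rw [le_sub_iff_add_le, le_inv_mul_iff₀ hτ0]; linarith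
  have qτ2 : ∀ x, 2 * τ < dist x z → 1 < q x := fun x hx => by
    simp only [hq, haτ]; rw [lt_sub_iff_add_lt, lt_inv_mul_iff₀ hτ0]; linarith
  have qτ3 : ∀ x, dist x z < τ → q x < 0 := fun x hx => by
    simp only [hq, haτ]; rw [sub_neg, inv_mul_lt_iff₀ hτ0]; linarith
  set χ := fun x => clp p x * clp q x with hχ
  have hχ0 : ∀ x, 0 ≤ χ x := fun x => mul_nonneg (clp0 _ _) (clp0 _ _)
  have hχ1 : ∀ x, χ x ≤ 1 := fun x => mul_le_one₀ (clp1 _ _) (clp0 _ _) (clp1 _ _)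
  refine ⟨χ, lm.continuous, hχ1, hχ0, fun x hx => ?_, ?_⟩
  · have := infDist_le_dist_of_mem (x := x) hz
    simp only [hχ]
    rw [clp_eq1 (pη' x lz), clp_eq1 (qτ' x lz), one_mul]
  have W := H.wg η hη0 χ _ lm (fun x => by rw [abn (hχ0 x)]; exact hχ1 x) (fun x hx => by
    simp only [hχ]; rw [clp_eq0 (pη x hx.le), zero_mul])
  have hKc : IsCompact (K0 ∩ {x | η ≤ dst x Γ}) := H.cpt.inter_right (isClosed_le continuous_const (continuous_infDist_pt _))
  obtain ⟨i1, i2⟩ := base_id hKc W (z := z) (fun hzK => by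
    have : η ≤ dst z Γ := hzK.2
    rw [infDist_zero_of_mem hz] at this; linarith) hε (by omega)
  have hgχm : Measurable (gradient χ) := by
    unfold gradient; exact ((InnerProductSpace.toDual ℝ E).symm.continuous.measurable.comp (measurable_fderiv ℝ χ))
  have hsm : Measurable fun x : E => dist x z := (continuous_id.dist continuous_const).measurable
  have hne : ∀ᵐ x : E, x ≠ z := by filter_upwards [h.aeΩ] with x hx h1 using hx (h1 ▸ hz)
  have main := lint_le_of_int0 (a := fun x => 2⁻¹ * (χ x * f x ^ 2 * (dist x z ^ (n - 1) * (dist x z + ε) ^ 2)⁻¹))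
    (b := fun x => f x ^ 2 * ‖gradient χ x‖ * (dist x z ^ (n - 1) * (dist x z + ε))⁻¹ + 2 * (‖g x‖ ^ 2 * (dist x z ^ (n - 1))⁻¹)) i1 i2
    (aoa _ fun x => by have := hχ0 x; positivity) (fun x => by positivity) (by
      have := H.fm.aemeasurable
      have := H.gm.norm.aemeasurable
      have := hgχm.norm
      fun_prop) (by
      filter_upwards [hne] with x hx
      have hs : 0 < dist x z := dist_pos.2 hx
      have e1 : inner ℝ (x - z) (f x ^ 2 • gradient χ x + (2 * χ x * f x) • g x) ≤ dist x z * (f x ^ 2 * ‖gradient χ x‖ + 2 * χ x * (|f x| * ‖g x‖)) := by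
        refine (real_inner_le_norm _ _).trans ?_
        rw [dist_eq_norm]
        refine mln ((norm_add_le _ _).trans (le_of_eq ?_)) (norm_nonneg _)
        rw [norm_smul, norm_smul, norm_eq_abs, norm_eq_abs, abn (sq_nonneg _), abs_mul, abs_mul, abn (hχ0 x), abs_two]
        ring
      have hn1 : dist x z ^ n = dist x z ^ (n - 1) * dist x z := by rw [← pow_succ]; congr 1; omega
      rw [hn1]
      set s := dist x z with hs'
      set P := s ^ (n - 1) with hP
      have hP0 : 0 < P := by positivity
      have e2 : (P * s * (s + ε))⁻¹ * inner ℝ (x - z) (f x ^ 2 • gradient χ x + (2 * χ x * f x) • g x) ≤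
          f x ^ 2 * ‖gradient χ x‖ * (P * (s + ε))⁻¹ + χ x * (2 * (|f x| * (s + ε)⁻¹) * ‖g x‖) * P⁻¹ := by
        refine (mln e1 pz).trans (le_of_eq ?_)
        field_simp
      have e3 : 2 * (|f x| * (s + ε)⁻¹) * ‖g x‖ ≤ 2⁻¹ * (|f x| * (s + ε)⁻¹) ^ 2 + 2 * ‖g x‖ ^ 2 := by
        nlinarith [sq_nonneg (|f x| * (s + ε)⁻¹ - 2 * ‖g x‖)]
      have e4 : χ x * (2 * (|f x| * (s + ε)⁻¹) * ‖g x‖) * P⁻¹ ≤ χ x * (2⁻¹ * (|f x| * (s + ε)⁻¹) ^ 2) * P⁻¹ + 2 * (‖g x‖ ^ 2 * P⁻¹) := by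
        have h1 : χ x * (2 * (|f x| * (s + ε)⁻¹) * ‖g x‖) ≤ χ x * (2⁻¹ * (|f x| * (s + ε)⁻¹) ^ 2) + 2 * ‖g x‖ ^ 2 := by
          have := mln e3 (hχ0 x)
          have := hχ1 x
          nlinarith [sq_nonneg ‖g x‖]
        have := mrn h1 (show 0 ≤ P⁻¹ by positivity)
        linarith
      have e5 : χ x * (2⁻¹ * (|f x| * (s + ε)⁻¹) ^ 2) * P⁻¹ = 2⁻¹ * (χ x * f x ^ 2 * (P * (s + ε) ^ 2)⁻¹) := by
        rw [mul_pow, sq_abs, mul_inv, inv_pow]; ring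
      linarith)
  refine main.trans ?_
  refine (lintegral_mono fun x => ofReal_add_le).trans ?_
  rw [lintegral_add_right' _ (by
      have := H.gm.norm.aemeasurable
      fun_prop)]
  gcongr
  set c1 := M * (ε⁻¹ * (τ ^ (n - 1))⁻¹) with hc1
  set c2 := ε⁻¹ * (τ ^ (n - 1))⁻¹ * τ⁻¹ with hc2
  have b1 : ∀ᵐ x, ofReal (f x ^ 2 * ‖gradient χ x‖ * (dist x z ^ (n - 1) * (dist x z + ε))⁻¹) ≤
      (K0 ∩ {x | dst x Γ ≤ 2 * η}).indicator (fun _ => ofReal (c1 * η⁻¹)) x + ofReal c2 * (ball z t).indicator (fun x => ofReal (f x ^ 2)) x := by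
    filter_upwards [norm_grad_mul lp lq, hne] with x hx hxz
    have hs : 0 < dist x z := dist_pos.2 hxz
    by_cases hxτ : τ ≤ dist x z
    · have k1 : (dist x z ^ (n - 1) * (dist x z + ε))⁻¹ ≤ ε⁻¹ * (τ ^ (n - 1))⁻¹ := by
        rw [← mul_inv, mul_comm ε]; gcongr; linarith
      have k2 : f x ^ 2 * ‖gradient χ x‖ * (dist x z ^ (n - 1) * (dist x z + ε))⁻¹ ≤ f x ^ 2 * (‖gradient (clp p) x‖ + ‖gradient (clp q) x‖) * (ε⁻¹ * (τ ^ (n - 1))⁻¹) := by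
        gcongr
        rw [abn (clp0 _ _), abn (clp0 _ _)] at hx
        have := clp1 p x
        have := clp1 q x
        nlinarith [norm_nonneg (gradient (clp p) x), norm_nonneg (gradient (clp q) x)]
      refine (ole k2).trans ?_
      rw [mul_add, add_mul]
      refine ofReal_add_le.trans (add_le_add ?_ ?_)
      · by_cases hxm : x ∈ K0 ∩ {x | dst x Γ ≤ 2 * η}
        · rw [iom hxm]
          apply ole
          have := norm_grad_le lp x
          rw [haη] at this
          have := hfM x
          calc _ ≤ M * η⁻¹ * (ε⁻¹ * (τ ^ (n - 1))⁻¹) := by gcongr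
            _ = _ := by rw [hc1]; ring
        · rw [ion hxm]
          by_cases hxK : x ∈ K0
          · rw [clp_grad1 l1.continuous (pη2 x (not_le.1 fun h => hxm ⟨hxK, h⟩))]; simp
          · rw [H.zero x hxK]; simp
      · by_cases hxm : x ∈ ball z t
        · rw [iom hxm, ← ofReal_mul pz]
          apply ole
          have := norm_grad_le lq x
          rw [haτ] at this
          calc _ ≤ f x ^ 2 * τ⁻¹ * (ε⁻¹ * (τ ^ (n - 1))⁻¹) := by gcongr
            _ = _ := by rw [hc2]; ring
        · rw [clp_grad1 l2.continuous (qτ2 x (by have := not_lt.1 (mt mem_ball.2 hxm); linarith))]; simp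
    · have k3 : gradient χ x = 0 := by
        rw [← norm_le_zero_iff]
        refine hx.trans (le_of_eq ?_)
        rw [clp_grad0 l2.continuous (qτ3 x (not_le.1 hxτ)), clp_eq0 (qτ3 x (not_le.1 hxτ)).le]; simp
      rw [k3]; simp
  refine (lintegral_mono_ae b1).trans ?_
  have hmeas : MeasurableSet (K0 ∩ {x | dst x Γ ≤ 2 * η}) := H.cpt.measurableSet.inter (isClosed_le (continuous_infDist_pt _) continuous_const).measurableSet
  rw [lintegral_add_left (measurable_const.indicator hmeas), lintegral_indicator hmeas, lintegral_const, Measure.restrict_apply_univ,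
    lcm _ _ ont, lintegral_indicator msb, two_mul ε, ofReal_add hε.le hε.le]
  have hc1p : 0 < c1 := by positivity
  have hc2p : 0 < c2 := by positivity
  gcongr
  · refine (mlr hη _).trans ?_
    rw [← ofReal_mul pz]
    apply ole
    apply le_of_eq; field_simp
  · refine (mlr ht _).trans ?_
    rw [← ofReal_mul pz]
    apply ole
    apply le_of_eq
    have : t ^ n = 3 ^ n * (τ ^ (n - 1) * τ) := by
      rw [← pow_succ, show n - 1 + 1 = n by omega, ← mul_pow]; congr 1; rw [hτ]; ring
    rw [hc2, this]; field_simp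

theorem hardy_pt {d cA : ℝ} {Γ : Set E} (h : AR d cA Γ) {K0 : Set E} {f : E → ℝ} {g : E → E} (H : HF d Γ K0 f g) {z : E} (hz : z ∈ Γ)
    (tr : ∀ c > (0:ℝ), ∀ᶠ t in 𝓝[>] (0:ℝ), ∫⁻ x in ball z t, ofReal (f x ^ 2) ≤ ofReal (c * t ^ dimE)) :
    ∫⁻ x, ofReal (f x ^ 2) * ofReal (dist x z ^ (-((dimE : ℝ) + 1))) ≤
      4 * ∫⁻ x, ofReal (‖g x‖ ^ 2) * ofReal (dist x z ^ (-((dimE : ℝ) - 1))) := by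
  have hn2 := h.n2
  have hε : ∀ m : ℕ, (0:ℝ) < 1 / ((m:ℝ) + 1) := fun m => by positivity
  choose χ c1 c2 c3 c4 c5 using fun m => hardy_eps h H hz tr (hε m)
  have hlim : Tendsto (fun m : ℕ => 1 / ((m:ℝ) + 1)) atTop (𝓝 0) := tendsto_one_div_add_atTop_nhds_zero_nat
  set n := dimE with hnn
  have hne : ∀ᵐ x : E, x ∉ Γ ∧ x ≠ z := by filter_upwards [h.aeΩ] with x hx using ⟨hx, fun h1 => hx (h1 ▸ hz)⟩
  have hsm : Measurable fun x : E => dist x z := (continuous_id.dist continuous_const).measurable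
  have F := fatou (μ := volume) (F0 := fun x => ofReal (2⁻¹ * (1 * f x ^ 2 * (dist x z ^ (n - 1) * (dist x z + 0) ^ 2)⁻¹))) (fun m => by
      have := H.fm.aemeasurable
      have := (c1 m).measurable
      fun_prop) (by
      filter_upwards [hne] with x hx
      have hs : 0 < dist x z := dist_pos.2 hx.2
      have hdp := dl_pos h.closed h.ne hx.1
      refine ENNReal.tendsto_ofReal (Tendsto.const_mul _ ?_)
      refine Tendsto.mul (Tendsto.mul_const _ ?_) ?_
      · refine tendsto_const_nhds.congr' ?_
        filter_upwards [hlim.eventually (gt_mem_nhds (show 0 < dst x Γ / 2 by linarith))] with m hm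
        rw [c4 m x lz]
      · refine Tendsto.inv₀ ?_ pz
        exact (((hlim.const_add _).pow 2).const_mul _)) 
      (Tendsto.add (ENNReal.tendsto_ofReal (hlim.const_mul 2)) tendsto_const_nhds) c5
  rw [mul_zero, ofReal_zero, zero_add] at F
  have e1 : ∫⁻ x, ofReal (f x ^ 2) * ofReal (dist x z ^ (-((n : ℝ) + 1))) = 2 * ∫⁻ x, ofReal (2⁻¹ * (1 * f x ^ 2 * (dist x z ^ (n - 1) * (dist x z + 0) ^ 2)⁻¹)) := by
    rw [← lcm _ _ ENNReal.ofNat_ne_top]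
    refine lintegral_congr fun x => ?_
    rw [← ofReal_mul (sq_nonneg _), ← ofReal_ofNat, ← ofReal_mul nz]
    congr 1
    rw [rpow_neg dist_nonneg, show (n:ℝ) + 1 = ((n - 1 + 2 : ℕ) : ℝ) by rw [show n - 1 + 2 = n + 1 by omega]; push_cast; ring, rpow_natCast, pow_add]
    ring
  have e2 : 2 * ∫⁻ x, ofReal (2 * (‖g x‖ ^ 2 * (dist x z ^ (n - 1))⁻¹)) = 4 * ∫⁻ x, ofReal (‖g x‖ ^ 2) * ofReal (dist x z ^ (-((n : ℝ) - 1))) := by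
    rw [← lcm _ _ ENNReal.ofNat_ne_top, ← lcm _ _ ENNReal.ofNat_ne_top]
    refine lintegral_congr fun x => ?_
    rw [← ofReal_mul (sq_nonneg _), ← ofReal_ofNat 2, ← ofReal_ofNat 4, ← ofReal_mul nz, ← ofReal_mul nz]
    congr 1
    rw [rpow_neg dist_nonneg, show (n:ℝ) - 1 = ((n - 1 : ℕ) : ℝ) by rw [Nat.cast_sub (by omega)]; push_cast; ring, rpow_natCast]
    ring
  rw [e1, ← e2]
  exact mlr F _

theorem hardy (d cA : ℝ) : ∃ C : ℝ, 0 < C ∧ ∀ {Γ : Set E}, AR d cA Γ → ∀ {K0 : Set E} {f : E → ℝ} {g : E → E}, HF d Γ K0 f g →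
    ∫⁻ x, ofReal (f x ^ 2 * dst x Γ ^ (-2 : ℝ) * wt d Γ x) ≤ ofReal C * ∫⁻ x, ofReal (‖g x‖ ^ 2 * wt d Γ x) := by
  by_cases hd : 0 < d ∧ d < (dimE : ℝ) - 1 ∧ 1 ≤ cA
  swap
  · exact ⟨1, one_pos, fun h => (hd ⟨h.d0, h.dn, h.C0⟩).elim⟩
  obtain ⟨hd0, hdn, hC0⟩ := hd
  set n := dimE with hnn
  have h2 : (2:ℝ) ^ (d - ((n:ℝ) - 1)) < 1 := Real.rpow_lt_one_of_one_lt_of_neg nz lz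
  set C1 := cA * 2 ^ ((n:ℝ) + 1) with hC1
  set C2 := cA * 6 ^ d * (1 - 2 ^ (d - ((n:ℝ) - 1)))⁻¹ with hC2
  have hC1p : 0 < C1 := by positivity
  have hC2p : 0 < C2 := by have : 0 < 1 - (2:ℝ) ^ (d - ((n:ℝ) - 1)) := by linarith
                           positivity
  refine ⟨C1 * (4 * C2), by positivity, fun {Γ} h {K0 f g} H => ?_⟩
  haveI := h.sfin
  set σ := (μH[d] : Measure E).restrict Γ with hσ
  have hfm : AEMeasurable (fun x => ofReal (f x ^ 2)) volume := by
    have := H.fm.aemeasurable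
    fun_prop
  have hgm : AEMeasurable (fun x => ofReal (‖g x‖ ^ 2)) volume := by
    have := H.gm.norm.aemeasurable
    fun_prop
  have hdm : ∀ p : ℝ, Measurable fun y : E × E => ofReal (dist y.1 y.2 ^ p) := fun p =>
    ((measurable_fst.dist measurable_snd).pow_const p).ennreal_ofReal
  have hdm' : ∀ (p : ℝ) (x : E), Measurable fun y : E => ofReal (dist x y ^ p) := fun p x =>
    ((measurable_const.dist measurable_id).pow_const p).ennreal_ofReal
  have s1 : ∫⁻ x, ofReal (f x ^ 2 * dst x Γ ^ (-2 : ℝ) * wt d Γ x) ≤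
      ofReal C1 * ∫⁻ x, ∫⁻ z, ofReal (f x ^ 2) * ofReal (dist x z ^ (-((n:ℝ) + 1))) ∂σ := by
    rw [← lcm _ _ ont]
    refine lintegral_mono_ae ?_
    filter_upwards [h.aeΩ] with x hx
    have hp := dl_pos h.closed h.ne hx
    rw [lcm _ _ ont, wt, mul_assoc, ← rpow_add hp, ofReal_mul (sq_nonneg _),
      show -2 + (d + 1 - (n:ℝ)) = d - ((n:ℝ) + 1) by ring]
    have := h.ker_low (p := (n:ℝ) + 1) pz hx
    calc _ ≤ ofReal (f x ^ 2) * (ofReal C1 * ∫⁻ z, ofReal (dist x z ^ (-((n:ℝ) + 1))) ∂σ) := by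
          refine mlr (this.trans (mlr ?_ _)) _
          exact lintegral_mono_set inter_subset_left
      _ = _ := by ring
  refine s1.trans ?_
  rw [ofReal_mul hC1p.le, mul_assoc]
  refine mlr ?_ _
  rw [lintegral_lintegral_swap (hfm.comp_fst.mul (hdm _).aemeasurable)]
  have s3 : ∀ᵐ z ∂σ, ∫⁻ x, ofReal (f x ^ 2) * ofReal (dist x z ^ (-((n:ℝ) + 1))) ≤
      4 * ∫⁻ x, ofReal (‖g x‖ ^ 2) * ofReal (dist x z ^ (-((n : ℝ) - 1))) := by
    filter_upwards [H.trace, ae_restrict_mem h.closed.measurableSet] with z hz hzΓ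
    exact hardy_pt h H hzΓ hz
  refine (lintegral_mono_ae s3).trans ?_
  rw [lcm _ _ ENNReal.ofNat_ne_top, ofReal_mul nz, ofReal_ofNat, mul_assoc]
  refine mlr ?_ _
  have s4 : AEMeasurable (Function.uncurry fun z x => ofReal (‖g x‖ ^ 2) * ofReal (dist x z ^ (-((n : ℝ) - 1)))) (σ.prod volume) :=
    hgm.comp_snd.mul ((hdm (-((n : ℝ) - 1))).comp measurable_swap).aemeasurable
  rw [← lcm _ _ ont, lintegral_lintegral_swap s4]
  refine lintegral_mono_ae ?_
  filter_upwards [h.aeΩ] with x hx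
  rw [lcm _ _ ont, ofReal_mul (sq_nonneg _), mul_left_comm, ← ofReal_mul hC2p.le]
  refine mlr ?_ _
  have := h.ker_up (p := (n:ℝ) - 1) lz hx
  simp_rw [dist_comm x]
  rw [wt, show d + 1 - (n:ℝ) = d - ((n:ℝ) - 1) by ring]
  exact this

theorem smooth_lip {χ : E → ℝ} (h : Sm χ) (hc : Hcs χ) : ∃ L : ℝ≥0, Lip L χ :=
  h.lipschitzWith_of_hasCompactSupport hc sz

theorem WG.lmul {K : Set E} (hK : IsCompact K) {f : E → ℝ} {g : E → E} (h : WG K f g) {χ : E → ℝ} {L : ℝ≥0}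
    (hL : Lip L χ) {M : ℝ≥0} (hb : ∀ x, |χ x| ≤ M) : WG K (fun x => χ x * f x) (fun x => f x • gradient χ x + χ x • g x) := by
  obtain ⟨χ0, c1, c2, c3, c4, c5⟩ := exists_cutoff hK isOpen_univ (subset_univ K)
  have hKn : ∀ x ∈ K, χ0 =ᶠ[𝓝 x] fun _ => 1 := fun x hx => eventually_nhdsSet_iff_forall.1 c4 x hx
  obtain ⟨L0, hL0⟩ := smooth_lip c1 c2
  have hl := lip_mul hL hL0 hb (N := 1) fun x => by rw [abn (c5 x).1]; exact_mod_cast (c5 x).2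
  have w := WG.lip (K := tsupport χ0) c2 hl fun x hx => by rw [offs hx, mul_zero]
  have w2 := WG.mul hK c2 h w
  have e1 : (fun x => f x * (χ x * χ0 x)) = fun x => χ x * f x := by
    ext x
    by_cases hx : x ∈ K
    · rw [(hKn x hx).eq_of_nhds]; ring
    · rw [h.zero x hx]; ring
  rw [e1] at w2
  refine w2.congr ?_
  filter_upwards [h.gzero] with x hg
  by_cases hx : x ∈ K
  · have : gradient (fun x => χ x * χ0 x) x = gradient χ x := by
      unfold gradient
      rw [Filter.EventuallyEq.fderiv_eq (f := χ)]
      filter_upwards [hKn x hx] with y hy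
      rw [hy, mul_one]
    rw [this, (hKn x hx).eq_of_nhds, mul_one]
  · rw [h.zero x hx, hg hx]; simp

theorem HF.ofWG {d : ℝ} {Γ K : Set E} (hΓ : IsClosed Γ) (hne : Γ.Nonempty) (hK : IsCompact K) (hKΓ : K ⊆ Γᶜ) {f : E → ℝ} {g : E → E} (h : WG K f g) : HF d Γ K f g where
  cpt := hK
  fm := h.cont.aestronglyMeasurable
  bd := by
    obtain ⟨M, hM, hb⟩ := h.bdd hK
    exact ⟨M ^ 2 + 1, by positivity, fun x => by have := sq_le_sq' (by have := neg_abs_le (f x); linarith [hb x]) ((le_abs_self _).trans (hb x)); linarith⟩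
  zero := h.zero
  gm := h.mem.1
  wg := fun η hη χ L hL hb hz => by
    have w := (WG.mul hK hK h h).lmul hK hL (M := 1) (by exact_mod_cast hb)
    have w2 : WG K (fun x => χ x * f x ^ 2) (fun x => f x ^ 2 • gradient χ x + (2 * χ x * f x) • g x) := by
      have e : (fun x => χ x * (f x * f x)) = fun x => χ x * f x ^ 2 := by ext x; ring
      rw [e] at w
      refine w.congr (aoa _ fun x => ?_)
      simp only []
      rw [← add_smul, smul_smul, sq]; congr 2; ring
    refine w2.shrink (fun x hx => ?_) ?_
    · by_cases hxK : x ∈ K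
      · rw [hz x (not_le.1 fun h1 => hx ⟨hxK, h1⟩), zero_mul]
      · rw [h.zero x hxK]; simp
    · refine aoa _ fun x hx => ?_
      by_cases hxK : x ∈ K
      · have h2 : dst x Γ < η := not_le.1 fun h1 => hx ⟨hxK, h1⟩
        rw [hz x h2, grad_loc_const (c := 0)]
        · simp
        · filter_upwards [(continuous_infDist_pt Γ).continuousAt.eventually (gt_mem_nhds h2)] with y hy using hz y hy
      · rw [h.zero x hxK]; simp
  trace := by
    filter_upwards [ae_restrict_mem hΓ.measurableSet] with z hz c hc
    have : ∀ᶠ t in 𝓝[>] (0:ℝ), ball z t ⊆ Kᶜ := by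
      obtain ⟨e, he, hb⟩ := Metric.isOpen_iff.1 hK.isClosed.isOpen_compl z (fun h => hKΓ h hz)
      filter_upwards [Ioo_mem_nhdsGT he] with t ht using (bsb ht.2.le).trans hb
    filter_upwards [this] with t ht
    rw [setLIntegral_congr_fun (g := fun _ => 0) msb (fun x hx => by simp [h.zero x (ht hx)])]
    simp

theorem Core.HFat {d cB cA : ℝ} {Γ B : Set E} {A : E → E →L[ℝ] E} {U : E → ℝ} {G : E → E} (h : Core d cB Γ A B U G) (ha : AR d cA Γ) {s : ℝ} (hs : 0 < s) :
    ∃ K0, HF d Γ K0 (fun x => s⁻¹ * arctan (s * U x)) (fun x => (1 + (s * U x) ^ 2)⁻¹ • G x) := by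
  obtain ⟨K0, hK0, hz0⟩ := h.cs
  refine ⟨K0, ?_⟩
  let F : ℝ → ℝ := fun t => s⁻¹ * arctan (s * t)
  have hF : Sm F := contDiff_const.mul (Real.contDiff_arctan.comp (contDiff_const.mul contDiff_id))
  have hF' : deriv F = fun t => (1 + (s * t) ^ 2)⁻¹ := by
    ext t
    have : HasDerivAt F (s⁻¹ * (1 / (1 + (s * t) ^ 2) * (s * 1))) t :=
      HasDerivAt.const_mul _ ((Real.hasDerivAt_arctan (s * t)).comp t ((hasDerivAt_id t).const_mul s))
    rw [this.deriv]; field_simp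
  have hUm : AEStronglyMeasurable U volume := h.integ.1
  have hch := (h.ch hF).sq h.closed
  rw [hF'] at hch
  have hat : ∀ t, |arctan t| ≤ 2 := fun t => by
    have h1 := Real.neg_pi_div_two_lt_arctan t
    have h2 := Real.arctan_lt_pi_div_two t
    have h3 := Real.pi_lt_four
    rw [abs_le]; constructor <;> linarith
  have hF0 : ∀ x ∉ K0, F (U x) = 0 := fun x hx => by simp [F, hz0 x hx]
  have hFU : ∀ x, F (U x) ^ 2 ≤ 2 * s⁻¹ * U x := fun x => by
    have h1 : 0 ≤ s * U x := mul_nonneg hs.le (h.nonneg x)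
    have h2 : arctan (s * U x) ≤ s * U x := by
      have := Real.le_tan (Real.arctan_nonneg.2 h1) (Real.arctan_lt_pi_div_two _)
      rwa [Real.tan_arctan] at this
    have h3 := (abs_le.1 (hat (s * U x))).2
    have h4 := Real.arctan_nonneg.2 h1
    calc F (U x) ^ 2 = s⁻¹ ^ 2 * (arctan (s * U x) * arctan (s * U x)) := by simp only [F]; ring
      _ ≤ s⁻¹ ^ 2 * (2 * (s * U x)) := by gcongr
      _ = _ := by field_simp
  exact {
    cpt := hK0
    fm := (hF.continuous.comp_aestronglyMeasurable hUm)
    bd := ⟨(s⁻¹ * 2) ^ 2, by positivity, fun x => by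
      rw [mul_pow, mul_pow]
      exact mln (sq_le_sq' (abs_le.1 (hat _)).1 (abs_le.1 (hat _)).2) (sq_nonneg _)⟩
    zero := hF0
    gm := by
      have := hUm.aemeasurable
      have h2 : AEMeasurable (fun x => (1 + (s * U x) ^ 2)⁻¹) volume := by fun_prop
      exact h2.aestronglyMeasurable.smul h.Gm
    wg := fun η hη χ L hL hb hz => by
      obtain ⟨χ0, c1, c2, c3, c4, c5⟩ := exists_cutoff hK0 isOpen_univ (subset_univ K0)
      have hKn : ∀ x ∈ K0, χ0 =ᶠ[𝓝 x] fun _ => 1 := fun x hx => eventually_nhdsSet_iff_forall.1 c4 x hx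
      obtain ⟨L0, hL0⟩ := smooth_lip c1 c2
      have hl := lip_mul hL hL0 (M := 1) (by exact_mod_cast hb) (N := 1) fun x => by rw [abn (c5 x).1]; exact_mod_cast (c5 x).2
      have hcl : IsClosed {x | η ≤ dst x Γ} := isClosed_le continuous_const (continuous_infDist_pt _)
      have w := hch (tsupport χ0 ∩ {x | η ≤ dst x Γ}) (c2.isCompact.inter_right hcl) (fun x hx hxΓ => by
          have : η ≤ dst x Γ := hx.2
          rw [infDist_zero_of_mem hxΓ] at this; linarith) _ _ hl (fun x hx => by
          by_cases hxs : x ∈ tsupport χ0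
          · rw [hz x (not_le.1 fun h1 => hx ⟨hxs, h1⟩), zero_mul]
          · rw [offs hxs, mul_zero])
      have e : (fun x => χ x * χ0 x * F (U x) ^ 2) = fun x => χ x * F (U x) ^ 2 := by
        ext x
        by_cases hx : x ∈ K0
        · rw [(hKn x hx).eq_of_nhds]; ring
        · rw [hF0 x hx]; ring
      rw [e] at w
      refine (w.congr (g' := fun x => F (U x) ^ 2 • gradient χ x + (2 * χ x * F (U x)) • (1 + (s * U x) ^ 2)⁻¹ • G x) (aoa _ fun x => ?_)).shrink (fun x hx => ?_) (aoa _ fun x hx => ?_)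
      · by_cases hx : x ∈ K0
        · have : gradient (fun x => χ x * χ0 x) x = gradient χ x := by
            unfold gradient
            rw [Filter.EventuallyEq.fderiv_eq (f := χ)]
            filter_upwards [hKn x hx] with y hy
            rw [hy, mul_one]
          simp only []
          rw [this, (hKn x hx).eq_of_nhds, mul_one, smul_smul]
          congr 2; ring
        · simp [hF0 x hx]
      · by_cases hxK : x ∈ K0
        · rw [hz x (not_le.1 fun h1 => hx ⟨hxK, h1⟩), zero_mul]
        · rw [hF0 x hxK]; simp
      · by_cases hxK : x ∈ K0
        · have h2 : dst x Γ < η := not_le.1 fun h1 => hx ⟨hxK, h1⟩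
          rw [hz x h2, grad_loc_const (c := 0)]
          · simp
          · filter_upwards [(continuous_infDist_pt Γ).continuousAt.eventually (gt_mem_nhds h2)] with y hy using hz y hy
        · rw [hF0 x hxK]; simp
    trace := by
      filter_upwards [h.trace] with z hz c hc
      have hv := vb_pos (E := E)
      filter_upwards [hz.eventually (gt_mem_nhds (show 0 < c / (2 * s⁻¹ * vb E) by positivity)), self_mem_nhdsWithin] with t ht ht0
      have ht0 : 0 < t := ht0
      refine (lintegral_mono fun x => ole (hFU x)).trans ?_
      rw [← ofReal_integral_eq_lintegral_ofReal ((h.integ.integrableOn).const_mul _) (aoa _ fun x => by have := h.nonneg x; positivity)]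
      apply ole
      rw [setAverage_eq, measureReal_def, vol_b z ht0, ENNReal.toReal_ofReal pz, smul_eq_mul, inv_mul_lt_iff₀ pz] at ht
      rw [integral_const_mul]
      calc _ ≤ 2 * s⁻¹ * (vb E * t ^ dimE * (c / (2 * s⁻¹ * vb E))) := by gcongr
        _ = _ := by field_simp }

theorem Core.hardyU {d cB cA : ℝ} {Γ B : Set E} {A : E → E →L[ℝ] E} {U : E → ℝ} {G : E → E} (h : Core d cB Γ A B U G) (ha : AR d cA Γ) :
    ∫⁻ x, ofReal (U x ^ 2 * dst x Γ ^ (-2 : ℝ) * wt d Γ x) < ⊤ := by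
  obtain ⟨C, hC, hh⟩ := hardy (E := E) d cA
  have hlim : Tendsto (fun m : ℕ => 1 / ((m:ℝ) + 1)) atTop (𝓝[>] 0) := 
    tendsto_nhdsWithin_iff.2 ⟨tendsto_one_div_add_atTop_nhds_zero_nat, Eventually.of_forall fun m => by simp only [mem_Ioi]; positivity⟩
  refine (fatou (μ := volume) (F := fun m x => ofReal (((1 / ((m:ℝ) + 1))⁻¹ * arctan ((1 / ((m:ℝ) + 1)) * U x)) ^ 2 * dst x Γ ^ (-2 : ℝ) * wt d Γ x))
    (c := fun _ => ofReal C * ∫⁻ x, ofReal (‖G x‖ ^ 2 * wt d Γ x)) (fun m => ?_) (aoa _ fun x => ?_) tendsto_const_nhds (fun m => ?_)).trans_lt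
    (ENNReal.mul_lt_top ofReal_lt_top h.Gfin)
  · have := h.integ.1.aemeasurable
    have : Measurable (wt d Γ) := wt_meas
    have : Measurable fun x => dst x Γ := measurable_infDist
    have : Measurable arctan := Real.measurable_arctan
    fun_prop
  · refine ENNReal.tendsto_ofReal (Tendsto.mul_const _ (Tendsto.mul_const _ (Tendsto.pow ?_ 2)))
    have : HasDerivAt (fun s => arctan (s * U x)) (1 / (1 + (0 * U x) ^ 2) * (1 * U x)) 0 :=
      HasDerivAt.arctan ((hasDerivAt_id (0:ℝ)).mul_const (U x))
    have := this.tendsto_slope_zero_right.comp hlim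
    simpa [Function.comp_def] using this
  · obtain ⟨K0, H⟩ := h.HFat ha (s := 1 / ((m:ℝ) + 1)) pz
    refine (hh ha H).trans (mlr (lintegral_mono fun x => ole ?_) _)
    rw [norm_smul, mul_pow]
    have h1 : ‖(1 + (1 / ((m:ℝ) + 1) * U x) ^ 2)⁻¹‖ ≤ 1 := by
      rw [norm_of_nonneg pz]
      exact inv_le_one_of_one_le₀ (by nlinarith [sq_nonneg (1 / ((m:ℝ) + 1) * U x)])
    have h2 : ‖(1 + (1 / ((m:ℝ) + 1) * U x) ^ 2)⁻¹‖ ^ 2 ≤ 1 := pow_le_one₀ (norm_nonneg _) h1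
    have h3 := wt_nonneg (d := d) (Γ := Γ) x
    refine mrn ?_ h3
    nlinarith [sq_nonneg ‖G x‖]

theorem gns_WG {p : ℝ} (hp : Real.HolderConjugate (dimE) p) {K : Set E} (hK : IsCompact K) {f : E → ℝ} {g : E → E} (h : WG K f g) :
    ∫⁻ x, ‖f x‖ₑ ^ p ≤ lintegralPowLePowLIntegralFDerivConst (volume : Measure E) p * (∫⁻ x, ‖g x‖ₑ) ^ p := by
  obtain ⟨K', hK', hKK⟩ := exists_compact_superset hK
  obtain ⟨F, f1, f2, f3, f4⟩ := h.approx hK hKK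
  have hp0 := hp.symm.pos
  have hcs : ∀ k, Hcs (F k) := fun k => hK'.of_isClosed_subset (isClosed_tsupport _) (f2 k)
  set e := fun k => eLpNorm (fun x => gradient (F k) x - g x) 2 volume with he
  have hb : ∀ k, ∫⁻ x, ‖fderiv ℝ (F k) x‖ₑ ≤ (∫⁻ x, ‖g x‖ₑ) + e k * volume K' ^ (1 / 2 : ℝ) := fun k => by
    have a1 : ∀ᵐ x, ‖fderiv ℝ (F k) x‖ₑ ≤ ‖g x‖ₑ + K'.indicator (fun x => ‖gradient (F k) x - g x‖ₑ) x := by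
      filter_upwards [h.gzero] with x hg
      have a2 : ‖fderiv ℝ (F k) x‖ₑ = ‖gradient (F k) x‖ₑ := by
        unfold gradient; rw [LinearIsometryEquiv.enorm_map]
      rw [a2]
      by_cases hx : x ∈ K'
      · rw [iom hx]
        calc _ = ‖g x + (gradient (F k) x - g x)‖ₑ := by congr 1; abel
          _ ≤ _ := enorm_add_le _ _
      · have : gradient (F k) x = 0 := by
          refine grad_loc_const (c := 0) ?_
          filter_upwards [(isClosed_tsupport (F k)).isOpen_compl.mem_nhds fun h1 => hx (f2 k h1)] with y hy using offs hy
        rw [this]; simp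
    have hm : AEStronglyMeasurable (fun x => gradient (F k) x - g x) volume := (grad_cont (f1 k)).aestronglyMeasurable.sub h.mem.1
    refine (lintegral_mono_ae a1).trans ?_
    rw [lintegral_add_left' h.mem.1.enorm, lintegral_indicator hK'.measurableSet]
    gcongr
    rw [← eLpNorm_one_eq_lintegral_enorm]
    refine (eLpNorm_le_eLpNorm_mul_rpow_measure_univ (p := 1) (q := 2) nz hm.restrict).trans ?_
    rw [Measure.restrict_apply_univ]
    exact mul_le_mul' (eLpNorm_mono_measure _ Measure.restrict_le_self) (le_of_eq nz)
  have hKv : volume K' ^ (1 / 2 : ℝ) ≠ ⊤ := ENNReal.rpow_ne_top_of_nonneg nz hK'.measure_lt_top.ne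
  refine fatou (μ := volume) (F := fun k x => ‖F k x‖ₑ ^ p) (c := fun k => lintegralPowLePowLIntegralFDerivConst (volume : Measure E) p * ((∫⁻ x, ‖g x‖ₑ) + e k * volume K' ^ (1 / 2 : ℝ)) ^ p)
    (fun k => ((f1 k).continuous.enorm.measurable.pow_const p).aemeasurable) (aoa _ fun x => ?_) ?_ (fun k => ?_)
  · exact ((ENNReal.continuous_rpow_const.comp continuous_enorm).tendsto _).comp (f3.tendsto_at x)
  · refine ENNReal.Tendsto.const_mul ?_ (Or.inr ENNReal.coe_ne_top)
    refine (ENNReal.continuous_rpow_const.tendsto _).comp ?_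
    have := (ENNReal.Tendsto.mul_const f4 (Or.inr hKv)).const_add (∫⁻ x, ‖g x‖ₑ)
    rwa [zero_mul, add_zero] at this
  · refine (lintegral_pow_le_pow_lintegral_fderiv volume ((f1 k).of_le sz) (hcs k) hp).trans ?_
    gcongr
    exact hb k

theorem fk (hn : 2 ≤ dimE) : ∃ C : ℝ, 0 < C ∧ ∀ {K : Set E}, IsCompact K → ∀ {f : E → ℝ} {g : E → E}, WG K f g →
    ∫⁻ x, ofReal (f x ^ 2) ≤ ofReal C * volume {x | f x ≠ 0} ^ (2 / (dimE : ℝ)) * ∫⁻ x, ofReal (‖g x‖ ^ 2) := by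
  set n := dimE with hnn
  have hn1 : (1:ℝ) < n := by exact_mod_cast hn
  have hp := Real.HolderConjugate.conjExponent hn1
  set p := Real.conjExponent (n:ℝ) with hpd
  set c0 := lintegralPowLePowLIntegralFDerivConst (volume : Measure E) p with hc0
  refine ⟨4 * ((c0 : ℝ) ^ (1 / p)) ^ 2 + 1, by positivity, fun {K} hK {f g} h => ?_⟩
  have hp0 := hp.symm.pos
  set I := ∫⁻ x, ofReal (f x ^ 2) with hI
  set J := ∫⁻ x, ofReal (‖g x‖ ^ 2) with hJ
  set V := volume {x | f x ≠ 0} with hV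
  have hSm : MeasurableSet {x | f x ≠ 0} := (isOpen_ne_fun h.cont continuous_const).measurableSet
  have hfm : AEMeasurable (fun x => ‖f x‖ₑ) volume := h.cont.enorm.measurable.aemeasurable
  have hgm : AEMeasurable (fun x => ‖g x‖ₑ) volume := h.mem.1.enorm
  have hI' : I = ∫⁻ x, ‖f x‖ₑ ^ (2:ℝ) := by
    refine lintegral_congr fun x => ?_
    rw [← sq_abs, ← norm_eq_abs, ofReal_pow (norm_nonneg _), ofReal_norm]; norm_num
  have hJ' : J = ∫⁻ x, ‖g x‖ₑ ^ (2:ℝ) := by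
    refine lintegral_congr fun x => ?_
    rw [ofReal_pow (norm_nonneg _), ofReal_norm]; norm_num
  have hIfin : I ≠ ⊤ := by
    have h1 : MemLp f 2 volume := cc_memLp h.cont (h.hcs hK) 2
    have := h1.eLpNorm_lt_top
    rw [hI']
    exact (lintegral_rpow_enorm_lt_top_of_eLpNorm_lt_top nz nz this).ne
  have h1 := gns_WG hp hK (WG.mul hK hK h h)
  have h2 : ∫⁻ x, ‖f x • g x + f x • g x‖ₑ ≤ 2 * (I ^ (1 / 2 : ℝ) * J ^ (1 / 2 : ℝ)) := by
    calc _ ≤ ∫⁻ x, 2 * (‖f x‖ₑ * ‖g x‖ₑ) := lintegral_mono fun x => by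
          refine (enorm_add_le _ _).trans ?_
          rw [enorm_smul, two_mul]
      _ = 2 * ∫⁻ x, ‖f x‖ₑ * ‖g x‖ₑ := lcm _ _ nz
      _ ≤ _ := by
        rw [hI', hJ']
        exact mlr (ENNReal.lintegral_mul_le_Lp_mul_Lq volume (by rw [Real.holderConjugate_iff]; norm_num) hfm hgm) _
  have h3 : I ≤ (∫⁻ x, ‖f x * f x‖ₑ ^ p) ^ (1 / p) * V ^ (1 / (n:ℝ)) := by
    have := ENNReal.lintegral_mul_le_Lp_mul_Lq volume hp.symm (f := fun x => ‖f x * f x‖ₑ) (g := {x | f x ≠ 0}.indicator 1)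
      (h.cont.mul h.cont).enorm.measurable.aemeasurable (measurable_one.indicator hSm).aemeasurable
    have e1 : ∫⁻ x, ({x | f x ≠ 0}.indicator (1 : E → ℝ≥0∞) x) ^ (n:ℝ) = V := by
      rw [hV, ← lintegral_indicator_one hSm]
      refine lintegral_congr fun x => ?_
      by_cases hx : x ∈ {x | f x ≠ 0}
      · simp [iom hx]
      · rw [ion hx, ENNReal.zero_rpow_of_pos lz]
    rw [e1] at this
    refine le_trans (le_of_eq ?_) this
    refine lintegral_congr fun x => ?_
    by_cases hx : f x = 0
    · simp [hx]
    · rw [Pi.mul_apply, iom (by exact hx), Pi.one_apply, mul_one, ← sq, ← ofReal_norm, norm_of_nonneg (sq_nonneg _)]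
  have h4 : I ≤ ofReal ((c0 : ℝ) ^ (1 / p)) * (2 * (I ^ (1 / 2 : ℝ) * J ^ (1 / 2 : ℝ))) * V ^ (1 / (n:ℝ)) := by
    refine h3.trans ?_
    gcongr
    refine (ENNReal.rpow_le_rpow (h1.trans (mlr (ENNReal.rpow_le_rpow h2 hp0.le) _)) pz).trans ?_
    rw [ENNReal.mul_rpow_of_nonneg _ _ pz, ← ENNReal.rpow_mul, mul_one_div_cancel hp0.ne', ENNReal.rpow_one,
      ← ofReal_rpow_of_nonneg pz pz, ofReal_coe_nnreal]
  have h5 : I * I ≤ I * (ofReal (4 * ((c0 : ℝ) ^ (1 / p)) ^ 2 + 1) * V ^ (2 / (n:ℝ)) * J) := by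
    have hh : ∀ a : ℝ≥0∞, a ^ (1 / 2 : ℝ) * a ^ (1 / 2 : ℝ) = a := fun a => by
      rw [← ENNReal.rpow_add_of_nonneg _ _ nz nz]; norm_num
    have hv : V ^ (1 / (n:ℝ)) * V ^ (1 / (n:ℝ)) = V ^ (2 / (n:ℝ)) := by
      rw [← ENNReal.rpow_add_of_nonneg _ _ pz pz]; congr 1; ring
    refine (mul_le_mul' h4 h4).trans ?_
    set c := ofReal ((c0 : ℝ) ^ (1 / p)) with hc
    calc _ = (4 * (c * c)) * (V ^ (1 / (n:ℝ)) * V ^ (1 / (n:ℝ))) * ((I ^ (1 / 2 : ℝ) * I ^ (1 / 2 : ℝ)) * (J ^ (1 / 2 : ℝ) * J ^ (1 / 2 : ℝ))) := by ring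
      _ = I * (4 * (c * c) * V ^ (2 / (n:ℝ)) * J) := by rw [hh, hh, hv]; ring
      _ ≤ _ := by
        gcongr
        rw [hc, ← ofReal_mul pz, ← ofReal_ofNat 4, ← ofReal_mul nz]
        apply ole; nlinarith
  by_cases hI0 : I = 0
  · rw [hI0]; exact zero_le
  · exact (ENNReal.mul_le_mul_iff_right hI0 hIfin).1 h5

theorem sob_w (d cA : ℝ) : ∃ C : ℝ, 0 < C ∧ ∃ β : ℝ, 0 < β ∧ ∀ {Γ : Set E}, AR d cA Γ → ∀ (X : E) (ρ : ℝ), 0 < ρ → ∀ {K : Set E}, IsCompact K →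
    K ⊆ Γᶜ → K ⊆ closedBall X ρ → ∀ {f : E → ℝ} {g : E → E}, WG K f g → ∀ θ : ℝ, 0 < θ → θ ≤ 1 →
    volume {x | f x ≠ 0} ≤ ofReal (θ * (vb E * ρ ^ dimE)) →
    ∫⁻ x, ofReal (f x ^ 2 * wt d Γ x) ≤ ofReal (C * ρ ^ 2 * θ ^ β) * ∫⁻ x, ofReal (‖g x‖ ^ 2 * wt d Γ x) := by
  by_cases hd : 2 ≤ dimE ∧ d < (dimE : ℝ) - 1
  swap
  · exact ⟨1, one_pos, 1, one_pos, fun h => (hd ⟨h.n2, h.dn⟩).elim⟩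
  obtain ⟨hn, hdn⟩ := hd
  obtain ⟨CF, hCF, hfk⟩ := fk (E := E) hn
  obtain ⟨CH, hCH, hha⟩ := hardy (E := E) d cA
  set n := dimE with hnn
  have hn0 : (0:ℝ) < n := by exact_mod_cast (by omega : 0 < n)
  set γ := (n:ℝ) - 1 - d with hγ
  have hγ0 : 0 < γ := by linarith
  have hv := vb_pos (E := E)
  set c := CF * vb E ^ (2 / (n:ℝ)) with hc
  have hc0 : 0 < c := by positivity
  set a := (2 / (n:ℝ)) / (2 + γ) with ha
  have ha0 : 0 < a := by positivity
  have ha1 : 2 / (n:ℝ) - a * γ = 2 * a := by rw [ha]; field_simp; ring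
  refine ⟨c * 4 ^ γ + CH + c * 3 ^ γ, by positivity, 2 * a, by positivity, fun {Γ} h X ρ hρ {K} hK hKΓ hKX {f g} w θ hθ0 hθ1 hV => ?_⟩
  have hwt : ∀ x, wt d Γ x = dst x Γ ^ (-γ) := fun x => by rw [wt, hγ]; congr 1; ring
  set G2 := ∫⁻ x, ofReal (‖g x‖ ^ 2 * wt d Γ x) with hG2
  have hF : ∫⁻ x, ofReal (f x ^ 2) ≤ ofReal (c * (θ ^ (2 / (n:ℝ)) * ρ ^ 2)) * ∫⁻ x, ofReal (‖g x‖ ^ 2) := by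
    refine (hfk hK w).trans (mul_le_mul_left ?_ _)
    refine (mlr (ENNReal.rpow_le_rpow hV pz) _).trans ?_
    rw [ofReal_rpow_of_nonneg pz pz, ← ofReal_mul hCF.le]
    apply ole
    rw [mul_rpow hθ0.le pz, mul_rpow hv.le pz, ← Real.rpow_natCast_mul hρ.le, mul_div_cancel₀ _ hn0.ne', Real.rpow_two, hc]
    apply le_of_eq; ring
  have hg : ∀ m : ℝ, 0 < m → (∀ x ∈ K, dst x Γ ≤ m) → ∫⁻ x, ofReal (‖g x‖ ^ 2) ≤ ofReal (m ^ γ) * G2 := fun m hm hmK => by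
    rw [hG2, ← lcm _ _ ont]
    refine lintegral_mono_ae ?_
    filter_upwards [w.gzero] with x hx
    by_cases hxK : x ∈ K
    · rw [← ofReal_mul pz]
      apply ole
      have hp := dl_pos h.closed h.ne (hKΓ hxK)
      have h1 : dst x Γ ^ γ ≤ m ^ γ := Real.rpow_le_rpow hp.le (hmK x hxK) hγ0.le
      have h2 : 0 < dst x Γ ^ γ := by positivity
      rw [hwt, rpow_neg hp.le]
      rw [← sub_nonneg]
      have : m ^ γ * (‖g x‖ ^ 2 * (dst x Γ ^ γ)⁻¹) - ‖g x‖ ^ 2 = ‖g x‖ ^ 2 * (dst x Γ ^ γ)⁻¹ * (m ^ γ - dst x Γ ^ γ) := by field_simp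
      rw [this]
      exact mul_nonneg pz lz
    · rw [hx hxK]; simp
  have hdK : ∀ x ∈ K, dst x Γ ≤ dst X Γ + ρ ∧ dst X Γ ≤ dst x Γ + ρ := fun x hx => by
    have h1 := infDist_le_infDist_add_dist (s := Γ) (x := X) (y := x)
    have h2 := infDist_le_infDist_add_dist (s := Γ) (x := x) (y := X)
    have h3 := mem_closedBall.1 (hKX hx)
    rw [dist_comm] at h1
    constructor <;> linarith
  rcases le_or_gt (2 * ρ) (dst X Γ) with hX | hX
  · have hXp : 0 < dst X Γ := by linarith
    have h1 : ∫⁻ x, ofReal (f x ^ 2 * wt d Γ x) ≤ ofReal ((dst X Γ / 2) ^ (-γ)) * ∫⁻ x, ofReal (f x ^ 2) := by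
      rw [← lcm _ _ ont]
      refine lintegral_mono fun x => ?_
      rw [← ofReal_mul pz]
      apply ole
      by_cases hxK : x ∈ K
      · rw [mul_comm, hwt]
        have := hdK x hxK
        exact mrn (rnp lz lz lz) (sq_nonneg _)
      · rw [w.zero x hxK]; simp
    refine h1.trans ((mlr (hF.trans (mlr (hg (2 * dst X Γ) pz fun x hx => by have := hdK x hx; linarith) _)) _).trans ?_)
    rw [← mul_assoc, ← mul_assoc, ← ofReal_mul pz, ← ofReal_mul pz]
    refine mul_le_mul_left (ole ?_) _
    have e1 : (dst X Γ / 2) ^ (-γ) * (2 * dst X Γ) ^ γ = 4 ^ γ := by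
      rw [rpow_neg pz, ← Real.inv_rpow pz, ← mul_rpow pz pz]
      congr 1; field_simp; norm_num
    have e2 : θ ^ (2 / (n:ℝ)) ≤ θ ^ (2 * a) := Real.rpow_le_rpow_of_exponent_ge hθ0 hθ1 (by nlinarith)
    calc _ = ((dst X Γ / 2) ^ (-γ) * (2 * dst X Γ) ^ γ) * (c * (θ ^ (2 / (n:ℝ)) * ρ ^ 2)) := by ring
      _ ≤ 4 ^ γ * (c * (θ ^ (2 * a) * ρ ^ 2)) := by rw [e1]; gcongr
      _ = (c * 4 ^ γ) * ρ ^ 2 * θ ^ (2 * a) := by ring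
      _ ≤ _ := by gcongr; have : 0 < CH + c * 3 ^ γ := by positivity
                  linarith
  · set t := ρ * θ ^ a with ht
    have ht0 : 0 < t := by positivity
    have hH := hha h (HF.ofWG (d := d) h.closed h.ne hK hKΓ w)
    have h1 : ∫⁻ x, ofReal (f x ^ 2 * wt d Γ x) ≤ ofReal (t ^ 2) * (∫⁻ x, ofReal (f x ^ 2 * dst x Γ ^ (-2 : ℝ) * wt d Γ x)) + ofReal (t ^ (-γ)) * ∫⁻ x, ofReal (f x ^ 2) := by
      rw [← lcm _ _ ont, ← lcm _ _ ont, ← lintegral_add_right _ (by have := w.cont.measurable; fun_prop)]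
      refine lintegral_mono fun x => ?_
      rw [← ofReal_mul pz, ← ofReal_mul pz, ← ofReal_add]
      · apply ole
        by_cases hxK : x ∈ K
        · have hp := dl_pos h.closed h.ne (hKΓ hxK)
          have hw := wt_nonneg (d := d) (Γ := Γ) x
          rcases le_or_gt (dst x Γ) t with hx | hx
          · have h2 : 1 ≤ t ^ 2 * dst x Γ ^ (-2 : ℝ) := by
              rw [rpow_neg hp.le, Real.rpow_two, ← div_eq_mul_inv, one_le_div pz]; gcongr
            have h3 : 0 ≤ t ^ (-γ) * f x ^ 2 := by positivity
            have := mrn h2 (mul_nonneg (sq_nonneg (f x)) hw)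
            nlinarith
          · have h2 : wt d Γ x ≤ t ^ (-γ) := by rw [hwt]; exact rnp ht0 hx.le lz
            have h3 : 0 ≤ t ^ 2 * (f x ^ 2 * dst x Γ ^ (-2 : ℝ) * wt d Γ x) := by positivity
            nlinarith [mrn h2 (sq_nonneg (f x))]
        · rw [w.zero x hxK]; simp
      · have hw := wt_nonneg (d := d) (Γ := Γ) x
        have : 0 ≤ dst x Γ := infDist_nonneg
        positivity
      · positivity
    have h2 : ∫⁻ x, ofReal (f x ^ 2 * wt d Γ x) ≤ ofReal (t ^ 2) * (ofReal CH * G2) +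
        ofReal (t ^ (-γ)) * (ofReal (c * (θ ^ (2 / (n:ℝ)) * ρ ^ 2)) * (ofReal ((3 * ρ) ^ γ) * G2)) :=
      h1.trans (add_le_add (mlr hH _) (mlr (hF.trans (mlr (hg (3 * ρ) pz fun x hx => by have := hdK x hx; linarith) _)) _))
    refine h2.trans ?_
    rw [← mul_assoc, ← mul_assoc, ← mul_assoc, ← ofReal_mul pz, ← ofReal_mul pz, ← ofReal_mul pz, ← add_mul, ← ofReal_add pz pz]
    refine mul_le_mul_left (ole ?_) _
    have e1 : t ^ 2 = ρ ^ 2 * θ ^ (2 * a) := by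
      rw [ht, mul_pow, ← Real.rpow_mul_natCast hθ0.le]; congr 2; push_cast; ring
    have e2 : t ^ (-γ) * (θ ^ (2 / (n:ℝ)) * (3 * ρ) ^ γ) = 3 ^ γ * θ ^ (2 * a) := by
      rw [ht, mul_rpow hρ.le pz, mul_rpow nz hρ.le, ← rpow_mul hθ0.le, ← ha1, Real.rpow_sub hθ0, show a * -γ = -(a * γ) by ring,
        rpow_neg hρ.le, rpow_neg hθ0.le]
      field_simp
    calc _ = ρ ^ 2 * θ ^ (2 * a) * CH + c * ρ ^ 2 * (t ^ (-γ) * (θ ^ (2 / (n:ℝ)) * (3 * ρ) ^ γ)) := by rw [e1]; ring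
      _ = (CH + c * 3 ^ γ) * ρ ^ 2 * θ ^ (2 * a) := by rw [e2]; ring
      _ ≤ _ := by gcongr; have : 0 < c * 4 ^ γ := by positivity
                  linarith

theorem grad_meas (f : E → ℝ) : Measurable (gradient f) := by
  unfold gradient
  exact (InnerProductSpace.toDual ℝ E).symm.continuous.measurable.comp (measurable_fderiv ℝ f)

theorem clp_gradz {f : E → ℝ} {x : E} (h : clp f x = 0) : gradient (clp f) x = 0 := by
  have : IsLocalMin (clp f) x := Filter.Eventually.of_forall fun y => h ▸ clp0 f y
  simp [gradient, this.fderiv_eq_zero]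

theorem pm_of_sq {s : ℝ} (hs : s ^ 2 = 1) : s = 1 ∨ s = -1 := mul_self_eq_one_iff.1 (by rwa [← sq])

theorem R0 (d cA cB : ℝ) : ∃ C : ℝ, 0 < C ∧ ∃ β : ℝ, 0 < β ∧ ∀ {Γ : Set E}, AR d cA Γ → ∀ {A B U G}, Core d cB Γ A B U G →
    ∀ {s k : ℝ}, s ^ 2 = 1 → ∀ (X : E) (ρ : ℝ), 0 < ρ → ∀ {K : Set E}, IsCompact K →
    K ⊆ B \ Γ → K ⊆ closedBall X ρ → ∀ {ζ : E → ℝ} {L : ℝ≥0}, Lip L ζ → (∀ x ∉ K, ζ x = 0) → ∀ θ : ℝ, 0 < θ → θ ≤ 1 →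
    volume {x | ζ x * max (s * (U x - k)) 0 ≠ 0} ≤ ofReal (θ * (vb E * ρ ^ dimE)) →
    ∫⁻ x, ofReal ((ζ x * max (s * (U x - k)) 0) ^ 2 * wt d Γ x) ≤ ofReal (C * ρ ^ 2 * θ ^ β) *
      ∫⁻ x, ofReal (max (s * (U x - k)) 0 ^ 2 * ‖gradient ζ x‖ ^ 2 * wt d Γ x) := by
  obtain ⟨C, hC, β, hβ, hS⟩ := sob_w (E := E) d cA
  refine ⟨C * (2 + 8 * cB ^ 4), by positivity, β, hβ, ?_⟩
  intro Γ ha A B U G h s k hs X ρ hρ K hK hKB hKX ζ L hL hz θ hθ hθ1 hv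
  have hKΓ : K ⊆ Γᶜ := fun x hx => (hKB hx).2
  have hw := h.ch_pos hs (k := k) K hK hKΓ ζ L hL hz
  have h1 := hS ha X ρ hρ hK hKΓ hKX hw θ hθ hθ1 hv
  refine h1.trans ?_
  have hca : ∫⁻ x, ofReal (ζ x ^ 2 * (s * ((s + SignType.sign (U x - k)) / 2)) * ‖G x‖ ^ 2 * wt d Γ x) ≤
      ofReal (4 * cB ^ 4) * ∫⁻ x, ofReal (max (s * (U x - k)) 0 ^ 2 * ‖gradient ζ x‖ ^ 2 * wt d Γ x) := by
    have hm : Measurable fun t : ℝ => max (s * (t - k)) 0 := by fun_prop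
    have key : ∀ t : ℝ, 0 ≤ s * ((s + SignType.sign (t - k)) / 2) ∧
        max (s * (t - k)) 0 ^ 2 ≤ (s * ((s + SignType.sign (t - k)) / 2)) * max (s * (t - k)) 0 ^ 2 := by
      intro t
      rcases pm_of_sq hs with rfl | rfl <;> rcases lt_trichotomy (t - k) 0 with h | h | h <;>
        simp [h, max_eq_left_of_lt, max_eq_right_of_lt, h.le] <;> (try norm_num) <;> (try linarith)
    rcases pm_of_sq hs with h1 | h1
    · have := h.cacc (h.ch_pos hs (k := k)) (N := fun t => max (s * (t - k)) 0) (fun t _ => by simpa [h1] using (key t).1)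
        (fun t _ => by simpa [h1] using (key t).2) hm hK hKB hL hz
      simpa only [h1, one_mul] using this
    · have := h.cacc (h.ch_pos hs (k := k)).neg (N := fun t => max (s * (t - k)) 0) (fun t _ => by simpa only [h1, neg_one_mul] using (key t).1)
        (fun t _ => by have := (key t).2; simp only [h1, neg_one_mul, neg_sq] at this ⊢; exact this) hm hK hKB hL hz
      simpa only [h1, neg_one_mul] using this
  set I := ∫⁻ x, ofReal (max (s * (U x - k)) 0 ^ 2 * ‖gradient ζ x‖ ^ 2 * wt d Γ x) with hI
  have hU := h.integ.1.aemeasurable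
  have hg := (grad_meas ζ)
  have hwm := wt_meas (d := d) (Γ := Γ)
  have h2 : ∫⁻ x, ofReal (‖max (s * (U x - k)) 0 • gradient ζ x + (ζ x * ((s + SignType.sign (U x - k)) / 2)) • G x‖ ^ 2 * wt d Γ x) ≤
      ofReal 2 * I + ofReal 2 * ∫⁻ x, ofReal (ζ x ^ 2 * (s * ((s + SignType.sign (U x - k)) / 2)) * ‖G x‖ ^ 2 * wt d Γ x) := by
    rw [hI, ← lcm _ _ sz, ← lcm _ _ sz, ← lintegral_add_left' fz]
    apply lintegral_mono
    intro x
    have hw0 := wt_nonneg (d := d) (Γ := Γ) x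
    have key : ((s + SignType.sign (U x - k)) / 2) ^ 2 ≤ (s * ((s + SignType.sign (U x - k)) / 2) : ℝ) ∧ 0 ≤ (s * ((s + SignType.sign (U x - k)) / 2) : ℝ) := by
      rcases pm_of_sq hs with rfl | rfl <;> rcases lt_trichotomy (U x - k) 0 with h | h | h <;> simp [h] <;> norm_num
    simp only
    rw [← ofReal_mul nz, ← ofReal_mul nz, ← ofReal_add pz (by have := key.2; positivity)]
    apply ole
    generalize ((s + SignType.sign (U x - k)) / 2 : ℝ) = H at key
    generalize max (s * (U x - k)) 0 = v
    have h3 : ‖v • gradient ζ x + (ζ x * H) • G x‖ ^ 2 ≤ 2 * (v ^ 2 * ‖gradient ζ x‖ ^ 2) + 2 * (ζ x ^ 2 * (s * H) * ‖G x‖ ^ 2) := by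
      have e := parallelogram_law_with_norm ℝ (v • gradient ζ x) ((ζ x * H) • G x)
      have e1 : ‖v • gradient ζ x‖ ^ 2 = v ^ 2 * ‖gradient ζ x‖ ^ 2 := by rw [norm_smul, mul_pow, norm_eq_abs, sq_abs]
      have e2 : ‖(ζ x * H) • G x‖ ^ 2 = ζ x ^ 2 * H ^ 2 * ‖G x‖ ^ 2 := by rw [norm_smul, mul_pow, norm_eq_abs, sq_abs, mul_pow]
      have e3 : ζ x ^ 2 * H ^ 2 * ‖G x‖ ^ 2 ≤ ζ x ^ 2 * (s * H) * ‖G x‖ ^ 2 := by gcongr; exact key.1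
      nlinarith [sq_nonneg ‖v • gradient ζ x - (ζ x * H) • G x‖]
    nlinarith
  refine (mlr (h2.trans (add_le_add le_rfl (mlr hca _))) _).trans (le_of_eq ?_)
  rw [← mul_assoc (ofReal 2), ← add_mul, ← ofReal_mul nz, ← ofReal_add nz pz, ← mul_assoc, ← ofReal_mul pz]
  congr 2
  ring

theorem R1 (d cA cB : ℝ) : ∃ C : ℝ, 0 < C ∧ ∃ β : ℝ, 0 < β ∧ ∀ {Γ : Set E}, AR d cA Γ → ∀ {A B U G}, Core d cB Γ A B U G →
    ∀ {s k : ℝ} (X : E) (ρ ra rb : ℝ), (s = 1 ∧ 0 ≤ k) ∨ (s = -1 ∧ 2 * ρ ≤ dst X Γ) → 0 < ρ → 0 < ra → ra < rb → rb ≤ ρ →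
    closedBall X rb ⊆ B → ∀ θ : ℝ, 0 < θ → θ ≤ 1 →
    volume ({x | 0 < s * (U x - k)} ∩ ball X rb) ≤ ofReal (θ * (vb E * ρ ^ dimE)) →
    ∫⁻ x in ball X ra, ofReal (max (s * (U x - k)) 0 ^ 2 * wt d Γ x) ≤ ofReal (C * θ ^ β * (ρ / (rb - ra)) ^ 2) *
      ∫⁻ x in ball X rb, ofReal (max (s * (U x - k)) 0 ^ 2 * wt d Γ x) := by
  obtain ⟨C, hC, β, hβ, hS⟩ := R0 (E := E) d cA cB
  refine ⟨C * 2, by positivity, β, hβ, ?_⟩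
  intro Γ ha A B U G h s k X ρ ra rb hsk hρ hr₁ hr hr₂ hB θ hθ hθ1 hv
  have hs : s ^ 2 = 1 := by rcases hsk with h | h <;> rw [h.1] <;> norm_num
  have hU := h.integ.1.aemeasurable
  have hwm := wt_meas (d := d) (Γ := Γ)
  have hdm : Measurable fun x => dst x Γ := measurable_infDist
  have hr21 : 0 < rb - ra := by linarith
  set a : ℝ≥0 := toNNReal (rb - ra)⁻¹ with haa
  have ea : (a : ℝ) = (rb - ra)⁻¹ := coe_toNNReal _ pz
  have hdl : Lip 1 fun x : E => - dist x X := by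
    refine LipschitzWith.of_dist_le_mul fun x y => ?_
    rw [Real.dist_eq]
    have := abs_dist_sub_le x y X
    rw [NNReal.coe_one, one_mul, abs_le] at *
    constructor <;> linarith [this.1, this.2]
  set φ : E → ℝ := clp fun x => a * (- dist x X) - (-(a * rb)) with hφ
  have hφL : Lip a φ := clp_lip (lip_aff hdl a _)
  have hφ1 : ∀ x ∈ ball X ra, φ x = 1 := by
    intro x hx
    rw [mem_ball] at hx
    apply clp_eq1
    have : (a:ℝ) * (rb - ra) = 1 := by rw [ea]; field_simp
    have : (a:ℝ) * (ra - dist x X) ≥ 0 := mul_nonneg a.2 lz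
    nlinarith
  have hφ0 : ∀ x ∉ ball X rb, φ x = 0 := by
    intro x hx
    rw [mem_ball, not_lt] at hx
    apply clp_eq0
    have : (a:ℝ) * (rb - dist x X) ≤ 0 := mul_nonpos_of_nonneg_of_nonpos a.2 lz
    nlinarith
  set η : ℕ → ℝ := fun j => ρ / 4 / ((j:ℝ) + 1) with hη
  have hηp : ∀ j, 0 < η j := fun j => by positivity
  have hηρ : ∀ j, 2 * η j < ρ := fun j => by
    have : η j ≤ ρ / 4 := div_le_self pz (by linarith [Nat.cast_nonneg (α := ℝ) j])
    linarith
  have hηt : Tendsto η atTop (𝓝 0) := by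
    have := tendsto_one_div_add_atTop_nhds_zero_nat (𝕜 := ℝ)
    have := this.const_mul (ρ / 4)
    simp only [mul_one_div, mul_zero] at this
    exact this
  have hdL : Lip 1 fun x : E => dst x Γ := lipschitz_infDist_pt Γ
  set b : ℕ → ℝ≥0 := fun j => toNNReal (η j)⁻¹ with hb
  have eb : ∀ j, (b j : ℝ) = (η j)⁻¹ := fun j => coe_toNNReal _ (by have := hηp j; positivity)
  set χ : ℕ → E → ℝ := fun j => clp fun x => b j * dst x Γ - 1 with hχ
  have hχL : ∀ j, Lip (b j) (χ j) := fun j => clp_lip (lip_aff hdL _ _)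
  have hχ0 : ∀ j x, dst x Γ ≤ η j → χ j x = 0 := fun j x hx => by
    apply clp_eq0
    rw [eb, inv_mul_eq_div, sub_nonpos, div_le_one (hηp j)]; exact hx
  have hχt : ∀ x ∉ Γ, ∀ᶠ j in atTop, χ j x = 1 := by
    intro x hx
    have h0 := dl_pos h.closed h.ne hx
    filter_upwards [hηt.eventually_lt_const (show (0:ℝ) < dst x Γ / 2 by positivity)] with j hj
    apply clp_eq1
    rw [eb, inv_mul_eq_div, le_sub_iff_add_le, le_div_iff₀ (hηp j)]; linarith
  set v : E → ℝ := fun x => max (s * (U x - k)) 0 with hvd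
  have hvm : AEMeasurable v volume := by fun_prop
  have hvp : ∀ x, v x ≠ 0 → 0 < s * (U x - k) := fun x hx => by
    by_contra h'; exact hx (max_eq_right (not_lt.1 h'))
  set er : ℕ → ℝ≥0∞ := fun j => ∫⁻ x, {x | dst x Γ ≤ 2 * η j}.indicator (fun x => ofReal (U x ^ 2 * dst x Γ ^ (-2 : ℝ) * wt d Γ x)) x with her
  have hsm : ∀ j, MeasurableSet {x | dst x Γ ≤ 2 * η j} := fun j => measurableSet_le hdm measurable_const
  have herm : ∀ j, AEMeasurable ({x | dst x Γ ≤ 2 * η j}.indicator (fun x => ofReal (U x ^ 2 * dst x Γ ^ (-2 : ℝ) * wt d Γ x))) volume :=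
    fun j => AEMeasurable.indicator fz (hsm j)
  have hert : Tendsto er atTop (𝓝 0) := by
    have := tendsto_lintegral_of_dominated_convergence' (μ := (volume : Measure E)) (F := fun j => {x | dst x Γ ≤ 2 * η j}.indicator (fun x => ofReal (U x ^ 2 * dst x Γ ^ (-2 : ℝ) * wt d Γ x)))
      (f := fun _ => 0) (fun x => ofReal (U x ^ 2 * dst x Γ ^ (-2 : ℝ) * wt d Γ x)) herm
      (fun j => Eventually.of_forall fun x => indicator_le_self _ _ x) (h.hardyU ha).ne ?_
    · rw [lintegral_zero] at this; exact this
    · filter_upwards [ha.aeΩ] with x hx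
      refine tendsto_const_nhds.congr' ?_
      have h0 := dl_pos h.closed h.ne hx
      filter_upwards [hηt.eventually_lt_const (show (0:ℝ) < dst x Γ / 2 by positivity)] with j hj
      rw [ion]
      simp only [mem_setOf_eq, not_le]; linarith
  set I := ∫⁻ x in ball X rb, ofReal (v x ^ 2 * wt d Γ x) with hI
  have main : ∀ j, ∫⁻ x, ofReal ((φ x * χ j x * v x) ^ 2 * wt d Γ x) ≤ ofReal (C * ρ ^ 2 * θ ^ β) *
      (ofReal 8 * er j + ofReal (2 * a ^ 2) * I) := by
    intro j
    have hK : IsCompact (closedBall X rb ∩ {x | η j ≤ dst x Γ}) :=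
      (isCompact_closedBall X rb).inter_right (isClosed_le continuous_const (continuous_infDist_pt Γ))
    refine (hS ha h hs (k := k) X ρ hρ hK ?_ ?_ (lip_mul hφL (hχL j) (clp_abs _) (clp_abs _)) ?_ θ hθ hθ1 ?_).trans (mlr ?_ _)
    · intro x hx
      refine ⟨hB hx.1, fun h' => ?_⟩
      have := hx.2
      simp only [mem_setOf_eq, infDist_zero_of_mem h'] at this
      linarith [hηp j]
    · exact inter_subset_left.trans (closedBall_subset_closedBall hr₂)
    · intro x hx
      by_cases h1 : x ∈ ball X rb
      · have : χ j x = 0 := hχ0 j x (by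
          by_contra h2; exact hx ⟨bsc h1, (not_le.1 h2).le⟩)
        simp [this]
      · simp [hφ0 x h1]
    · refine (measure_mono ?_).trans hv
      intro x hx
      refine ⟨hvp x fun h' => hx (by show _ * v x = 0; rw [h', mul_zero]), ?_⟩
      by_contra h'
      exact hx (by simp [hφ0 x h'])
    · rw [her, hI, ← lcm _ _ ont, ← lcm _ _ ont, ← lintegral_indicator msb, ← lintegral_add_left' ((herm j).const_mul _)]
      apply lintegral_mono_ae
      filter_upwards [norm_grad_mul hφL (hχL j), ha.aeΩ] with x h1 hx
      have h0 := dl_pos h.closed h.ne hx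
      have hw0 := wt_nonneg (d := d) (Γ := Γ) x
      have hsq : ‖gradient (fun x => φ x * χ j x) x‖ ^ 2 ≤ 2 * (φ x ^ 2 * ‖gradient (χ j) x‖ ^ 2) + 2 * ‖gradient φ x‖ ^ 2 := by
        rw [abn (clp0 _ x), abn (clp0 _ x)] at h1
        have h2 : χ j x * ‖gradient φ x‖ ≤ ‖gradient φ x‖ := mul_le_of_le_one_left (norm_nonneg _) (clp1 _ x)
        calc _ ≤ (φ x * ‖gradient (χ j) x‖ + ‖gradient φ x‖) ^ 2 := by
                apply pow_le_pow_left₀ (norm_nonneg _); exact h1.trans lz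
          _ ≤ _ := by nlinarith [sq_nonneg (φ x * ‖gradient (χ j) x‖ - ‖gradient φ x‖)]
      have hp1 : ofReal (v x ^ 2 * (2 * (φ x ^ 2 * ‖gradient (χ j) x‖ ^ 2)) * wt d Γ x) ≤ ofReal 8 * {x | dst x Γ ≤ 2 * η j}.indicator (fun x => ofReal (U x ^ 2 * dst x Γ ^ (-2 : ℝ) * wt d Γ x)) x := by
        by_cases hx1 : dst x Γ ≤ 2 * η j
        · rw [iom (by exact hx1), ← ofReal_mul nz]
          apply ole
          by_cases hx2 : x ∈ ball X rb
          · have hvU : v x ≤ U x := by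
              rcases hsk with ⟨rfl, hk⟩ | ⟨rfl, hk⟩
              · simp only [hvd, one_mul]; exact max_le lz (h.nonneg x)
              · exfalso
                have e := hdL.dist_le_mul x X
                rw [mem_ball] at hx2
                rw [Real.dist_eq, abs_le] at e
                simp only [NNReal.coe_one, one_mul] at e
                linarith [hηρ j, e.1]
            have hv0 : 0 ≤ v x := le_max_right _ _
            have g1 : ‖gradient (χ j) x‖ ≤ 2 * (dst x Γ)⁻¹ := by
              refine (norm_grad_le (hχL j) x).trans ?_
              rw [eb, inv_le_iff_one_le_mul₀ (hηp j), ← div_eq_mul_inv, div_mul_eq_mul_div, le_div_iff₀ h0]; linarith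
            have g2 : φ x ^ 2 ≤ 1 := pow_le_one₀ (clp0 _ x) (clp1 _ x)
            have e2 : dst x Γ ^ (-2:ℝ) = (dst x Γ)⁻¹ ^ 2 := by
              rw [rpow_neg h0.le, inv_pow]; norm_cast
            rw [e2]
            have : φ x ^ 2 * ‖gradient (χ j) x‖ ^ 2 ≤ 1 * (2 * (dst x Γ)⁻¹) ^ 2 := by gcongr
            calc v x ^ 2 * (2 * (φ x ^ 2 * ‖gradient (χ j) x‖ ^ 2)) * wt d Γ x ≤ U x ^ 2 * (2 * (1 * (2 * (dst x Γ)⁻¹) ^ 2)) * wt d Γ x := by gcongr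
              _ = _ := by ring
          · rw [hφ0 x hx2]
            simp only [ne_eq, OfNat.ofNat_ne_zero, not_false_eq_true, zero_pow, zero_mul, mul_zero]
            have := Real.rpow_nonneg h0.le (-2); positivity
        · have : gradient (χ j) x = 0 := clp_grad1 (by have := continuous_infDist_pt Γ; fun_prop) (by
            rw [eb, inv_mul_eq_div, lt_sub_iff_add_lt, lt_div_iff₀ (hηp j)]; linarith)
          simp [this]
      have hp2 : ofReal (v x ^ 2 * (2 * ‖gradient φ x‖ ^ 2) * wt d Γ x) ≤ (ball X rb).indicator (fun x => ofReal (2 * a ^ 2) * ofReal (v x ^ 2 * wt d Γ x)) x := by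
        by_cases hx2 : x ∈ ball X rb
        · rw [iom hx2, ← ofReal_mul pz]
          apply ole
          have := norm_grad_le hφL x
          calc v x ^ 2 * (2 * ‖gradient φ x‖ ^ 2) * wt d Γ x ≤ v x ^ 2 * (2 * a ^ 2) * wt d Γ x := by gcongr
            _ = _ := by ring
        · have : gradient φ x = 0 := clp_gradz (hφ0 x hx2)
          simp [this]
      refine le_trans ?_ (add_le_add hp1 hp2)
      rw [← ofReal_add pz pz]
      apply ole
      show v x ^ 2 * _ * _ ≤ _
      calc _ ≤ v x ^ 2 * (2 * (φ x ^ 2 * ‖gradient (χ j) x‖ ^ 2) + 2 * ‖gradient φ x‖ ^ 2) * wt d Γ x := by gcongr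
        _ = _ := by ring
  have hφm : Measurable φ := hφL.continuous.measurable
  have hχm : ∀ j, Measurable (χ j) := fun j => (hχL j).continuous.measurable
  have fin := fatou (F := fun j x => ofReal ((φ x * χ j x * v x) ^ 2 * wt d Γ x)) (F0 := fun x => ofReal ((φ x * v x) ^ 2 * wt d Γ x))
    (c0 := ofReal (C * ρ ^ 2 * θ ^ β) * (ofReal 8 * 0 + ofReal (2 * a ^ 2) * I)) (fun j => by have := hχm j; fun_prop) ?_ ?_ main
  · have hle : ∫⁻ x in ball X ra, ofReal (v x ^ 2 * wt d Γ x) ≤ ∫⁻ x, ofReal ((φ x * v x) ^ 2 * wt d Γ x) := by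
      rw [← lintegral_indicator msb]
      apply lintegral_mono
      intro x
      by_cases hx : x ∈ ball X ra
      · simp [iom hx, hφ1 x hx]
      · simp [ion hx]
    refine hle.trans (fin.trans (le_of_eq ?_))
    rw [mul_zero, zero_add, ← mul_assoc, ← ofReal_mul pz, ea]
    congr 2
    field_simp
  · filter_upwards [ha.aeΩ] with x hx
    refine tendsto_const_nhds.congr' ?_
    filter_upwards [hχt x hx] with j hj
    rw [hj, mul_one]
  · refine ENNReal.Tendsto.const_mul ?_ (Or.inr sz)
    exact (ENNReal.Tendsto.const_mul hert (Or.inr sz)).add tendsto_const_nhds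

theorem cheb {S T : Set E} {f : E → ℝ≥0∞} {a b : ℝ} (ha : 0 < a) (hT : MeasurableSet T) (hf : AEMeasurable f (volume.restrict T))
    (h : ∀ᵐ x : E, x ∈ S → x ∈ T ∧ ofReal a ≤ f x) (hb : ∫⁻ x in T, f x ≤ ofReal b) : volume S ≤ ofReal (b / a) := by
  have h1 := mul_meas_ge_le_lintegral₀ hf (ofReal a)
  have h2 : volume S ≤ volume.restrict T {x | ofReal a ≤ f x} := by
    rw [Measure.restrict_apply' hT]
    refine measure_mono_ae ?_
    filter_upwards [h] with x hx hS
    exact ⟨(hx hS).2, (hx hS).1⟩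
  rw [ofReal_div_of_pos ha, ENNReal.le_div_iff_mul_le (Or.inl (by simpa using ha)) (Or.inl sz), mul_comm]
  exact (mlr h2 _).trans (h1.trans hb)

theorem wt_low {d cA : ℝ} {Γ : Set E} (ha : AR d cA Γ) {X x : E} {ρ : ℝ} (hρ : 0 < ρ) (hx : x ∈ ball X ρ) (hx' : x ∉ Γ) :
    (2 * max (dst X Γ) ρ) ^ (d + 1 - (dimE : ℝ)) ≤ wt d Γ x := by
  have h0 := dl_pos ha.closed ha.ne hx'
  refine rnp h0 ?_ (by linarith [ha.dn])
  have e := (lipschitz_infDist_pt Γ).dist_le_mul x X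
  rw [mem_ball] at hx
  rw [Real.dist_eq, abs_le] at e
  simp only [NNReal.coe_one, one_mul] at e
  linarith [e.2, le_max_left (dst X Γ) ρ, le_max_right (dst X Γ) ρ]

theorem T1 (d cA cB : ℝ) : ∃ c : ℝ, 0 < c ∧ ∀ {Γ : Set E}, AR d cA Γ → ∀ {A B U G}, Core d cB Γ A B U G →
    ∀ {s k : ℝ} (X : E) (ρ : ℝ), (s = 1 ∧ 0 ≤ k) ∨ (s = -1 ∧ 2 * ρ ≤ dst X Γ) → 0 < ρ → ball X ρ ⊆ B → ∀ h : ℝ, 0 < h →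
    ∫⁻ x in ball X ρ, ofReal (max (s * (U x - k)) 0 ^ 2 * wt d Γ x) ≤
      ofReal (c * (h ^ 2 * ρ ^ dimE * max (dst X Γ) ρ ^ (d + 1 - (dimE : ℝ)))) →
    ∀ x ∈ ball X (ρ / 2), x ∉ Γ → s * (U x - k) ≤ h := by
  obtain ⟨C, hC, β, hβ, hS⟩ := R1 (E := E) d cA cB
  set n := dimE with hn
  set g := d + 1 - (n : ℝ) with hg
  have hvb := vb_pos (E := E)
  set q : ℝ := 4 ^ (-(1 + 1 / β)) with hq
  have hq0 : 0 < q := by positivity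
  have hq1 : (4 * q) ^ β * 4 = 1 := by
    have : (4:ℝ) * q = 4 ^ (-(1 / β)) := by
      rw [hq, neg_add, rpow_add nz, Real.rpow_neg_one]; ring
    rw [this, ← rpow_mul nz, show -(1 / β) * β = -1 by field_simp, Real.rpow_neg_one]; norm_num
  have hq2 : q < 1 := by
    refine Real.rpow_lt_one_of_one_lt_of_neg nz ?_
    have : 0 < 1 / β := by positivity
    linarith
  have hq4 : 4 * q ≤ 1 := by
    by_contra h'
    have := Real.one_lt_rpow (not_le.1 h') hβ
    linarith
  set t : ℝ := min 1 ((q / (64 * C)) ^ (1 / β)) with ht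
  have ht0 : 0 < t := lt_min one_pos pz
  have ht1 : t ≤ 1 := min_le_left _ _
  have htβ : t ^ β ≤ q / (64 * C) := by
    calc t ^ β ≤ ((q / (64 * C)) ^ (1 / β)) ^ β := Real.rpow_le_rpow ht0.le (min_le_right _ _) hβ.le
      _ = q / (64 * C) := by rw [← rpow_mul pz, show 1 / β * β = 1 by field_simp, Real.rpow_one]
  set κ : ℝ := 2 ^ (-g) / vb E with hκ
  have hκ0 : 0 < κ := by positivity
  refine ⟨t / (4 * κ), by positivity, ?_⟩
  intro Γ ha A B U G hc s k X ρ hsk hρ hB h hh hini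
  set D := max (dst X Γ) ρ with hD
  have hD0 : 0 < D := lt_max_of_lt_right hρ
  set M := h ^ 2 * ρ ^ n * D ^ g with hM
  have hM0 : 0 < M := by positivity
  have hU := hc.integ.1.aemeasurable
  have hwm := wt_meas (d := d) (Γ := Γ)
  have hs : s ^ 2 = 1 := by rcases hsk with h | h <;> rw [h.1] <;> norm_num
  set kk : ℕ → ℝ := fun j => k + s * (h * (1 - (1 / 2) ^ j)) with hkk
  have ekk : ∀ j x, s * (U x - kk j) = s * (U x - k) - h * (1 - (1 / 2) ^ j) := fun j x => by
    simp only [hkk]; linear_combination (-(h * (1 - (1 / 2) ^ j))) * hs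
  have hp1 : ∀ j : ℕ, ((1:ℝ) / 2) ^ j ≤ 1 := fun j => pow_le_one₀ nz nz
  set rr : ℕ → ℝ := fun j => ρ * (1 / 2 + (1 / 2) ^ j / 4) with hrr
  have main : ∀ j, ∫⁻ x in ball X (rr j), ofReal (max (s * (U x - kk j)) 0 ^ 2 * wt d Γ x) ≤ ofReal (t / (4 * κ) * q ^ j * M) := by
    intro j
    induction j with
    | zero =>
      simp only [pow_zero, mul_one]
      refine le_trans ?_ hini
      have : kk 0 = k := by simp [hkk]
      rw [this]
      exact lintegral_mono_set (bsb (by simp only [hrr, pow_zero]; linarith))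
    | succ j ih =>
      have hpj : (0:ℝ) < (1 / 2) ^ j := by positivity
      have hr1 : rr (j + 1) < rr j := by simp only [hrr, pow_succ]; nlinarith
      have hr2 : rr j < ρ := by simp only [hrr]; nlinarith [hp1 j]
      have hvol : volume ({x | 0 < s * (U x - kk (j+1))} ∩ ball X (rr j)) ≤ ofReal (t * (4 * q) ^ j * (vb E * ρ ^ n)) := by
        refine (cheb (a := (h * (1 / 2) ^ (j + 1)) ^ 2 * (2 * D) ^ g) pz msb fz ?_ ih).trans (le_of_eq ?_)
        · filter_upwards [ha.aeΩ] with x hx hxs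
          refine ⟨hxs.2, ole ?_⟩
          have h1 := wt_low ha hρ (bsb hr2.le hxs.2) hx
          have h2 := hxs.1
          simp only [mem_setOf_eq, ekk, pow_succ] at h2
          have h3 : h * (1 / 2) ^ (j + 1) ≤ max (s * (U x - kk j)) 0 := by
            refine le_max_of_le_left ?_
            rw [ekk, pow_succ]; linarith
          gcongr
        · congr 1
          rw [mul_rpow nz hD0.le, hM, hκ, rpow_neg nz, mul_pow 4 q j, mul_pow h, ← pow_mul, mul_comm (j+1) 2, pow_mul]
          have e : (((1:ℝ) / 2) ^ 2) ^ (j + 1) = (4 ^ j)⁻¹ / 4 := by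
            rw [pow_succ, show ((1:ℝ) / 2) ^ 2 = 4⁻¹ by norm_num, inv_pow]; ring
          rw [e]
          field_simp
      have hstep := hS ha hc (s := s) (k := kk (j + 1)) X ρ (rr (j + 1)) (rr j) ?_ hρ pz hr1 hr2.le
        ((closedBall_subset_ball hr2).trans hB) (t * (4 * q) ^ j) pz (mul_le_one₀ ht1 pz (pow_le_one₀ pz hq4)) hvol
      · refine hstep.trans ?_
        have hmono : ∫⁻ x in ball X (rr j), ofReal (max (s * (U x - kk (j+1))) 0 ^ 2 * wt d Γ x) ≤ ∫⁻ x in ball X (rr j), ofReal (max (s * (U x - kk j)) 0 ^ 2 * wt d Γ x) := by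
          apply lintegral_mono
          intro x
          apply ole
          have := wt_nonneg (d := d) (Γ := Γ) x
          have h3 : s * (U x - kk (j+1)) ≤ s * (U x - kk j) := by
            rw [ekk, ekk, pow_succ]; nlinarith
          gcongr
        refine (mlr (hmono.trans ih) _).trans ?_
        rw [← ofReal_mul pz]
        apply ole
        have e1 : ρ / (rr j - rr (j + 1)) = 8 * 2 ^ j := by
          simp only [hrr, pow_succ, one_div, inv_pow]
          have : ρ * (2⁻¹ + ((2:ℝ) ^ j)⁻¹ / 4) - ρ * (2⁻¹ + ((2 ^ j) * 2)⁻¹ / 4) = ρ / (8 * 2 ^ j) := by field_simp; ring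
          rw [this]; field_simp
        have e2 : (t * (4 * q) ^ j) ^ β * 4 ^ j = t ^ β := by
          rw [mul_rpow ht0.le pz, ← rpow_natCast, ← rpow_mul pz, mul_comm (j:ℝ) β, rpow_mul pz, rpow_natCast, mul_assoc, ← mul_pow, hq1, one_pow, mul_one]
        have e3 : C * (t * (4 * q) ^ j) ^ β * (ρ / (rr j - rr (j + 1))) ^ 2 ≤ q := by
          rw [e1]
          calc _ = 64 * C * ((t * (4 * q) ^ j) ^ β * 4 ^ j) := by
                rw [show (4:ℝ) ^ j = (2 ^ j) ^ 2 by rw [← pow_mul, mul_comm j 2, pow_mul]; norm_num]; ring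
            _ ≤ 64 * C * (q / (64 * C)) := by rw [e2]; gcongr
            _ = q := by field_simp
        calc _ ≤ q * (t / (4 * κ) * q ^ j * M) := by gcongr
          _ = _ := by rw [pow_succ]; ring
      · rcases hsk with ⟨rfl, h1⟩ | h1
        · left; refine ⟨rfl, ?_⟩
          simp only [hkk]; have := hp1 (j+1); nlinarith
        · right; exact h1
  have hzero : ∫⁻ x in ball X (ρ / 2), ofReal (max (s * (U x - k) - h) 0 ^ 2 * wt d Γ x) = 0 := by
    refine le_antisymm ?_ zero_le
    have hlim : Tendsto (fun j : ℕ => ofReal (t / (4 * κ) * q ^ j * M)) atTop (𝓝 0) := by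
      have := ((tendsto_pow_atTop_nhds_zero_of_lt_one hq0.le hq2).const_mul (t / (4 * κ))).mul_const M
      simpa using ENNReal.tendsto_ofReal this
    refine ge_of_tendsto' hlim fun j => le_trans ?_ (main j)
    refine (lintegral_mono_set (bsb (?_ : ρ / 2 ≤ rr j))).trans (lintegral_mono fun x => ole ?_)
    · simp only [hrr]; have : (0:ℝ) < (1 / 2) ^ j := by positivity
      nlinarith
    · have := wt_nonneg (d := d) (Γ := Γ) x
      have h3 : s * (U x - k) - h ≤ s * (U x - kk j) := by
        rw [ekk]; have : (0:ℝ) < (1 / 2) ^ j := by positivity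
        nlinarith
      gcongr
  intro x hx hxΓ
  by_contra hlt
  rw [not_le] at hlt
  rw [lintegral_eq_zero_iff' fz] at hzero
  have hopen : IsOpen (ball X (ρ / 2) ∩ Γᶜ) := isOpen_ball.inter hc.closed.isOpen_compl
  have hco : ContinuousOn (fun y => s * (U y - k)) (ball X (ρ / 2) ∩ Γᶜ) := by
    have := hc.cont.mono (inter_subset_right (s := ball X (ρ / 2))); fun_prop
  have hO := hco.isOpen_inter_preimage hopen (isOpen_Ioi (a := h))
  have hpos := hO.measure_pos volume ⟨x, ⟨hx, hxΓ⟩, hlt⟩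
  rw [Filter.EventuallyEq, ae_restrict_iff' msb] at hzero
  have : volume ((ball X (ρ / 2) ∩ Γᶜ) ∩ (fun y => s * (U y - k)) ⁻¹' Ioi h) = 0 := by
    refine measure_mono_null (fun y hy => ?_) (ae_iff.1 hzero)
    simp only [mem_setOf_eq, Pi.zero_apply, ofReal_eq_zero, not_forall, not_le]
    refine ⟨hy.1.1, ?_⟩
    have h1 := wt_pos (d := d) hc.closed hc.ne hy.1.2
    have h2 : 0 < s * (U y - k) - h := sub_pos.2 hy.2
    rw [max_eq_left h2.le]
    positivity
  exact hpos.ne' this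

theorem rpow_lip {α η : ℝ} (h0 : 0 < α) (h1 : α ≤ 1) (hη : 0 < η) :
    LipschitzOnWith (toNNReal (η ^ (α - 1))) (fun t : ℝ => t ^ α) (Ici η) := by
  refine (convex_Ici η).lipschitzOnWith_of_nnnorm_hasDerivWithin_le (f' := fun t => α * t ^ (α - 1)) (fun t ht => ?_) (fun t ht => ?_)
  · exact (Real.hasDerivAt_rpow_const (Or.inl (hη.trans_le ht).ne')).hasDerivWithinAt
  · have ht' : 0 < t := hη.trans_le ht
    rw [← NNReal.coe_le_coe, coe_nnnorm, coe_toNNReal _ pz, norm_of_nonneg pz]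
    calc α * t ^ (α - 1) ≤ 1 * η ^ (α - 1) := 
          mul_le_mul h1 (rnp hη ht lz) pz zero_le_one
      _ = _ := one_mul _

def psi (Γ : Set E) (α R η : ℝ) (x : E) : ℝ := (max (min (dst x Γ) R) η) ^ α - η ^ α

theorem psi_lip {Γ : Set E} {α R η : ℝ} (h0 : 0 < α) (h1 : α ≤ 1) (hη : 0 < η) :
    ∃ L, Lip L (psi Γ α R η) := by
  refine ⟨toNNReal (η ^ (α - 1)), LipschitzWith.of_dist_le_mul fun x y => ?_⟩
  have h2 : Lip 1 fun x : E => max (min (dst x Γ) R) η := ((lipschitz_infDist_pt Γ).min_const R).max_const η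
  have h3 := (rpow_lip h0 h1 hη).dist_le_mul (max (min (dst x Γ) R) η) (mem_Ici.2 (le_max_right _ _)) (max (min (dst y Γ) R) η) (mem_Ici.2 (le_max_right _ _))
  have h4 := h2.dist_le_mul x y
  simp only [psi, dist_sub_right]
  rw [NNReal.coe_one, one_mul] at h4
  exact h3.trans (by gcongr)

theorem psi_grad {Γ : Set E} {α R η : ℝ} (h0 : 0 < α) (h1 : α ≤ 1) (hη : 0 < η) (hR : η < R) :
    ∀ᵐ x : E, ‖gradient (psi Γ α R η) x‖ ≤ {x : E | dst x Γ < R ∧ η < dst x Γ}.indicator (fun x => dst x Γ ^ (α - 1)) x := by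
  have hd : Lip 1 fun x : E => dst x Γ := lipschitz_infDist_pt Γ
  filter_upwards [hd.ae_differentiableAt (μ := volume)] with x hx
  have ez : ∀ y : E, fderiv ℝ (psi Γ α R η) y = 0 → ‖gradient (psi Γ α R η) y‖ ≤ 0 := fun y hy => by simp [gradient, hy]
  by_cases hxR : dst x Γ < R
  · by_cases hxη : η < dst x Γ
    · rw [iom (show x ∈ {x : E | dst x Γ < R ∧ η < dst x Γ} from ⟨hxR, hxη⟩)]
      have hx0 := hη.trans hxη
      have e : psi Γ α R η =ᶠ[𝓝 x] fun y => (fun t => t ^ α - η ^ α) (dst y Γ) := by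
        filter_upwards [hd.continuous.continuousAt.eventually_lt_const hxR, hd.continuous.continuousAt.eventually_const_lt hxη] with y h2 h3
        simp only [psi]; rw [min_eq_left h2.le, max_eq_left h3.le]
      have hD : HasDerivAt (fun t : ℝ => t ^ α - η ^ α) (α * dst x Γ ^ (α - 1)) (dst x Γ) :=
        (Real.hasDerivAt_rpow_const (Or.inl hx0.ne')).sub_const _
      have e2 : gradient (psi Γ α R η) x = gradient (fun y => (fun t => t ^ α - η ^ α) (dst y Γ)) x := by unfold gradient; rw [e.fderiv_eq]
      rw [e2, grad_comp hx hD.differentiableAt, hD.deriv, norm_smul, norm_of_nonneg pz]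
      have h3 : ‖gradient (fun x => dst x Γ) x‖ ≤ 1 := norm_grad_le hd x
      calc _ ≤ 1 * dst x Γ ^ (α - 1) * 1 := by gcongr
        _ = _ := by ring
    · rw [ion (fun h => hxη h.2)]
      apply ez
      apply IsLocalMin.fderiv_eq_zero
      refine Eventually.of_forall fun y => ?_
      simp only [psi]
      rw [max_eq_right ((min_le_left _ _).trans (not_lt.1 hxη))]
      have : η ^ α ≤ (max (min (dst y Γ) R) η) ^ α := Real.rpow_le_rpow hη.le (le_max_right _ _) h0.le
      linarith
  · rw [ion (fun h => hxR h.1)]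
    apply ez
    apply IsLocalMax.fderiv_eq_zero
    refine Eventually.of_forall fun y => ?_
    simp only [psi]
    rw [min_eq_right (not_lt.1 hxR)]
    have : (max (min (dst y Γ) R) η) ^ α ≤ (max R η) ^ α := Real.rpow_le_rpow (le_max_of_le_right hη.le) (max_le_max_right _ (min_le_right _ _)) h0.le
    linarith

def lF (a t : ℝ) : ℝ := (t - √(a ^ 2 + t ^ 2)) / a ^ 2

theorem lF_props {a : ℝ} (ha : 0 < a) : Sm (lF a) ∧ (∀ t, 0 ≤ deriv (lF a) t) ∧ (∀ t, 0 ≤ t → lF a t ^ 2 ≤ deriv (lF a) t * 1 ^ 2) ∧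
    ∀ t, 0 ≤ t → (t / (a ^ 2 + t ^ 2)) ^ 2 ≤ 2 * deriv (lF a) t := by
  have hp : ∀ t : ℝ, 0 < a ^ 2 + t ^ 2 := fun t => by positivity
  have hD : ∀ t, deriv (lF a) t = (1 - t / √(a ^ 2 + t ^ 2)) / a ^ 2 := by
    intro t
    have h1 : HasDerivAt (fun t : ℝ => a ^ 2 + t ^ 2) (2 * t) t := by simpa using (hasDerivAt_pow 2 t).const_add (a ^ 2)
    have h2 := ((hasDerivAt_id' t).sub (h1.sqrt (hp t).ne')).div_const (a ^ 2)
    have h3 : HasDerivAt (lF a) _ t := h2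
    rw [h3.deriv]; congr 2; field_simp
  have hs : ∀ t : ℝ, √(a ^ 2 + t ^ 2) ^ 2 = a ^ 2 + t ^ 2 := fun t => Real.sq_sqrt (hp t).le
  have hs0 : ∀ t : ℝ, 0 < √(a ^ 2 + t ^ 2) := fun t => Real.sqrt_pos.2 (hp t)
  have hlt : ∀ t : ℝ, t < √(a ^ 2 + t ^ 2) := fun t => by
    by_contra h'
    rw [not_lt] at h'
    nlinarith [hs t, hs0 t]
  have e1 : ∀ t, 0 ≤ t → deriv (lF a) t = 1 / (√(a ^ 2 + t ^ 2) * (√(a ^ 2 + t ^ 2) + t)) := fun t ht => by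
    rw [hD]
    have := hs t; have := hs0 t
    generalize √(a ^ 2 + t ^ 2) = S at *
    field_simp
    nlinarith
  refine ⟨?_, fun t => ?_, fun t ht => ?_, fun t ht => ?_⟩
  · unfold lF
    exact (contDiff_id.sub ((contDiff_const.add (contDiff_id.pow 2)).sqrt fun t => (hp t).ne')).div_const _
  · rw [hD]
    have : t / √(a ^ 2 + t ^ 2) ≤ 1 := (div_le_one (hs0 t)).2 (hlt t).le
    have : 0 ≤ 1 - t / √(a ^ 2 + t ^ 2) := by linarith
    positivity
  · rw [e1 t ht]
    have h1 := hs t; have h2 := hs0 t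
    have : lF a t = - (1 / (√(a ^ 2 + t ^ 2) + t)) := by
      unfold lF
      generalize √(a ^ 2 + t ^ 2) = S at *
      field_simp
      nlinarith
    rw [this]
    generalize √(a ^ 2 + t ^ 2) = S at *
    rw [neg_sq, div_pow, one_pow, mul_one]
    gcongr
    nlinarith
  · rw [e1 t ht]
    have h1 := hs t; have h2 := hs0 t; have h3 := hlt t
    generalize √(a ^ 2 + t ^ 2) = S at *
    rw [← h1]
    rw [div_pow, mul_one_div, div_le_div_iff₀ pz pz]
    have : t ^ 2 * (S * (S + t)) ≤ S ^ 2 * (S * (S + S)) := by gcongr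
    nlinarith

theorem cutoff (X : E) {ra rb : ℝ} (hr : ra < rb) : ∃ φ : E → ℝ, Lip (toNNReal (rb - ra)⁻¹) φ ∧ (∀ x ∈ ball X ra, φ x = 1) ∧
    (∀ x ∉ ball X rb, φ x = 0 ∧ gradient φ x = 0) ∧ (∀ x, 0 ≤ φ x) ∧ ∀ x, φ x ≤ 1 := by
  set a : ℝ≥0 := toNNReal (rb - ra)⁻¹ with haa
  have hr21 : 0 < rb - ra := by linarith
  have ea : (a : ℝ) = (rb - ra)⁻¹ := coe_toNNReal _ pz
  have hdl : Lip 1 fun x : E => - dist x X := by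
    refine LipschitzWith.of_dist_le_mul fun x y => ?_
    rw [Real.dist_eq]
    have := abs_dist_sub_le x y X
    rw [NNReal.coe_one, one_mul, abs_le] at *
    constructor <;> linarith [this.1, this.2]
  have hφ0 : ∀ x ∉ ball X rb, clp (fun x => a * (- dist x X) - (-(a * rb))) x = 0 := by
    intro x hx
    rw [mem_ball, not_lt] at hx
    apply clp_eq0
    have : (a:ℝ) * (rb - dist x X) ≤ 0 := mul_nonpos_of_nonneg_of_nonpos a.2 lz
    nlinarith
  refine ⟨_, clp_lip (lip_aff hdl a (-(a * rb))), fun x hx => ?_, fun x hx => ⟨hφ0 x hx, clp_gradz (hφ0 x hx)⟩, clp0 _, clp1 _⟩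
  rw [mem_ball] at hx
  apply clp_eq1
  have : (a:ℝ) * (rb - ra) = 1 := by rw [ea]; field_simp
  have : (a:ℝ) * (ra - dist x X) ≥ 0 := mul_nonneg a.2 lz
  nlinarith

theorem LG0 (d cA cB α : ℝ) (hd0 : 0 < d) (hdn : d < (dimE : ℝ) - 1) (hC0 : 1 ≤ cA) (hα : 1 / 2 < α) (hα1 : α ≤ 1) :
    ∃ C : ℝ, 0 < C ∧ ∀ {Γ : Set E}, AR d cA Γ → ∀ {A B U G}, Core d cB Γ A B U G →
    ∀ {a : ℝ}, 0 < a → ∀ (Y : E) (R : ℝ), 0 < R → ball Y (9 * R / 8) ⊆ B →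
    ∫⁻ x in ball Y R, ofReal ((min (dst x Γ) R ^ α) ^ 2 * deriv (lF a) (U x) * ‖G x‖ ^ 2 * wt d Γ x) ≤
      ofReal (C * (R ^ dimE * R ^ (2 * α - 2) * max (dst Y Γ) R ^ (d + 1 - (dimE : ℝ)))) := by
  set n := dimE with hn
  set g := d + 1 - (n : ℝ) with hg
  have hg0 : g < 0 := by rw [hg]; linarith
  obtain ⟨c1, hc1, h1⟩ := wt_int (E := E) d cA (-g) hd0 hC0 lz lz
  obtain ⟨c2, hc2, h2⟩ := wt_int (E := E) d cA (2 - 2 * α - g) hd0 hC0 lz lz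
  refine ⟨4 * max 1 cB ^ 4 * (2 * c2 * (10 / 9) ^ n + 162 * c1 * (10 / 9) ^ n), by positivity, ?_⟩
  intro Γ ha A B U G hc a ha0 Y R hR hB
  have hC1 : max 1 cB = cB := max_eq_right hc.C1
  rw [hC1]
  set D := max (dst Y Γ) R with hD
  have hD0 : 0 < D := lt_max_of_lt_right hR
  have hRD : R ≤ D := le_max_right _ _
  obtain ⟨φ, φL, φ1, φ0, φn, φb⟩ := cutoff Y (show R < 10 * R / 9 by linarith)
  have ea : ((toNNReal (10 * R / 9 - R)⁻¹ : ℝ≥0) : ℝ) = 9 / R := by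
    rw [coe_toNNReal]
    · field_simp; ring
    · have : 0 < 10 * R / 9 - R := by linarith
      positivity
  obtain ⟨p1, p2, p3, p4⟩ := lF_props ha0
  have hU := hc.integ.1.aemeasurable
  have hwm := wt_meas (d := d) (Γ := Γ)
  have hdm : Measurable fun x => dst x Γ := measurable_infDist
  have hDm : Measurable (deriv (lF a)) := measurable_deriv _
  have hGm := hc.Gm.norm.aemeasurable
  have hφm : Measurable φ := φL.continuous.measurable
  set T := R ^ n * R ^ (2 * α - 2) * D ^ g with hT
  have hT0 : 0 < T := by positivity
  have I1 : ∫⁻ x in ball Y (10 * R / 9), ofReal (162 * R ^ (2 * α - 2) * wt d Γ x) ≤ ofReal (162 * c1 * (10 / 9) ^ n * T) := by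
    have := h1 ha Y (10 * R / 9) pz
    rw [neg_neg] at this
    calc _ = ofReal (162 * R ^ (2 * α - 2)) * ∫⁻ x in ball Y (10 * R / 9), ofReal (wt d Γ x) := by
          rw [← lcm _ _ ont]
          refine lintegral_congr fun x => ?_
          rw [← ofReal_mul pz]
      _ ≤ _ := (mlr this _)
      _ ≤ _ := by
          rw [← ofReal_mul pz]
          apply ole
          have : max (dst Y Γ) (10 * R / 9) ^ g ≤ D ^ g := rnp hD0 (max_le_max_left _ lz) hg0.le
          calc _ ≤ 162 * R ^ (2 * α - 2) * (c1 * (10 * R / 9) ^ n * D ^ g) := by gcongr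
            _ = _ := by rw [hT, show 10 * R / 9 = 10 / 9 * R by ring, mul_pow]; ring
  have I2 : ∫⁻ x in ball Y (10 * R / 9), ofReal (2 * dst x Γ ^ (-(2 - 2 * α - g))) ≤ ofReal (2 * c2 * (10 / 9) ^ n * T) := by
    have := h2 ha Y (10 * R / 9) pz
    calc _ = ofReal 2 * ∫⁻ x in ball Y (10 * R / 9), ofReal (dst x Γ ^ (-(2 - 2 * α - g))) := by
          rw [← lcm _ _ ont]
          refine lintegral_congr fun x => ?_
          rw [← ofReal_mul pz]
      _ ≤ _ := (mlr this _)
      _ ≤ _ := by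
          rw [← ofReal_mul pz]
          apply ole
          have e1 : max (dst Y Γ) (10 * R / 9) ^ (-(2 - 2 * α - g)) ≤ D ^ (-(2 - 2 * α - g)) := rnp hD0 (max_le_max_left _ lz) lz
          have e2 : D ^ (-(2 - 2 * α - g)) ≤ R ^ (2 * α - 2) * D ^ g := by
            rw [show -(2 - 2 * α - g) = (2 * α - 2) + g by ring, rpow_add hD0]
            exact mrn (rnp hR hRD lz) pz
          calc _ ≤ 2 * (c2 * (10 * R / 9) ^ n * (R ^ (2 * α - 2) * D ^ g)) := by gcongr; exact e1.trans e2
            _ = _ := by rw [hT, show 10 * R / 9 = 10 / 9 * R by ring, mul_pow]; ring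
  set η : ℕ → ℝ := fun j => R / 2 / ((j:ℝ) + 1) with hη
  have hηp : ∀ j, 0 < η j := fun j => by positivity
  have hηρ : ∀ j, η j < R := fun j => by
    have : η j ≤ R / 2 := div_le_self pz (by linarith [Nat.cast_nonneg (α := ℝ) j])
    linarith
  have hηt : Tendsto η atTop (𝓝 0) := by
    have := tendsto_one_div_add_atTop_nhds_zero_nat (𝕜 := ℝ)
    have := this.const_mul (R / 2)
    simp only [mul_one_div, mul_zero] at this
    exact this
  have hψ0 : ∀ j x, 0 ≤ psi Γ α R (η j) x := fun j x => sub_nonneg.2 (Real.rpow_le_rpow (hηp j).le (le_max_right _ _) lz)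
  have hψ1 : ∀ j x, psi Γ α R (η j) x ≤ R ^ α := fun j x => by
    have : max (min (dst x Γ) R) (η j) ^ α ≤ R ^ α := Real.rpow_le_rpow (le_max_of_le_right (hηp j).le) (max_le (min_le_right _ _) (hηρ j).le) lz
    have h3 : 0 < η j ^ α := Real.rpow_pos_of_pos (hηp j) _
    simp only [psi]; linarith
  have main : ∀ j, ∫⁻ x, ofReal ((φ x * psi Γ α R (η j) x) ^ 2 * deriv (lF a) (U x) * ‖G x‖ ^ 2 * wt d Γ x) ≤
      ofReal (4 * cB ^ 4) * (ofReal (2 * c2 * (10 / 9) ^ n * T) + ofReal (162 * c1 * (10 / 9) ^ n * T)) := by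
    intro j
    obtain ⟨L, hL⟩ := psi_lip (Γ := Γ) (R := R) (by linarith : 0 < α) hα1 (hηp j)
    have hK : IsCompact (closedBall Y (10 * R / 9) ∩ {x | η j ≤ dst x Γ}) :=
      (isCompact_closedBall _ _).inter_right (isClosed_le continuous_const (continuous_infDist_pt Γ))
    have hlip := lip_mul (M := 1) (N := toNNReal (R ^ α)) φL hL (fun x => by rw [abn (φn x)]; exact_mod_cast φb x)
      (fun x => by rw [abn (hψ0 j x), coe_toNNReal _ pz]; exact hψ1 j x)
    refine (hc.cacc (N := fun _ => 1) (hc.ch p1) (fun t _ => p2 t) p3 measurable_const hK ?_ hlip ?_).trans (mlr ?_ _)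
    · intro x hx
      refine ⟨hB (closedBall_subset_ball lz hx.1), fun h' => ?_⟩
      have := hx.2
      simp only [mem_setOf_eq, infDist_zero_of_mem h'] at this
      linarith [hηp j]
    · intro x hx
      by_cases h3 : x ∈ ball Y (10 * R / 9)
      · have : dst x Γ ≤ η j := by
          by_contra h2; exact hx ⟨bsc h3, (not_le.1 h2).le⟩
        simp [psi, max_eq_right ((min_le_left _ _).trans this)]
      · simp [(φ0 x h3).1]
    · refine le_trans ?_ (add_le_add I2 I1)
      rw [← lintegral_indicator msb, ← lintegral_indicator msb, ← lintegral_add_left (Measurable.indicator fz msb)]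
      apply lintegral_mono_ae
      filter_upwards [norm_grad_mul φL hL, ha.aeΩ, psi_grad (Γ := Γ) (by linarith : 0 < α) hα1 (hηp j) (hηρ j)] with x h3 hx h4
      have h0 := dl_pos ha.closed ha.ne hx
      have hw0 := wt_nonneg (d := d) (Γ := Γ) x
      by_cases hxb : x ∈ ball Y (10 * R / 9)
      · rw [iom hxb, iom hxb, ← ofReal_add pz pz]
        apply ole
        rw [abn (φn x), abn (hψ0 j x)] at h3
        have h5 : ‖gradient (psi Γ α R (η j)) x‖ ≤ dst x Γ ^ (α - 1) := h4.trans (indicator_le_self' (fun _ _ => Real.rpow_nonneg infDist_nonneg _) x)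
        have h6 := norm_grad_le φL x
        rw [ea] at h6
        have h7 : ‖gradient (fun x => φ x * psi Γ α R (η j) x) x‖ ≤ 1 * dst x Γ ^ (α - 1) + R ^ α * (9 / R) := by
          refine h3.trans (add_le_add (mul_le_mul (φb x) h5 (norm_nonneg _) zero_le_one) (mul_le_mul (hψ1 j x) h6 (norm_nonneg _) pz))
        have e1 : (dst x Γ ^ (α - 1)) ^ 2 * wt d Γ x = dst x Γ ^ (-(2 - 2 * α - g)) := by
          rw [wt, ← rpow_natCast, ← rpow_mul h0.le, ← rpow_add h0]; congr 1; push_cast; ring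
        have e2 : (R ^ α * (9 / R)) ^ 2 = 81 * R ^ (2 * α - 2) := by
          rw [show 2 * α - 2 = α * 2 - (2:ℕ) by push_cast; ring, Real.rpow_sub hR, rpow_mul hR.le, rpow_natCast]; norm_cast; field_simp; norm_num
        rw [← e1]
        calc _ ≤ 1 ^ 2 * (1 * dst x Γ ^ (α - 1) + R ^ α * (9 / R)) ^ 2 * wt d Γ x := by gcongr
          _ ≤ (2 * (dst x Γ ^ (α - 1)) ^ 2 + 2 * (R ^ α * (9 / R)) ^ 2) * wt d Γ x := by
              gcongr
              nlinarith [sq_nonneg (dst x Γ ^ (α - 1) - R ^ α * (9 / R))]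
          _ = _ := by rw [e2]; ring
      · obtain ⟨k1, k2⟩ := φ0 x hxb
        rw [k1, k2] at h3
        simp only [abs_zero, norm_zero, zero_mul, mul_zero, add_zero] at h3
        have := le_antisymm h3 (norm_nonneg _)
        simp only [this]
        simp
  have fin := fatou (F := fun j x => ofReal ((φ x * psi Γ α R (η j) x) ^ 2 * deriv (lF a) (U x) * ‖G x‖ ^ 2 * wt d Γ x))
    (F0 := fun x => ofReal ((φ x * min (dst x Γ) R ^ α) ^ 2 * deriv (lF a) (U x) * ‖G x‖ ^ 2 * wt d Γ x))
    (fun j => by unfold psi; fun_prop) ?_ tendsto_const_nhds main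
  · calc _ ≤ ∫⁻ x, ofReal ((φ x * min (dst x Γ) R ^ α) ^ 2 * deriv (lF a) (U x) * ‖G x‖ ^ 2 * wt d Γ x) := by
          rw [← lintegral_indicator msb]
          apply lintegral_mono
          intro x
          by_cases hx : x ∈ ball Y R
          · simp [iom hx, φ1 x hx]
          · simp [ion hx]
      _ ≤ _ := fin
      _ = _ := by
          rw [← ofReal_add pz pz, ← ofReal_mul pz]
          congr 1; ring
  · filter_upwards [ha.aeΩ] with x hx
    have h0 := dl_pos ha.closed ha.ne hx
    apply ENNReal.tendsto_ofReal
    have hψt : Tendsto (fun j => psi Γ α R (η j) x) atTop (𝓝 (min (dst x Γ) R ^ α)) := by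
      have e1 : Tendsto (fun j => η j ^ α) atTop (𝓝 0) := by
        have := hηt.rpow_const (p := α) (Or.inr lz)
        rwa [Real.zero_rpow lz] at this
      have e2 : Tendsto (fun j => max (min (dst x Γ) R) (η j) ^ α) atTop (𝓝 (min (dst x Γ) R ^ α)) := by
        refine tendsto_const_nhds.congr' ?_
        filter_upwards [hηt.eventually_lt_const (show 0 < min (dst x Γ) R from lt_min h0 hR)] with j hj
        rw [max_eq_left hj.le]
      simpa [psi] using e2.sub e1
    exact ((((hψt.const_mul _).pow 2).mul_const _).mul_const _).mul_const _

set_option maxHeartbeats 400000 in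
theorem LG (d cA cB : ℝ) (hd0 : 0 < d) (hdn : d < (dimE : ℝ) - 1) (hC0 : 1 ≤ cA) :
    ∃ C : ℝ, 0 < C ∧ ∀ {Γ : Set E}, AR d cA Γ → ∀ {A B U G}, Core d cB Γ A B U G →
    ∀ {a : ℝ}, 0 < a → ∀ (Y : E) (R : ℝ), 0 < R → ball Y (9 * R / 8) ⊆ B →
    ∫⁻ x in ball Y R, ofReal (U x / (a ^ 2 + U x ^ 2) * ‖G x‖) ≤ ofReal (C * (R ^ dimE / R)) := by
  set n := dimE with hn
  set g := d + 1 - (n : ℝ) with hg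
  have hg0 : g < 0 := by rw [hg]; linarith
  set α : ℝ := 1 / 2 + min 1 (-g) / 4 with hα
  have hm : 0 < min 1 (-g) := lt_min one_pos lz
  have hm1 : min 1 (-g) ≤ 1 := min_le_left _ _
  have hm2 : min 1 (-g) ≤ -g := min_le_right _ _
  obtain ⟨c1, hc1, h1⟩ := LG0 (E := E) d cA cB α hd0 hdn hC0 lz lz
  set q := max (2 * α + g) 0 with hq
  have hqn : q < n - d := max_lt (by rw [hα]; linarith) lz
  obtain ⟨c2, hc2, h2⟩ := wt_int (E := E) d cA q hd0 hC0 (le_max_right _ _) hqn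
  have hqg : 0 ≤ -g - 2 * α + q := by have := le_max_left (2 * α + g) 0; linarith
  have hvb := vb_pos (E := E)
  refine ⟨c1 + 2 ^ (-g - 2 * α + q) * c2 + 2 ^ (-g) * vb E, by positivity, ?_⟩
  intro Γ ha A B U G hc a ha0 Y R hR hB
  have I1 := h1 ha hc ha0 Y R hR hB
  have I2 := h2 ha Y R hR
  obtain ⟨p1, p2, p3, p4⟩ := lF_props ha0
  have hU := hc.integ.1.aemeasurable
  have hwm := wt_meas (d := d) (Γ := Γ)
  have hdm : Measurable fun x => dst x Γ := measurable_infDist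
  have hDm : Measurable (deriv (lF a)) := measurable_deriv _
  have hGm := hc.Gm.norm.aemeasurable
  set D := max (dst Y Γ) R with hD
  have hD0 : 0 < D := lt_max_of_lt_right hR
  have hRD : R ≤ D := le_max_right _ _
  set l := R ^ (1 - 2 * α) * D ^ (-g) with hl
  have hl0 : 0 < l := by positivity
  have key : ∀ᵐ x : E, x ∈ ball Y R → ofReal (U x / (a ^ 2 + U x ^ 2) * ‖G x‖) ≤
      ofReal l * ofReal ((min (dst x Γ) R ^ α) ^ 2 * deriv (lF a) (U x) * ‖G x‖ ^ 2 * wt d Γ x) +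
      (ofReal (l⁻¹ * (2 * D) ^ (-g - 2 * α + q)) * ofReal (dst x Γ ^ (-q)) + ofReal (l⁻¹ * (R ^ (-(2 * α)) * (2 * D) ^ (-g)))) := by
    filter_upwards [ha.aeΩ] with x hx hxb
    have h0 := dl_pos ha.closed ha.ne hx
    have hw := wt_pos (d := d) ha.closed ha.ne hx
    have hUn := hc.nonneg x
    have hH := p2 (U x)
    set m := min (dst x Γ) R with hm
    have hm0 : 0 < m := lt_min h0 hR
    have hδ : dst x Γ ≤ 2 * D := by
      have e := (lipschitz_infDist_pt Γ).dist_le_mul x Y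
      rw [mem_ball] at hxb
      rw [Real.dist_eq, abs_le] at e
      simp only [NNReal.coe_one, one_mul] at e
      linarith [e.2, le_max_left (dst Y Γ) R, le_max_right (dst Y Γ) R]
    rw [← ofReal_mul hl0.le, ← ofReal_mul pz, ← ofReal_add pz pz, ← ofReal_add pz pz]
    apply ole
    have e0 : (wt d Γ x)⁻¹ = dst x Γ ^ (-g) := by rw [wt, rpow_neg h0.le]
    have e1 : (m ^ α)⁻¹ ^ 2 * (wt d Γ x)⁻¹ ≤ (2 * D) ^ (-g - 2 * α + q) * dst x Γ ^ (-q) + R ^ (-(2 * α)) * (2 * D) ^ (-g) := by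
      have e2 : (m ^ α)⁻¹ ^ 2 = m ^ (-(2 * α)) := by
        rw [← rpow_neg hm0.le, ← rpow_natCast, ← rpow_mul hm0.le]; congr 1; push_cast; ring
      rw [e2, e0]
      rcases min_choice (dst x Γ) R with hmm | hmm
      · rw [hm, hmm, ← rpow_add h0, show -(2 * α) + -g = (-g - 2 * α + q) + -q by ring, rpow_add h0]
        have : dst x Γ ^ (-g - 2 * α + q) ≤ (2 * D) ^ (-g - 2 * α + q) := Real.rpow_le_rpow h0.le hδ hqg
        have h4 : 0 ≤ R ^ (-(2 * α)) * (2 * D) ^ (-g) := by positivity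
        have := mrn this (show 0 ≤ dst x Γ ^ (-q) by positivity)
        linarith
      · rw [hm, hmm]
        have : dst x Γ ^ (-g) ≤ (2 * D) ^ (-g) := Real.rpow_le_rpow h0.le hδ lz
        have h4 : 0 ≤ (2 * D) ^ (-g - 2 * α + q) * dst x Γ ^ (-q) := by positivity
        have := mln this (show 0 ≤ R ^ (-(2 * α)) by positivity)
        linarith
    have e3 : U x / (a ^ 2 + U x ^ 2) * ‖G x‖ ≤ l * ((m ^ α) ^ 2 * deriv (lF a) (U x) * ‖G x‖ ^ 2 * wt d Γ x) + l⁻¹ * ((m ^ α)⁻¹ ^ 2 * (wt d Γ x)⁻¹) := by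
      have hp4 := p4 (U x) hUn
      have hma : 0 < m ^ α := by positivity
      generalize deriv (lF a) (U x) = H at *
      generalize U x / (a ^ 2 + U x ^ 2) = F at *
      generalize wt d Γ x = w at *
      generalize m ^ α = M at *
      set P := l * M ^ 2 * w with hP
      have hP0 : 0 < P := by positivity
      have e4 : l⁻¹ * (M⁻¹ ^ 2 * w⁻¹) = P⁻¹ := by rw [hP]; field_simp
      have e5 : l * (M ^ 2 * H * ‖G x‖ ^ 2 * w) = P * (H * ‖G x‖ ^ 2) := by rw [hP]; ring
      rw [e4, e5]
      have e6 : F ^ 2 * ‖G x‖ ^ 2 ≤ 2 * H * ‖G x‖ ^ 2 := by gcongr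
      have e7 : P * (F * ‖G x‖) ^ 2 / 2 + P⁻¹ ≤ P * (H * ‖G x‖ ^ 2) + P⁻¹ := by
        have := mln e6 hP0.le
        nlinarith
      refine le_trans ?_ e7
      generalize F * ‖G x‖ = z
      have e8 : P * P⁻¹ = 1 := mul_inv_cancel₀ hP0.ne'
      have hP1 : 0 < P⁻¹ := by positivity
      have e9 : 0 ≤ P⁻¹ * (P * z - 1) ^ 2 := by positivity
      have e10 : P⁻¹ * (P * z - 1) ^ 2 = P * z ^ 2 - 2 * z + P⁻¹ := by field_simp; ring
      linarith
    refine e3.trans ?_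
    have := mln e1 (show 0 ≤ l⁻¹ by positivity)
    nlinarith
  have hR1 : R ^ n / R = R ^ ((n:ℝ) - 1) := by rw [Real.rpow_sub_one hR.ne', rpow_natCast]
  calc _ ≤ _ := lintegral_mono_ae ((ae_restrict_iff' msb).2 key)
    _ = ofReal l * (∫⁻ x in ball Y R, ofReal ((min (dst x Γ) R ^ α) ^ 2 * deriv (lF a) (U x) * ‖G x‖ ^ 2 * wt d Γ x)) +
      (ofReal (l⁻¹ * (2 * D) ^ (-g - 2 * α + q)) * (∫⁻ x in ball Y R, ofReal (dst x Γ ^ (-q))) + ofReal (l⁻¹ * (R ^ (-(2 * α)) * (2 * D) ^ (-g))) * volume (ball Y R)) := by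
        have hqm : Measurable fun x => ofReal (dst x Γ ^ (-q)) := ENNReal.measurable_ofReal.comp (hdm.pow_const _)
        rw [lintegral_add_right _ ((hqm.const_mul _).add_const _), lintegral_add_right _ measurable_const, lcm _ _ ont, lcm _ _ ont, lintegral_const, Measure.restrict_apply_univ]
    _ ≤ ofReal l * ofReal (c1 * (R ^ n * R ^ (2 * α - 2) * D ^ g)) +
      (ofReal (l⁻¹ * (2 * D) ^ (-g - 2 * α + q)) * ofReal (c2 * R ^ n * D ^ (-q)) + ofReal (l⁻¹ * (R ^ (-(2 * α)) * (2 * D) ^ (-g))) * ofReal (vb E * R ^ n)) := by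
        rw [vol_b Y hR]
        gcongr
    _ ≤ _ := by
        rw [← ofReal_mul pz, ← ofReal_mul pz, ← ofReal_mul pz, ← ofReal_add pz pz, ← ofReal_add pz pz]
        apply ole
        have hDg : D ^ (-g) * D ^ g = 1 := by rw [← rpow_add hD0]; simp
        have r1 : R ^ (1 - 2 * α) * R ^ (2 * α - 2) = R⁻¹ := by rw [← rpow_add hR, ← Real.rpow_neg_one]; congr 1; ring
        have r2 : R ^ (1 - 2 * α) * R = R ^ (2 - 2 * α) := by rw [← Real.rpow_add_one hR.ne']; congr 1; ring
        have hl1 : l⁻¹ = R ^ (2 * α - 1) * D ^ g := by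
          rw [hl, mul_inv, ← rpow_neg hR.le, ← rpow_neg hD0.le, neg_neg, neg_sub]
        have t1 : l * (c1 * (R ^ n * R ^ (2 * α - 2) * D ^ g)) = c1 * (R ^ n / R) := by
          rw [hl]
          calc _ = c1 * (R ^ n * (R ^ (1 - 2 * α) * R ^ (2 * α - 2))) * (D ^ (-g) * D ^ g) := by ring
            _ = _ := by rw [r1, hDg]; field_simp
        have t2 : l⁻¹ * (2 * D) ^ (-g - 2 * α + q) * (c2 * R ^ n * D ^ (-q)) ≤ 2 ^ (-g - 2 * α + q) * c2 * (R ^ n / R) := by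
          rw [hl1, mul_rpow nz hD0.le]
          have u1 : D ^ g * D ^ (-g - 2 * α + q) * D ^ (-q) = D ^ (-(2 * α)) := by
            rw [← rpow_add hD0, ← rpow_add hD0]; congr 1; ring
          have u2 : D ^ (-(2 * α)) ≤ R ^ (-(2 * α)) := rnp hR hRD lz
          have u3 : R ^ (2 * α - 1) * R ^ (-(2 * α)) = R⁻¹ := by rw [← rpow_add hR, ← Real.rpow_neg_one]; congr 1; ring
          calc _ = 2 ^ (-g - 2 * α + q) * c2 * R ^ n * (R ^ (2 * α - 1) * (D ^ g * D ^ (-g - 2 * α + q) * D ^ (-q))) := by ring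
            _ ≤ 2 ^ (-g - 2 * α + q) * c2 * R ^ n * (R ^ (2 * α - 1) * R ^ (-(2 * α))) := by rw [u1]; gcongr
            _ = _ := by rw [u3]; field_simp
        have t3 : l⁻¹ * (R ^ (-(2 * α)) * (2 * D) ^ (-g)) * (vb E * R ^ n) = 2 ^ (-g) * vb E * (R ^ n / R) := by
          rw [hl1, mul_rpow nz hD0.le]
          have u3 : R ^ (2 * α - 1) * R ^ (-(2 * α)) = R⁻¹ := by rw [← rpow_add hR, ← Real.rpow_neg_one]; congr 1; ring
          calc _ = 2 ^ (-g) * vb E * R ^ n * (R ^ (2 * α - 1) * R ^ (-(2 * α))) * (D ^ (-g) * D ^ g) := by ring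
            _ = _ := by rw [u3, hDg]; field_simp
        rw [t1, t3]
        linarith

theorem ker1 {h : E → ℝ≥0∞} (hh : Measurable h) (Y : E) (R : ℝ) {y : E} (hy : y ∈ ball Y R) {t : ℝ} (ht : t ∈ Icc (1/2:ℝ) 1) :
    ∫⁻ x in ball Y R, h (y + t • (x - y)) ≤ 2 ^ dimE * ∫⁻ x in ball Y R, h x := by
  have t0 : (0:ℝ) < t := by linarith [ht.1]
  set H := (ball Y R).indicator h with hH
  have Hm : Measurable H := hh.indicator msb
  have e1 : ∫⁻ x in ball Y R, h (y + t • (x - y)) ≤ ∫⁻ x, H (t • x + (1 - t) • y) := by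
    rw [← lintegral_indicator msb]
    refine lintegral_mono fun x => ?_
    by_cases hx : x ∈ ball Y R
    · rw [iom hx]
      have e : y + t • (x - y) = t • x + (1 - t) • y := by module
      rw [e, hH, iom ((convex_ball Y R) hx hy t0.le (by linarith [ht.2]) (by ring))]
    · rw [ion hx]; exact zero_le
  have e2 : ∫⁻ x, H (t • x + (1 - t) • y) = ofReal |(t ^ dimE)⁻¹| * ∫⁻ x, H x := by
    have := lintegral_map (μ := (volume : Measure E)) (f := fun z => H (z + (1 - t) • y)) fz (show Measurable fun x : E => t • x by fun_prop)
    rw [← this, Measure.map_addHaar_smul _ t0.ne', lintegral_smul_measure, lintegral_add_right_eq_self H]; rfl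
  refine e1.trans (e2.le.trans ?_)
  rw [hH, lintegral_indicator msb]
  gcongr
  rw [abs_of_pos pz, ← inv_pow]
  calc _ ≤ ofReal (2 ^ dimE) := by
        apply ole; gcongr
        rw [inv_le_comm₀ t0 nz]; linarith [ht.1]
    _ = _ := by rw [ofReal_pow nz]; norm_num

theorem ker2 {h : E → ℝ≥0∞} (hh : Measurable h) (Y : E) (R : ℝ) :
    ∫⁻ p : E × E, (∫⁻ t in Icc (0:ℝ) 1, h (p.2 + t • (p.1 - p.2))) ∂((volume.restrict (ball Y R)).prod (volume.restrict (ball Y R)))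
      ≤ volume (ball Y R) * (2 ^ dimE * ∫⁻ x in ball Y R, h x) := by
  set μ : Measure E := volume.restrict (ball Y R) with hμ
  have : IsFiniteMeasure μ := ⟨by rw [hμ, Measure.restrict_apply_univ]; exact measure_ball_lt_top⟩
  rw [lintegral_lintegral_swap fz]
  have hc : ∀ c : ℝ≥0∞, ∫⁻ x, c ∂μ = volume (ball Y R) * c := fun c => by rw [lintegral_const, hμ, Measure.restrict_apply_univ, mul_comm]
  calc _ ≤ ∫⁻ t in Icc (0:ℝ) 1, volume (ball Y R) * (2 ^ dimE * ∫⁻ x in ball Y R, h x) := by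
        refine setLIntegral_mono measurable_const fun t ht => ?_
        rcases le_total (1/2) t with h1 | h1
        · rw [lintegral_prod_symm' _ fz, ← hc]
          refine setLIntegral_mono measurable_const fun y hy => ?_
          exact ker1 hh Y R hy ⟨h1, ht.2⟩
        · rw [lintegral_prod _ fz, ← hc]
          refine setLIntegral_mono measurable_const fun x hx => ?_
          have := ker1 hh Y R hx (t := 1 - t) ⟨by linarith, by linarith [ht.1]⟩
          refine le_trans (le_of_eq ?_) this
          refine lintegral_congr fun y => ?_
          dsimp only; congr 1; module
    _ = _ := by rw [lintegral_const, Measure.restrict_apply_univ]; simp [hμ]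

theorem ftc_seg {F : E → ℝ} (hF : ContDiff ℝ (⊤:ℕ∞) F) {Y : E} {R : ℝ} {x y : E} (hx : x ∈ ball Y R) (hy : y ∈ ball Y R) :
    ‖F x - F y‖ₑ ≤ ofReal (2 * R) * ∫⁻ t in Icc (0:ℝ) 1, ‖gradient F (y + t • (x - y))‖ₑ := by
  have hd : ∀ t : ℝ, HasDerivAt (fun t : ℝ => F (y + t • (x - y))) (inner ℝ (gradient F (y + t • (x - y))) (x - y)) t := fun t => by
    have h1 : HasDerivAt (fun t : ℝ => y + t • (x - y)) (x - y) t := by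
      simpa using ((hasDerivAt_id t).smul_const (x - y)).const_add y
    have h2 := ((hF.differentiable sz) (y + t • (x - y))).hasFDerivAt.comp_hasDerivAt t h1
    have h3 : inner ℝ (gradient F (y + t • (x - y))) (x - y) = fderiv ℝ F (y + t • (x - y)) (x - y) := by
      unfold gradient; simp
    rw [h3]; exact h2
  have hc : Continuous fun t : ℝ => inner ℝ (gradient F (y + t • (x - y))) (x - y) := by
    have := grad_cont hF; fun_prop
  have h1 := intervalIntegral.integral_eq_sub_of_hasDerivAt (a := 0) (b := 1) (fun t _ => hd t) (hc.intervalIntegrable _ _)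
  simp only [one_smul, zero_smul, add_zero, add_sub_cancel] at h1
  rw [← h1, intervalIntegral.integral_of_le zero_le_one, ← integral_Icc_eq_integral_Ioc]
  refine (enorm_integral_le_lintegral_enorm _).trans ?_
  rw [← lcm _ _ ont]
  refine lintegral_mono fun t => ?_
  rw [mul_comm, ← ofReal_norm_eq_enorm, ← ofReal_norm_eq_enorm, ← ofReal_mul (norm_nonneg _)]
  apply ole
  refine (norm_inner_le_norm _ _).trans ?_
  gcongr
  rw [← dist_eq_norm]
  rw [mem_ball] at hx hy
  linarith [dist_triangle_right x y Y]

theorem poin_WG {K : Set E} (hK : IsCompact K) {f : E → ℝ} {g : E → E} (h : WG K f g) (Y : E) (R : ℝ) :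
    ∫⁻ p : E × E, ‖f p.1 - f p.2‖ₑ ∂((volume.restrict (ball Y R)).prod (volume.restrict (ball Y R)))
      ≤ ofReal (2 * R) * (volume (ball Y R) * (2 ^ dimE * ∫⁻ x in ball Y R, ‖g x‖ₑ)) := by
  obtain ⟨K', hK', hKK⟩ := exists_compact_superset hK
  obtain ⟨F, f1, f2, f3, f4⟩ := h.approx hK hKK
  set e := fun k => eLpNorm (fun x => gradient (F k) x - g x) 2 volume with he
  have hvt : volume (ball Y R) ≠ ⊤ := measure_ball_lt_top.ne
  have hb : ∀ k, ∫⁻ x in ball Y R, ‖gradient (F k) x‖ₑ ≤ (∫⁻ x in ball Y R, ‖g x‖ₑ) + e k * volume (ball Y R) ^ (1 / 2 : ℝ) := fun k => by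
    have hm : AEStronglyMeasurable (fun x => gradient (F k) x - g x) volume := (grad_cont (f1 k)).aestronglyMeasurable.sub h.mem.1
    refine (lintegral_mono (g := fun x => ‖g x‖ₑ + ‖gradient (F k) x - g x‖ₑ) fun x => ?_).trans ?_
    · calc _ = ‖g x + (gradient (F k) x - g x)‖ₑ := by congr 1; abel
        _ ≤ _ := enorm_add_le _ _
    rw [lintegral_add_left' h.mem.1.enorm.restrict]
    gcongr
    rw [← eLpNorm_one_eq_lintegral_enorm]
    refine (eLpNorm_le_eLpNorm_mul_rpow_measure_univ (p := 1) (q := 2) nz hm.restrict).trans ?_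
    rw [Measure.restrict_apply_univ]
    exact mul_le_mul' (eLpNorm_mono_measure _ Measure.restrict_le_self) (le_of_eq nz)
  have hKv : volume (ball Y R) ^ (1 / 2 : ℝ) ≠ ⊤ := ENNReal.rpow_ne_top_of_nonneg nz hvt
  refine fatou (F := fun k p => ‖F k p.1 - F k p.2‖ₑ) (c := fun k => ofReal (2 * R) * (volume (ball Y R) * (2 ^ dimE * ((∫⁻ x in ball Y R, ‖g x‖ₑ) + e k * volume (ball Y R) ^ (1 / 2 : ℝ)))))
    (fun k => ?_) (aoa _ fun p => ?_) ?_ (fun k => ?_)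
  · have := (f1 k).continuous; fun_prop
  · exact (continuous_enorm.tendsto _).comp ((f3.tendsto_at p.1).sub (f3.tendsto_at p.2))
  · refine ENNReal.Tendsto.const_mul (ENNReal.Tendsto.const_mul (ENNReal.Tendsto.const_mul ?_ (Or.inr (by finiteness))) (Or.inr hvt)) (Or.inr ont)
    have := (ENNReal.Tendsto.mul_const f4 (Or.inr hKv)).const_add (∫⁻ x in ball Y R, ‖g x‖ₑ)
    rwa [zero_mul, add_zero] at this
  · have hgm : Measurable fun x => ‖gradient (F k) x‖ₑ := (grad_cont (f1 k)).enorm.measurable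
    have := (ker2 hgm Y R).trans (mlr (mlr (hb k) _) _)
    refine le_trans ?_ (mlr this _)
    rw [← lcm _ _ ont, Measure.prod_restrict]
    refine setLIntegral_mono' (measurableSet_ball.prod msb) fun p hp => ftc_seg (f1 k) hp.1 hp.2

def lg (a t : ℝ) : ℝ := log (a ^ 2 + t ^ 2) / 2

theorem lg_d {a : ℝ} (ha : 0 < a) : ContDiff ℝ (⊤:ℕ∞) (lg a) ∧ deriv (lg a) = fun t => t / (a ^ 2 + t ^ 2) := by
  have hp : ∀ t : ℝ, a ^ 2 + t ^ 2 ≠ 0 := fun t => by positivity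
  refine ⟨(ContDiff.log fz hp).div_const 2, funext fun t => ?_⟩
  have h1 : HasDerivAt (fun t : ℝ => a ^ 2 + t ^ 2) (2 * t) t := by simpa using (hasDerivAt_pow 2 t).const_add (a ^ 2)
  have := ((h1.log (hp t)).div_const 2).deriv
  unfold lg
  rw [this]; field_simp

theorem osc0 (d cA cB : ℝ) (hd0 : 0 < d) (hdn : d < (dimE : ℝ) - 1) (hC0 : 1 ≤ cA) :
    ∃ C : ℝ, 0 < C ∧ ∀ {Γ : Set E}, AR d cA Γ → ∀ {A B U G}, Core d cB Γ A B U G →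
    ∀ {a : ℝ}, 0 < a → ∀ (Y : E) (R : ℝ), 0 < R → ball Y (9 * R / 8) ⊆ B → ∀ M : ℝ, (∀ x ∈ ball Y R, U x ≤ M) →
    ∫⁻ p : E × E, ‖lg a (U p.1) - lg a (U p.2)‖ₑ ∂((volume.restrict (ball Y R)).prod (volume.restrict (ball Y R)))
      ≤ volume (ball Y R) * ofReal (C * R ^ dimE) := by
  set n := dimE with hn
  obtain ⟨C, hC, H⟩ := LG (E := E) d cA cB hd0 hdn hC0
  refine ⟨2 * 2 ^ n * C, by positivity, fun {Γ} ha {A B U G} h {a} a0 Y R hR hB M hM => ?_⟩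
  replace H := H ha h a0 Y R hR hB
  obtain ⟨lc, ld⟩ := lg_d a0
  have hch := h.ch lc
  rw [ld] at hch
  have hM0 : 0 ≤ M := (h.nonneg Y).trans (hM Y (mem_ball_self hR))
  set S := (|log (a ^ 2)| + |log (a ^ 2 + M ^ 2)|) / 2 with hS
  have hS0 : 0 ≤ S := by positivity
  have hSb : ∀ x ∈ ball Y R, |lg a (U x)| ≤ S := fun x hx => by
    have := hM x hx; have := h.nonneg x
    unfold lg
    have h1 : log (a ^ 2) ≤ log (a ^ 2 + U x ^ 2) := Real.log_le_log pz (by nlinarith)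
    have h2 : log (a ^ 2 + U x ^ 2) ≤ log (a ^ 2 + M ^ 2) := Real.log_le_log pz (by gcongr)
    rw [hS, abs_div, abs_two]
    gcongr
    rw [abs_le]
    constructor
    · linarith [neg_abs_le (log (a ^ 2)), abs_nonneg (log (a ^ 2 + M ^ 2))]
    · linarith [le_abs_self (log (a ^ 2 + M ^ 2)), abs_nonneg (log (a ^ 2))]
  have hη : ∀ j : ℕ, ∃ η : ℝ, 0 < η ∧ η < 1 / ((j:ℝ) + 1) ∧ volume (ball Y R ∩ {x | dst x Γ ≤ 2 * η}) ≤ ofReal (1 / ((j:ℝ) + 1) * η) := fun j => by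
    have j0 : (0:ℝ) < 1 / ((j:ℝ) + 1) := by positivity
    have e1 := ha.layer (K0 := ball Y R) isBounded_ball j0
    have e2 : ∀ᶠ η in 𝓝[>] (0:ℝ), η ∈ Ioo 0 (1 / ((j:ℝ) + 1)) := Ioo_mem_nhdsGT j0
    obtain ⟨η, h1, h2⟩ := (e1.and e2).exists
    exact ⟨η, h2.1, h2.2, h1⟩
  choose η η0 η1 η2 using hη
  obtain ⟨φ, φL, φ1, φ0, φn, φo⟩ := cutoff Y (show R < 2 * R by linarith)
  set χ := fun j : ℕ => clp fun x : E => ((η j)⁻¹).toNNReal * dst x Γ - 1 with hχ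
  have ec : ∀ j, (((η j)⁻¹).toNNReal : ℝ) = (η j)⁻¹ := fun j => coe_toNNReal _ (inv_pos.2 (η0 j)).le
  have χL : ∀ j, Lip ((η j)⁻¹).toNNReal (χ j) := fun j => clp_lip (lip_aff (lipschitz_infDist_pt Γ) _ _)
  have χ1 : ∀ j x, 2 * η j ≤ dst x Γ → χ j x = 1 := fun j x hx => by
    refine clp_eq1 ?_
    rw [ec]; have := η0 j
    rw [le_sub_iff_add_le, inv_mul_eq_div, le_div_iff₀ this]; linarith
  set K := fun j => closedBall Y (2 * R) ∩ {x | η j ≤ dst x Γ} with hK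
  have Kc : ∀ j, IsCompact (K j) := fun j => (isCompact_closedBall _ _).inter_right (isClosed_le continuous_const (continuous_infDist_pt Γ))
  have KΓ : ∀ j, K j ⊆ Γᶜ := fun j x hx hx' => by
    have := hx.2; rw [mem_setOf_eq, infDist_zero_of_mem hx'] at this; linarith [η0 j]
  have hζ := fun j => lip_mul φL (χL j) (M := 1) (N := 1) (fun x => by rw [abn (φn x)]; exact_mod_cast φo x) (clp_abs _)
  have hw := fun j => hch (K j) (Kc j) (KΓ j) _ _ (hζ j) (fun x hx => by
    by_cases h1 : x ∈ closedBall Y (2 * R)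
    · have h2 : dst x Γ < η j := by by_contra h3; exact hx ⟨h1, not_lt.1 h3⟩
      have : χ j x = 0 := by
        refine clp_eq0 ?_
        rw [ec, sub_nonpos, inv_mul_eq_div, div_le_one (η0 j)]; exact h2.le
      rw [this, mul_zero]
    · rw [(φ0 x fun h2 => h1 (bsc h2)).1, zero_mul])
  have hg : ∀ j x, x ∈ ball Y R → gradient (fun x => φ x * χ j x) x = gradient (χ j) x := fun j x hx => by
    have : (fun x => φ x * χ j x) =ᶠ[𝓝 x] χ j := by
      filter_upwards [isOpen_ball.mem_nhds hx] with y hy; rw [φ1 y hy, one_mul]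
    unfold gradient; rw [this.fderiv_eq]
  have hgb : ∀ j, ∫⁻ x in ball Y R, ‖lg a (U x) • gradient (fun x => φ x * χ j x) x + (φ x * χ j x * (U x / (a ^ 2 + U x ^ 2))) • G x‖ₑ
      ≤ ofReal (S * (1 / ((j:ℝ) + 1))) + ofReal (C * (R ^ n / R)) := fun j => by
    have mS : MeasurableSet {x : E | dst x Γ ≤ 2 * η j} := measurableSet_le measurable_infDist measurable_const
    refine (setLIntegral_mono' (g := fun x => {x : E | dst x Γ ≤ 2 * η j}.indicator (fun _ => ofReal (S * (η j)⁻¹)) x + ofReal (U x / (a ^ 2 + U x ^ 2) * ‖G x‖)) msb fun x hx => ?_).trans ?_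
    · refine (enorm_add_le _ _).trans (add_le_add ?_ ?_)
      · rw [hg j x hx, ← ofReal_norm_eq_enorm, norm_smul]
        by_cases h1 : dst x Γ ≤ 2 * η j
        · rw [iom (show x ∈ {x : E | dst x Γ ≤ 2 * η j} from h1)]
          have := norm_grad_le (χL j) x
          rw [ec] at this
          exact ole (mul_le_mul (hSb x hx) this (norm_nonneg _) hS0)
        · have : gradient (χ j) x = 0 := by
            refine clp_grad1 fz ?_
            rw [ec, lt_sub_iff_add_lt, inv_mul_eq_div, lt_div_iff₀ (η0 j)]; linarith
          rw [this]; simp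
      · rw [← ofReal_norm_eq_enorm, norm_smul]
        apply ole
        have := h.nonneg x
        have e : ‖φ x * χ j x * (U x / (a ^ 2 + U x ^ 2))‖ ≤ U x / (a ^ 2 + U x ^ 2) := by
          have := clp0 (fun x : E => ((η j)⁻¹).toNNReal * dst x Γ - 1) x
          have := clp1 (fun x : E => ((η j)⁻¹).toNNReal * dst x Γ - 1) x
          have := φn x
          rw [norm_of_nonneg pz]
          exact mul_le_of_le_one_left pz (mul_le_one₀ (φo x) (clp0 _ _) (clp1 _ _))
        gcongr
    · rw [lintegral_add_left (measurable_const.indicator mS), lintegral_indicator mS, setLIntegral_const, Measure.restrict_apply mS, inter_comm]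
      refine add_le_add ((mlr (η2 j) _).trans ?_) H
      rw [← ofReal_mul (by have := η0 j; positivity)]
      apply ole
      have := η0 j
      apply le_of_eq; field_simp
  have hp := fun j => (poin_WG (Kc j) (hw j) Y R).trans (mlr (mlr (mlr (hgb j) _) _) _)
  have key := fatou (c0 := ofReal (2 * R) * (volume (ball Y R) * (2 ^ n * (0 + ofReal (C * (R ^ n / R))))))
    (F0 := fun p : E × E => ‖lg a (U p.1) - lg a (U p.2)‖ₑ) (fun j => ?_) ?_ ?_ hp
  · refine key.trans (le_of_eq ?_)
    have e2 : (2:ℝ≥0∞) ^ n = ofReal (2 ^ n) := by rw [ofReal_pow nz]; norm_num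
    rw [zero_add, e2, ← ofReal_mul pz, mul_left_comm, ← ofReal_mul pz]
    congr 2; field_simp
  · exact (((hw j).cont.comp continuous_fst).sub ((hw j).cont.comp continuous_snd)).enorm.measurable.aemeasurable
  · have t1 : ∀ x, x ∉ Γ → x ∈ ball Y R → Tendsto (fun j => φ x * χ j x * lg a (U x)) atTop (𝓝 (lg a (U x))) := fun x hx hb => by
      refine tendsto_const_nhds.congr' ?_
      have h0 := dl_pos h.closed h.ne hx
      have := (tendsto_one_div_add_atTop_nhds_zero_nat (𝕜 := ℝ)).eventually (gt_mem_nhds (half_pos h0))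
      filter_upwards [this] with j hj
      rw [φ1 x hb, χ1 j x (by linarith [η1 j])]; ring
    have a1 : ∀ᵐ x ∂(volume.restrict (ball Y R)), x ∉ Γ ∧ x ∈ ball Y R := (ae_restrict_of_ae ha.aeΩ).and (ae_restrict_mem msb)
    filter_upwards [Measure.quasiMeasurePreserving_fst.tendsto_ae.eventually a1, Measure.quasiMeasurePreserving_snd.tendsto_ae.eventually a1] with p h1 h2
    exact (continuous_enorm.tendsto _).comp ((t1 _ h1.1 h1.2).sub (t1 _ h2.1 h2.2))
  · refine ENNReal.Tendsto.const_mul (ENNReal.Tendsto.const_mul (ENNReal.Tendsto.const_mul ?_ (Or.inr (by finiteness))) (Or.inr measure_ball_lt_top.ne)) (Or.inr ont)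
    refine Tendsto.add_const _ ?_
    have := (tendsto_one_div_add_atTop_nhds_zero_nat (𝕜 := ℝ)).const_mul S
    rw [mul_zero] at this
    simpa using ENNReal.tendsto_ofReal this

theorem osc (d cA cB : ℝ) (hd0 : 0 < d) (hdn : d < (dimE : ℝ) - 1) (hC0 : 1 ≤ cA) :
    ∃ C : ℝ, 0 < C ∧ ∀ {Γ : Set E}, AR d cA Γ → ∀ {A B U G}, Core d cB Γ A B U G →
    ∀ {a : ℝ}, 0 < a → ∀ (Y : E) (R : ℝ), 0 < R → ball Y (9 * R / 8) ⊆ B → ∀ M : ℝ, (∀ x ∈ ball Y R, U x ≤ M) →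
    ∃ c : ℝ, ∫⁻ x in ball Y R, ofReal |lg a (U x) - c| ≤ ofReal (C * R ^ dimE) := by
  obtain ⟨C, hC, H⟩ := osc0 (E := E) d cA cB hd0 hdn hC0
  refine ⟨C, hC, fun {Γ} ha {A B U G} h {a} a0 Y R hR hB M hM => ?_⟩
  replace H := H ha h a0 Y R hR hB M hM
  have hv0 : volume (ball Y R) ≠ 0 := (measure_ball_pos _ _ hR).ne'
  have hvt : volume (ball Y R) ≠ ⊤ := measure_ball_lt_top.ne
  have hm : AEMeasurable (fun x => lg a (U x)) (volume.restrict (ball Y R)) :=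
    ((lg_d a0).1.continuous.measurable.comp_aemeasurable h.integ.1.aemeasurable).restrict
  have hm2 : AEMeasurable (fun p : E × E => ‖lg a (U p.1) - lg a (U p.2)‖ₑ) ((volume.restrict (ball Y R)).prod (volume.restrict (ball Y R))) :=
    ((hm.comp_fst).sub (hm.comp_snd)).enorm
  rw [lintegral_prod_symm _ hm2] at H
  obtain ⟨y, hy, h2⟩ := exists_le_setLAverage hv0 hvt hm2.lintegral_prod_left'
  refine ⟨lg a (U y), ?_⟩
  rw [setLAverage_eq, ENNReal.le_div_iff_mul_le (Or.inl hv0) (Or.inl hvt), mul_comm] at h2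
  have := (ENNReal.mul_le_mul_iff_right hv0 hvt).1 (h2.trans H)
  refine le_trans (le_of_eq ?_) this
  refine lintegral_congr fun x => ?_
  rw [← ofReal_norm_eq_enorm, norm_eq_abs]

theorem ubdd {d cA cB : ℝ} {Γ : Set E} (ha : AR d cA Γ) {A B U G} (h : Core d cB Γ A B U G) {xz : E} (hx₀ : xz ∈ Γ) {r : ℝ} (hr : 0 < r)
    (hB : ball xz (15 * r / 8) ⊆ B) : ∃ M : ℝ, ∀ x ∈ ball xz (5 * r / 3), U x ≤ M := by
  obtain ⟨c, hc, H⟩ := T1 (E := E) d cA cB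
  set n := dimE with hn
  set g := d + 1 - (n : ℝ) with hg
  have hI := h.hardyU ha
  set I := ∫⁻ x, ofReal (U x ^ 2 * dst x Γ ^ (-2 : ℝ) * wt d Γ x) with hId
  have eI : I = ofReal I.toReal := (ofReal_toReal hI.ne).symm
  have I0 : 0 ≤ I.toReal := ENNReal.toReal_nonneg
  set ρ := 5 * r / 24 with hρ
  have hρ0 : 0 < ρ := by positivity
  set Q := c * (ρ ^ n * (2 * r) ^ g) with hQ
  have hQ0 : 0 < Q := by positivity
  set t := ((2 * r) ^ 2 * I.toReal) / Q + 1 with ht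
  have ht0 : 0 < t := by positivity
  refine ⟨Real.sqrt t, fun X hX => ?_⟩
  by_cases hXΓ : X ∈ Γ
  · rw [h.zeroΓ X hXΓ]; positivity
  rw [mem_ball] at hX
  have hd1 : ∀ x ∈ ball X ρ, dist x xz < 15 * r / 8 := fun x hx => by
    rw [mem_ball] at hx; linarith [dist_triangle x X xz]
  have hd2 : ∀ x ∈ ball X ρ, dst x Γ ≤ 2 * r := fun x hx => (infDist_le_dist_of_mem hx₀).trans (by linarith [hd1 x hx])
  have := H ha h (s := 1) (k := 0) X ρ (Or.inl ⟨rfl, le_rfl⟩) hρ0 (fun x hx => hB (hd1 x hx)) (Real.sqrt t) pz ?_ X (mem_ball_self pz) hXΓ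
  · linarith
  calc _ ≤ ∫⁻ x in ball X ρ, ofReal ((2 * r) ^ 2) * ofReal (U x ^ 2 * dst x Γ ^ (-2 : ℝ) * wt d Γ x) := by
        refine setLIntegral_mono' msb fun x hx => ?_
        rw [← ofReal_mul pz]
        apply ole
        have hw := wt_nonneg (d := d) (Γ := Γ) x
        have hu := h.nonneg x
        rw [one_mul, sub_zero, max_eq_left hu]
        by_cases hxΓ : x ∈ Γ
        · rw [h.zeroΓ x hxΓ]; simp
        have h0 := dl_pos h.closed h.ne hxΓ
        have h1 := hd2 x hx
        have e : (1:ℝ) ≤ (2 * r) ^ 2 * dst x Γ ^ (-2 : ℝ) := by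
          rw [rpow_neg h0.le, Real.rpow_two, ← div_eq_mul_inv, one_le_div pz]; gcongr
        calc U x ^ 2 * wt d Γ x = 1 * (U x ^ 2 * wt d Γ x) := by ring
          _ ≤ ((2 * r) ^ 2 * dst x Γ ^ (-2 : ℝ)) * (U x ^ 2 * wt d Γ x) := by gcongr
          _ = _ := by ring
    _ ≤ ofReal ((2 * r) ^ 2) * I := by
        rw [lcm _ _ ont]; gcongr; exact setLIntegral_le_lintegral _ _
    _ = ofReal ((2 * r) ^ 2 * I.toReal) := by rw [eI, ← ofReal_mul pz, ENNReal.toReal_ofReal I0]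
    _ ≤ _ := by
        apply ole
        rw [Real.sq_sqrt ht0.le]
        have hm : max (dst X Γ) ρ ≤ 2 * r := max_le (hd2 X (mem_ball_self hρ0)) lz
        have h2 : (2 * r) ^ g ≤ max (dst X Γ) ρ ^ g := rnp (lt_max_of_lt_right hρ0) hm (by linarith [ha.dn])
        calc (2 * r) ^ 2 * I.toReal = (2 * r) ^ 2 * I.toReal / Q * Q := by field_simp
          _ ≤ t * Q := by gcongr; linarith
          _ = c * (t * ρ ^ n * (2 * r) ^ g) := by rw [hQ]; ring
          _ ≤ _ := by gcongr

theorem cdiff {f : E → ℝ} (hf : AEMeasurable f volume) {Y Y' : E} {R R' c c' C : ℝ} (hR : 0 < R) (hR' : 0 < R') (hC : 0 ≤ C) (hs : ball Y' R' ⊆ ball Y R)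
    (h : ∫⁻ x in ball Y R, ofReal |f x - c| ≤ ofReal (C * R ^ dimE))
    (h' : ∫⁻ x in ball Y' R', ofReal |f x - c'| ≤ ofReal (C * R' ^ dimE)) :
    |c' - c| ≤ C / vb E * (1 + (R / R') ^ dimE) := by
  set n := dimE with hn
  have hv := vb_pos (E := E)
  have e : ofReal |c' - c| * volume (ball Y' R') ≤ ofReal (C * R' ^ n) + ofReal (C * R ^ n) := by
    rw [← setLIntegral_const]
    calc _ ≤ ∫⁻ x in ball Y' R', (ofReal |f x - c'| + ofReal |f x - c|) := by
          refine lintegral_mono fun x => ?_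
          rw [← ofReal_add pz pz]
          apply ole
          rw [show c' - c = (f x - c) - (f x - c') by ring]
          linarith [abs_sub (f x - c) (f x - c')]
      _ = (∫⁻ x in ball Y' R', ofReal |f x - c'|) + ∫⁻ x in ball Y' R', ofReal |f x - c| := by
          refine lintegral_add_left' ?_ _
          have := hf.restrict (s := ball Y' R')
          have h2 : AEMeasurable (fun x => |f x - c'|) (volume.restrict (ball Y' R')) := continuous_abs.measurable.comp_aemeasurable (this.sub_const c')
          exact h2.ennreal_ofReal
      _ ≤ _ := add_le_add h' ((lintegral_mono_set hs).trans h)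
  rw [vol_b _ hR', ← ofReal_add pz pz, ← ofReal_mul pz,
    ofReal_le_ofReal_iff pz, ← le_div_iff₀ pz] at e
  refine e.trans (le_of_eq ?_)
  rw [div_pow, hn]; field_simp

theorem tele (d cA cB : ℝ) (hd0 : 0 < d) (hdn : d < (dimE : ℝ) - 1) (hC0 : 1 ≤ cA) :
    ∃ T : ℝ, 0 < T ∧ ∀ {Γ : Set E}, AR d cA Γ → ∀ {A B U G}, Core d cB Γ A B U G →
    ∀ {xz : E}, xz ∈ Γ → ∀ {r : ℝ}, 0 < r → ball xz (15 * r / 8) ⊆ B → ∀ {a : ℝ}, 0 < a → ∃ cz : ℝ, ∀ Y ∈ ball xz (5 * r / 4), ∀ i : ℕ,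
    ∫⁻ x in ball Y (r / 8 / 2 ^ i), ofReal |lg a (U x) - cz| ≤ ofReal (T * (i + 1) * (r / 8 / 2 ^ i) ^ dimE) := by
  set n := dimE with hn
  obtain ⟨C, hC, H⟩ := osc (E := E) d cA cB hd0 hdn hC0
  have hv := vb_pos (E := E)
  set S := C / vb E * (1 + 14 ^ n) with hS
  have hS0 : 0 < S := by positivity
  refine ⟨C + S * vb E, by positivity, fun {Γ} ha {A B U G} h {xz} hx₀ {r} hr hB {a} a0 => ?_⟩
  obtain ⟨M, hM⟩ := ubdd ha h hx₀ hr hB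
  have hf : AEMeasurable (fun x => lg a (U x)) volume := (lg_d a0).1.continuous.measurable.comp_aemeasurable h.integ.1.aemeasurable
  obtain ⟨cz, hc₀⟩ := H ha h a0 xz (5 * r / 3) pz (by rwa [show 9 * (5 * r / 3) / 8 = 15 * r / 8 by ring]) M hM
  refine ⟨cz, fun Y hY => ?_⟩
  rw [mem_ball] at hY
  have hRi : ∀ i : ℕ, 0 < r / 8 / 2 ^ i ∧ r / 8 / 2 ^ i ≤ r / 8 := fun i => ⟨by positivity, div_le_self pz (one_le_pow₀ nz)⟩
  have hsub : ∀ i : ℕ, ball Y (r / 8 / 2 ^ i) ⊆ ball xz (5 * r / 3) := fun i => ball_subset_ball' (by linarith [(hRi i).2])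
  have hex : ∀ i : ℕ, ∃ c : ℝ, ∫⁻ x in ball Y (r / 8 / 2 ^ i), ofReal |lg a (U x) - c| ≤ ofReal (C * (r / 8 / 2 ^ i) ^ n) := fun i =>
    H ha h a0 Y _ (hRi i).1 ((ball_subset_ball' (by linarith [(hRi i).2])).trans hB) M (fun x hx => hM x (hsub i hx))
  choose c hc using hex
  have hb : ∀ i : ℕ, |c i - cz| ≤ S * (i + 1) := fun i => by
    induction i with
    | zero =>
      have := cdiff hf pz (hRi 0).1 hC.le (hsub 0) hc₀ (hc 0)
      refine this.trans ?_
      rw [hS]; push_cast; rw [zero_add, mul_one, ← hn]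
      have e : 5 * r / 3 / (r / 8 / 2 ^ 0) ≤ 14 := by rw [pow_zero, div_one, div_le_iff₀ pz]; linarith
      gcongr
    | succ i ih =>
      have e : r / 8 / 2 ^ i / (r / 8 / 2 ^ (i + 1)) = 2 := by rw [pow_succ]; field_simp
      have := cdiff hf (hRi i).1 (hRi (i+1)).1 hC.le (bsb (by rw [pow_succ]; gcongr; linarith [pow_pos (two_pos : (0:ℝ) < 2) i])) (hc i) (hc (i+1))
      rw [e] at this
      have h2 : C / vb E * (1 + 2 ^ n) ≤ S := by rw [hS]; gcongr; norm_num
      have h3 := abs_sub_le (c (i+1)) (c i) cz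
      push_cast; linarith
  intro i
  have hR := (hRi i).1
  calc _ ≤ ∫⁻ x in ball Y (r / 8 / 2 ^ i), (ofReal |lg a (U x) - c i| + ofReal (S * (i + 1))) := by
        refine lintegral_mono fun x => ?_
        rw [← ofReal_add pz pz]
        apply ole
        linarith [abs_sub_le (lg a (U x)) (c i) cz, hb i]
    _ = (∫⁻ x in ball Y (r / 8 / 2 ^ i), ofReal |lg a (U x) - c i|) + ofReal (S * (i + 1)) * volume (ball Y (r / 8 / 2 ^ i)) := by
        rw [lintegral_add_right _ measurable_const, setLIntegral_const]
    _ ≤ ofReal (C * (r / 8 / 2 ^ i) ^ n) + ofReal (S * (i + 1)) * volume (ball Y (r / 8 / 2 ^ i)) := by gcongr; exact hc i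
    _ ≤ _ := by
        rw [vol_b _ hR, ← ofReal_mul pz, ← ofReal_add pz pz]
        apply ole
        have : C * (r / 8 / 2 ^ i) ^ n ≤ C * (i + 1) * (r / 8 / 2 ^ i) ^ n := by
          gcongr; exact le_mul_of_one_le_right hC.le (by linarith [(Nat.cast_nonneg i : (0:ℝ) ≤ i)])
        rw [← hn]; nlinarith

theorem ws (d cA : ℝ) (hd0 : 0 < d) (hdn : d < (dimE : ℝ) - 1) (hC0 : 1 ≤ cA) {κ : ℝ} (hκ : 0 < κ) :
    ∃ θ : ℝ, 0 < θ ∧ ∀ {Γ : Set E}, AR d cA Γ → ∀ (X : E) (ρ : ℝ), 0 < ρ → ∀ S ⊆ ball X ρ,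
    volume S ≤ ofReal (θ * ρ ^ dimE) →
    ∫⁻ x in S, ofReal (wt d Γ x) ≤
      ofReal (κ * (ρ ^ dimE * max (dst X Γ) ρ ^ (d + 1 - (dimE : ℝ)))) := by
  set n := dimE with hn
  set g := d + 1 - (n : ℝ) with hg
  obtain ⟨C, hC, H⟩ := wt_int (E := E) d cA (1 / 2 - g) hd0 hC0 lz (by rw [← hn]; linarith)
  set s := (κ / (2 * C)) ^ 2 with hs
  have hs0 : 0 < s := by positivity
  refine ⟨κ / 2 * s ^ (-g), by positivity, fun {Γ} ha X ρ hρ S hS hv => ?_⟩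
  set D := max (dst X Γ) ρ with hD
  have D0 : 0 < D := lt_max_of_lt_right hρ
  have hw := H ha X ρ hρ
  have hsq : (s * D) ^ (1/2:ℝ) = κ / (2 * C) * D ^ (1/2:ℝ) := by
    rw [mul_rpow hs0.le D0.le, hs, ← rpow_natCast, ← rpow_mul pz]; norm_num
  calc _ ≤ ∫⁻ x in S, (ofReal ((s * D) ^ g) + ofReal ((s * D) ^ (1/2:ℝ)) * ofReal (dst x Γ ^ (-(1 / 2 - g)))) := by
        refine lintegral_mono_ae (ae_restrict_of_ae ?_)
        filter_upwards [ha.aeΩ] with x hx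
        have h0 := dl_pos ha.closed ha.ne hx
        rw [← ofReal_mul pz, ← ofReal_add pz pz]
        apply ole
        change dst x Γ ^ g ≤ _
        rcases le_total (s * D) (dst x Γ) with h1 | h1
        · have := rnp pz h1 (show g ≤ 0 by linarith)
          have : 0 ≤ (s * D) ^ (1/2:ℝ) * dst x Γ ^ (-(1 / 2 - g)) := by positivity
          linarith
        · have e : dst x Γ ^ g = dst x Γ ^ (1/2:ℝ) * dst x Γ ^ (-(1 / 2 - g)) := by rw [← rpow_add h0]; ring_nf
          have := Real.rpow_le_rpow h0.le h1 (show (0:ℝ) ≤ 1/2 by norm_num)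
          have h3 : dst x Γ ^ g ≤ (s * D) ^ (1/2:ℝ) * dst x Γ ^ (-(1 / 2 - g)) := by rw [e]; gcongr
          have : 0 ≤ (s * D) ^ g := by positivity
          linarith
    _ = ofReal ((s * D) ^ g) * volume S + ofReal ((s * D) ^ (1/2:ℝ)) * ∫⁻ x in S, ofReal (dst x Γ ^ (-(1 / 2 - g))) := by
        rw [lintegral_add_left measurable_const, setLIntegral_const, lcm _ _ ont]
    _ ≤ ofReal ((s * D) ^ g) * ofReal (κ / 2 * s ^ (-g) * ρ ^ n) + ofReal ((s * D) ^ (1/2:ℝ)) * ofReal (C * ρ ^ n * D ^ (-(1 / 2 - g))) := by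
        gcongr; exact (lintegral_mono_set hS).trans hw
    _ = _ := by
        rw [← ofReal_mul pz, ← ofReal_mul pz, ← ofReal_add pz pz]
        congr 1
        have e1 : s ^ g * s ^ (-g) = 1 := by rw [← rpow_add hs0]; simp
        have e2 : D ^ (1/2:ℝ) * D ^ (-(1 / 2 - g)) = D ^ g := by rw [← rpow_add D0]; ring_nf
        rw [hsq, mul_rpow hs0.le D0.le]
        calc _ = (s ^ g * s ^ (-g)) * D ^ g * (κ / 2) * ρ ^ n + κ / (2 * C) * C * ρ ^ n * (D ^ (1/2:ℝ) * D ^ (-(1 / 2 - g))) := by ring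
          _ = _ := by rw [e1, e2]; field_simp; ring

theorem growth (d cA cB : ℝ) (hd0 : 0 < d) (hdn : d < (dimE : ℝ) - 1) (hC0 : 1 ≤ cA) :
    ∃ θ : ℝ, 0 < θ ∧ ∀ {Γ : Set E}, AR d cA Γ → ∀ {A B U G}, Core d cB Γ A B U G →
    ∀ {s : ℝ} (X : E) (ρ M : ℝ), (s = 1) ∨ (s = -1 ∧ 2 * ρ ≤ dst X Γ) → 0 < ρ → ball X ρ ⊆ B → 0 < M → X ∉ Γ →
    (∀ x ∈ ball X ρ, U x ≤ 4 * M ∨ s = -1) → volume {x | x ∈ ball X ρ ∧ 0 < s * (U x - M)} ≤ ofReal (θ * ρ ^ dimE) →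
    s * (U X - M) ≤ M / 2 := by
  obtain ⟨c, hc, H⟩ := T1 (E := E) d cA cB
  obtain ⟨θ, hθ, W⟩ := ws (E := E) d cA hd0 hdn hC0 (κ := c / 64) pz
  refine ⟨θ, hθ, fun {Γ} ha {A B U G} h {s} X ρ M hs hρ hB hM hX hU hv => ?_⟩
  refine H ha h (k := M) X ρ (hs.imp (fun e => ⟨e, hM.le⟩) id) hρ hB (M / 2) pz ?_ X (mem_ball_self pz) hX
  have h1 := W ha X ρ hρ _ (fun x hx => hx.1) hv
  set S := {x | x ∈ ball X ρ ∧ 0 < s * (U x - M)} with hS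
  have hSm : NullMeasurableSet S volume := by
    have : AEMeasurable (fun x => s * (U x - M)) volume := (h.integ.1.aemeasurable.sub_const M).const_mul s
    exact measurableSet_ball.nullMeasurableSet.inter (nullMeasurableSet_lt aemeasurable_const this)
  calc _ ≤ ∫⁻ x, S.indicator (fun x => ofReal (16 * M ^ 2) * ofReal (wt d Γ x)) x := by
        rw [← lintegral_indicator msb]
        refine lintegral_mono fun x => ?_
        by_cases hx : x ∈ ball X ρ
        · rw [iom hx]
          rcases le_or_gt (s * (U x - M)) 0 with h0 | h0
          · rw [max_eq_right h0]; simp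
          · rw [iom (show x ∈ S from ⟨hx, h0⟩), ← ofReal_mul pz, max_eq_left h0.le]
            apply ole
            have := wt_nonneg (d := d) (Γ := Γ) x
            have hu := h.nonneg x
            have e : s * (U x - M) ≤ 4 * M := by
              rcases hs with e | e
              · rcases hU x hx with h2 | h2
                · rw [e]; linarith
                · linarith
              · rw [e.1]; linarith
            gcongr
            nlinarith
        · rw [ion hx]; exact zero_le
    _ = ofReal (16 * M ^ 2) * ∫⁻ x in S, ofReal (wt d Γ x) := by
        rw [lintegral_indicator₀ hSm, lcm _ _ ont]
    _ ≤ _ := (mlr h1 _).trans (le_of_eq (by rw [← ofReal_mul pz]; congr 1; ring))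

theorem seqi (m : ℕ) (hm : 0 < m) : ∃ N : ℕ, ∀ j : ℕ, ((j:ℝ) + 1) * (j + 2) ≤ 2 ^ (j / m + N) := by
  have hk : ∀ k : ℕ, (k + 1) ^ 2 ≤ 4 * 2 ^ k := fun k => by
    induction k with
    | zero => norm_num
    | succ k ih =>
      rcases k with _ | _ | k
      · norm_num
      · norm_num
      · have : (k + 1 + 1 + 1 + 1) ^ 2 ≤ 2 * (k + 1 + 1 + 1) ^ 2 := by ring_nf; omega
        rw [pow_succ 2 (k + 1 + 1)]; omega
  refine ⟨16 * m ^ 2, fun j => ?_⟩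
  have h1 : j + 1 ≤ m * (j / m + 1) := Nat.lt_mul_div_succ j hm
  set k := j / m
  have h2 : 16 * m ^ 2 ≤ 2 ^ (16 * m ^ 2) := Nat.lt_two_pow_self.le
  have h3 : (j + 1) * (j + 2) ≤ 2 ^ (k + 16 * m ^ 2) := by
    rw [pow_add]
    calc (j + 1) * (j + 2) ≤ (2 * (m * (k + 1))) ^ 2 := by nlinarith
      _ = 4 * m ^ 2 * (k + 1) ^ 2 := by ring
      _ ≤ 4 * m ^ 2 * (4 * 2 ^ k) := by gcongr; exact hk k
      _ = 2 ^ k * (16 * m ^ 2) := by ring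
      _ ≤ _ := by gcongr
  exact_mod_cast h3

theorem main4 (d cA cB ε : ℝ) (hd0 : 0 < d) (hdn : d < (dimE : ℝ) - 1) (hC0 : 1 ≤ cA) (hε : 0 < ε) :
    ∃ C : ℝ, 0 < C ∧ ∀ {Γ : Set E}, AR d cA Γ → ∀ {A B U G}, Core d cB Γ A B U G →
    ∀ {xz : E}, xz ∈ Γ → ∀ {r : ℝ}, 0 < r → ball xz (15 * r / 8) ⊆ B → ∀ Xz : E, dist Xz xz ≤ r → ε * r ≤ dst Xz Γ →
    ∀ X ∈ ball xz r, U X ≤ C * U Xz := by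
  set n := dimE with hn
  obtain ⟨T, hT, HT⟩ := tele (E := E) d cA cB hd0 hdn hC0
  obtain ⟨θ, hθ, HG⟩ := growth (E := E) d cA cB hd0 hdn hC0
  have hl2 : 0 < log 2 := Real.log_pos nz
  obtain ⟨m, hm⟩ := exists_nat_gt (T / (θ * log 2))
  have hm0 : 0 < m := by
    have : (0:ℝ) < m := lt_of_le_of_lt pz hm
    exact_mod_cast this
  have hm0' : (0:ℝ) < m := by exact_mod_cast hm0
  rw [div_lt_iff₀ pz] at hm
  obtain ⟨N, hN⟩ := seqi m hm0
  obtain ⟨iz, hi₀⟩ := exists_pow_lt_of_lt_one (show 0 < 4 * ε by positivity) (show (1/2:ℝ) < 1 by norm_num)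
  set Cs := log 2 + T * (N + 1) / θ with hCs
  set Cl := T * (iz + 1) / θ with hCl
  have hCl0 : 0 < Cl := by positivity
  set Q := 4 * Real.exp (Cs + Cl) with hQ
  have hQ0 : 0 < Q := by positivity
  refine ⟨Q, hQ0, fun {Γ} ha {A B U G} h {xz} hx₀ {r} hr hB Xz hX₀ hX₀' X hX => ?_⟩
  have key : ∀ a : ℝ, 0 < a → U X ≤ Q * (U Xz + a) := fun a a0 => by
    obtain ⟨cz, hc⟩ := HT ha h hx₀ hr hB a0
    have chb : ∀ Y ∈ ball xz (5 * r / 4), ∀ (i : ℕ) (S : Set E) (l : ℝ), 0 < l → T * (i + 1) ≤ θ * l → (∀ x ∈ S, x ∈ ball Y (r / 8 / 2 ^ i) ∧ l ≤ |lg a (U x) - cz|) →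
        volume S ≤ ofReal (θ * (r / 8 / 2 ^ i) ^ n) := fun Y hY i S l hl hle hS => by
      have hf : AEMeasurable (fun x => lg a (U x)) volume := (lg_d a0).1.continuous.measurable.comp_aemeasurable h.integ.1.aemeasurable
      have hf2 : AEMeasurable (fun x => |lg a (U x) - cz|) volume := continuous_abs.measurable.comp_aemeasurable (hf.sub_const cz)
      refine (cheb hl msb hf2.ennreal_ofReal.restrict (aoa _ fun x hx => ⟨(hS x hx).1, ole (hS x hx).2⟩) (hc Y hY i)).trans ?_
      apply ole
      rw [div_le_iff₀ hl]
      calc _ ≤ (θ * l) * (r / 8 / 2 ^ i) ^ n := by gcongr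
        _ = _ := by ring
    have hRi : ∀ i : ℕ, 0 < r / 8 / 2 ^ i ∧ r / 8 / 2 ^ i ≤ r / 8 := fun i => ⟨by positivity, div_le_self pz (one_le_pow₀ nz)⟩
    have hsub : ∀ Y ∈ ball xz (5 * r / 4), ∀ i : ℕ, ball Y (r / 8 / 2 ^ i) ⊆ B := fun Y hY i => by
      rw [mem_ball] at hY
      exact (ball_subset_ball' (by linarith [(hRi i).2])).trans hB
    have lgl : ∀ x : E, 0 < U x → log (U x) ≤ lg a (U x) := fun x hx => by
      have : log (U x ^ 2) ≤ log (a ^ 2 + U x ^ 2) := Real.log_le_log pz (by linarith [sq_nonneg a])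
      rw [Real.log_pow] at this; push_cast at this
      unfold lg; linarith
    have up : U X ≤ Real.exp (cz + Cs) := by
      by_contra hlt
      rw [not_le] at hlt
      set M := Real.exp (cz + Cs) with hM
      have M0 : 0 < M := Real.exp_pos _
      have hind : ∀ j : ℕ, ∃ Z : E, dist Z xz ≤ r + r / 4 * (1 - 1 / ((j:ℝ) + 1)) ∧ 2 ^ j * M ≤ U Z := fun j => by
        induction j with
        | zero => exact ⟨X, by simpa using (mem_ball.1 hX).le, by simpa using hlt.le⟩
        | succ j ih =>
          obtain ⟨Z, hZ, hUZ⟩ := ih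
          have j0 : (0:ℝ) < (j:ℝ) + 1 := by positivity
          have hZb : Z ∈ ball xz (5 * r / 4) := by
            rw [mem_ball]
            have : 0 < r / 4 * (1 / ((j:ℝ) + 1)) := by positivity
            nlinarith
          by_contra hno
          push Not at hno
          set i := j / m + N with hi
          have hρ : r / 8 / 2 ^ i ≤ r / 4 * (1 / (j + 1) - 1 / ((j:ℝ) + 1 + 1)) := by
            have e : 1 / ((j:ℝ) + 1) - 1 / ((j:ℝ) + 1 + 1) = 1 / (((j:ℝ) + 1) * (j + 2)) := by field_simp; ring
            rw [e]
            calc r / 8 / 2 ^ i ≤ r / 8 / ((j + 1) * (j + 2)) := by gcongr; exact hN j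
              _ = (r / 8) * (1 / (((j:ℝ) + 1) * (j + 2))) := by ring
              _ ≤ _ := by gcongr; norm_num
          have hb : ∀ x ∈ ball Z (r / 8 / 2 ^ i), U x ≤ 2 * (2 ^ j * M) := fun x hx => by
            have := hno x ?_
            · rw [pow_succ] at this; linarith
            · rw [mem_ball] at hx
              push_cast
              linarith [dist_triangle x Z xz]
          have hMj : 0 < 2 ^ j * M / 2 := by positivity
          have hZΓ : Z ∉ Γ := fun h1 => by rw [h.zeroΓ Z h1] at hUZ; linarith
          have := HG ha h (s := 1) Z (r / 8 / 2 ^ i) (2 ^ j * M / 2) (Or.inl rfl) (hRi i).1 (hsub Z hZb i) hMj hZΓ (fun x hx => Or.inl (by linarith [hb x hx])) ?_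
          · linarith
          refine chb Z hZb i _ (j * log 2 + T * (N + 1) / θ) pz ?_ fun x hx => ⟨hx.1, ?_⟩
          · have e : (i : ℝ) ≤ j / m + N := by rw [hi]; push_cast; gcongr; exact Nat.cast_div_le
            calc T * (i + 1) ≤ T * (j / m + N + 1) := by gcongr
              _ = j * (T / m) + T * (N + 1) := by ring
              _ ≤ j * (θ * log 2) + T * (N + 1) := by gcongr; rw [div_le_iff₀ hm0']; linarith
              _ = _ := by field_simp
          · have h1 : 2 ^ j * M / 2 < U x := by linarith [hx.2]
            have h2 := lgl x lz
            have h3 := Real.log_le_log hMj h1.le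
            rw [Real.log_div pz nz, Real.log_mul pz pz, Real.log_pow, hM, Real.log_exp, hCs] at h3
            refine le_trans ?_ (le_abs_self _)
            linarith
      obtain ⟨Mb, hMb⟩ := ubdd ha h hx₀ hr hB
      obtain ⟨j, hj⟩ := pow_unbounded_of_one_lt (Mb / M) (one_lt_two (α := ℝ))
      rw [div_lt_iff₀ M0] at hj
      obtain ⟨Z, h1, h2⟩ := hind j
      have := hMb Z (by
        rw [mem_ball]
        have : 0 < r / 4 * (1 / ((j:ℝ) + 1)) := by positivity
        nlinarith)
      linarith
    set k := Real.exp (cz - Cl) / 2 with hk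
    have k0 : 0 < k := by positivity
    have e : Real.exp (cz + Cs) = 2 * k * Real.exp (Cs + Cl) := by rw [hk, mul_div_cancel₀ _ nz, ← Real.exp_add]; ring_nf
    have hlow : k / 2 ≤ U Xz + a := by
      rcases le_or_gt k a with hka | hka
      · linarith [h.nonneg Xz]
      have hXb : Xz ∈ ball xz (5 * r / 4) := by rw [mem_ball]; linarith
      have hε2 : 2 * (r / 8 / 2 ^ iz) ≤ dst Xz Γ := by
        refine le_trans ?_ hX₀'
        rw [one_div, inv_pow] at hi₀
        have : r / 4 * (2 ^ iz)⁻¹ ≤ r / 4 * (4 * ε) := by gcongr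
        calc _ = r / 4 * (2 ^ iz)⁻¹ := by ring
          _ ≤ _ := by linarith
      have hXΓ : Xz ∉ Γ := fun h1 => by
        rw [infDist_zero_of_mem h1] at hX₀'; have : 0 < ε * r := by positivity
        linarith
      have := HG ha h (s := -1) Xz (r / 8 / 2 ^ iz) k (Or.inr ⟨rfl, hε2⟩) (hRi iz).1 (hsub Xz hXb iz) k0 hXΓ (fun x hx => Or.inr rfl) ?_
      · linarith
      refine chb Xz hXb iz _ Cl hCl0 (by rw [hCl]; apply le_of_eq; field_simp) fun x hx => ⟨hx.1, ?_⟩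
      have h1 : U x < k := by linarith [hx.2]
      have h0 := h.nonneg x
      have h2 : log (a ^ 2 + U x ^ 2) ≤ log ((2 * k) ^ 2) := Real.log_le_log pz (by nlinarith)
      rw [Real.log_pow, hk, mul_div_cancel₀ _ nz, Real.log_exp] at h2
      push_cast at h2
      refine le_trans ?_ (neg_le_abs _)
      unfold lg; linarith
    calc U X ≤ 2 * k * Real.exp (Cs + Cl) := by rw [← e]; exact up
      _ = Q * (k / 2) := by rw [hQ]; ring
      _ ≤ _ := by gcongr
  refine le_of_forall_pos_le_add fun t ht => ?_
  have := key (t / Q) pz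
  rwa [mul_add, mul_div_cancel₀ _ hQ0.ne'] at this

theorem grad_off {ψ : E → ℝ} {x : E} (hx : x ∉ tsupport ψ) : gradient ψ x = 0 := by
  refine grad_loc_const (c := 0) ?_
  filter_upwards [(isClosed_tsupport ψ).isOpen_compl.mem_nhds hx] with y hy using offs hy

theorem off_int {F : Type*} [NormedAddCommGroup F] [NormedSpace ℝ F] {ψ : E → ℝ} {O : Set E} (h : tsupport ψ ⊆ O) {f : E → F}
    (hf : ∀ x ∉ tsupport ψ, f x = 0) : ∫ x in O, f x = ∫ x, f x :=
  setIntegral_eq_integral_of_forall_compl_eq_zero fun x hx => hf x fun h1 => hx (h h1)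

theorem int_ug {u : E → ℝ} {O : Set E} (hu : LocallyIntegrableOn u O volume) {ψ : E → ℝ} (h1 : ContDiff ℝ (⊤:ℕ∞) ψ) (h2 : Hcs ψ)
    (h3 : tsupport ψ ⊆ O) : Integrable fun x => u x • gradient ψ x := by
  have h4 := ((hu.mono_set h3).integrableOn_isCompact h2).smul_continuousOn (grad_cont h1).continuousOn h2
  exact h4.integrable_of_forall_notMem_eq_zero fun x hx => by rw [grad_off hx, smul_zero]

theorem solG {V O : Set E} (hV : IsOpen V) (hO : IsOpen O) (hVO : V ⊆ O) {u : E → ℝ} {v G : E → E} {A : E → E →L[ℝ] E} (hu : LocallyIntegrableOn u O volume)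
    (hv : ∀ φ : E → ℝ, ContDiff ℝ (⊤:ℕ∞) φ → Hcs φ → tsupport φ ⊆ O → ∫ x, u x • gradient φ x = -∫ x, φ x • v x)
    (hG : ∀ φ : E → ℝ, ContDiff ℝ (⊤:ℕ∞) φ → Hcs φ → tsupport φ ⊆ V → ∫ x, u x • gradient φ x = -∫ x, φ x • G x)
    (hGl : LocallyIntegrableOn G V volume)
    (hs : ∀ φ : E → ℝ, ContDiff ℝ (⊤:ℕ∞) φ → Hcs φ → tsupport φ ⊆ O → ∫ x, inner ℝ (A x (v x)) (gradient φ x) = 0) :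
    ∀ φ : E → ℝ, ContDiff ℝ (⊤:ℕ∞) φ → Hcs φ → tsupport φ ⊆ V → ∫ x, inner ℝ (A x (G x)) (gradient φ x) = 0 := by
  intro φ f1 f2 f3
  by_cases hvl : LocallyIntegrableOn v O volume
  · have hvl' := hvl.mono_set hVO
    have ae : ∀ᵐ x, x ∈ V → G x - v x = 0 := by
      refine hV.ae_eq_zero_of_integral_contDiff_smul_eq_zero (hGl.sub hvl') fun ψ p1 p2 p3 => ?_
      have i1 : ∀ {w : E → E}, LocallyIntegrableOn w V volume → Integrable fun x => ψ x • w x := fun {w} hw =>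
        (((hw.mono_set p3).integrableOn_isCompact p2).continuousOn_smul p1.continuous.continuousOn p2).integrable_of_forall_notMem_eq_zero
          fun x hx => by rw [offs hx, zero_smul]
      have e1 := hv ψ p1 p2 (p3.trans hVO)
      have e2 := hG ψ p1 p2 p3
      have e3 : ∫ x, ψ x • (G x - v x) = (∫ x, ψ x • G x) - ∫ x, ψ x • v x := by
        rw [← integral_sub (i1 hGl) (i1 hvl')]; simp only [smul_sub]
      change ∫ x, ψ x • (G x - v x) = 0
      rw [e3, sub_eq_zero]; rw [e1] at e2; exact (neg_injective e2).symm
    rw [← hs φ f1 f2 (f3.trans hVO)]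
    refine integral_congr_ae ?_
    filter_upwards [ae] with x hx
    by_cases h1 : x ∈ tsupport φ
    · rw [sub_eq_zero.1 (hx (f3 h1))]
    · rw [grad_off h1, inner_zero_right, inner_zero_right]
  · unfold LocallyIntegrableOn at hvl
    push Not at hvl
    obtain ⟨p, hp, hpn⟩ := hvl
    have z1 : ∀ ψ : E → ℝ, ContDiff ℝ (⊤:ℕ∞) ψ → Hcs ψ → tsupport ψ ⊆ O → (∀ᶠ x in 𝓝 p, ψ x = 1) → ∫ x, u x • gradient ψ x = 0 := fun ψ p1 p2 p3 p4 => by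
      rw [hv ψ p1 p2 p3, integral_undef, neg_zero]
      intro hi
      refine hpn ⟨{x | ψ x = 1}, mem_nhdsWithin_of_mem_nhds p4, ?_⟩
      have : IntegrableOn (fun x => ψ x • v x) {x | ψ x = 1} volume := hi.integrableOn
      exact this.congr_fun (fun x hx => by dsimp only; rw [show ψ x = 1 from hx, one_smul]) (p1.continuous.measurable (measurableSet_singleton 1))
    obtain ⟨χ, c1, c2, c3, c4, c5⟩ := exists_cutoff (isCompact_singleton (x := p)) hO (singleton_subset_iff.2 hp)
    rw [nhdsSet_singleton] at c4
    have ae : ∀ᵐ x, x ∈ V \ {p} → G x = 0 := by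
      refine (hV.sdiff isClosed_singleton).ae_eq_zero_of_integral_contDiff_smul_eq_zero (hGl.mono_set diff_subset) fun ψ p1 p2 p3 => ?_
      have p4 := p3.trans diff_subset
      have e0 := hG ψ p1 p2 p4
      have e1 := z1 χ c1 c2 c3 c4
      have hpp : p ∉ tsupport ψ := fun h => (p3 h).2 rfl
      have e2 := z1 (fun x => ψ x + χ x) (p1.add c1) (p2.add c2) ((tsupport_add ψ χ).trans (union_subset (p4.trans hVO) c3)) (by
        filter_upwards [c4, (isClosed_tsupport ψ).isOpen_compl.mem_nhds hpp] with x h1 h2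
        rw [h1, offs h2, zero_add])
      have e3 : ∀ x, gradient (fun x => ψ x + χ x) x = gradient ψ x + gradient χ x := fun x => by
        unfold gradient
        rw [fderiv_fun_add (p1.differentiable sz x) (c1.differentiable sz x), map_add]
      simp only [e3, smul_add] at e2
      rw [integral_add (int_ug hu p1 p2 (p4.trans hVO)) (int_ug hu c1 c2 c3), e1, add_zero] at e2
      rw [e2] at e0
      exact neg_eq_zero.1 e0.symm
    rw [← integral_zero E ℝ (μ := volume)]
    refine integral_congr_ae ?_
    by_cases hV1 : Nontrivial E
    · filter_upwards [ae, Measure.ae_ne volume p] with x hx hxp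
      by_cases h1 : x ∈ tsupport φ
      · rw [hx ⟨f3 h1, hxp⟩, map_zero, inner_zero_left]
      · rw [grad_off h1, inner_zero_right]
    · rw [not_nontrivial_iff_subsingleton] at hV1
      exact aoa _ fun x => by dsimp only; rw [Subsingleton.elim (gradient φ x) 0, inner_zero_right]


theorem euc_inner {n : ℕ} (x y : Euc n) : ∑ i, x i * y i = inner ℝ x y := by simp [PiLp.inner_apply, mul_comm]

theorem core_of {n : ℕ} {d cA cB : ℝ} (hd0 : 0 < d) (hC₁ : 1 ≤ cB) {Γ : Set (Euc n)} (ar : AR d cA Γ) {A : Euc n → Euc n →L[ℝ] Euc n} (hA : AEStronglyMeasurable A volume)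
    (hell : EllipticOn n d Γ A cB) {xz : Euc n} {r : ℝ} {φ : Euc n → ℝ} (f1 : ContDiff ℝ (⊤:ℕ∞) φ) (f2 : Hcs φ) (f3 : tsupport φ ⊆ ball xz (2 * r))
    (f5 : ∀ x, φ x ∈ Icc (0:ℝ) 1) (f6 : ∀ x ∈ ball xz (15 * r / 8), φ x = 1) {u uc : Euc n → ℝ} {v w : Euc n → Euc n}
    (hu : LocallyIntegrableOn u (ball xz (2 * r)) volume) (hw : MemW n d Γ (fun x => φ x * u x) w) (hgr : IsDistribGradOn u v (ball xz (2 * r) \ Γ))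
    (hpos : ∀ᵐ y ∂(volume.restrict (ball xz (2 * r) \ Γ)), 0 ≤ u y) (hsol : SolOn Γ A v (ball xz (2 * r) \ Γ))
    (htr : ∀ᵐ z ∂(μH[d].restrict (Γ ∩ ball xz (2 * r))), HasTraceAt u z 0) (huc : ContinuousOn uc (ball xz (2 * r) \ Γ))
    (hae : ∀ᵐ y ∂(volume.restrict (ball xz (2 * r) \ Γ)), uc y = u y) :
    Core d cB Γ A (ball xz (15 * r / 8)) ((ball xz (2 * r) \ Γ).indicator fun x => φ x * uc x) (Γᶜ.indicator w) := by
  set O := ball xz (2 * r) \ Γ with hO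
  have Oo : IsOpen O := isOpen_ball.sdiff ar.closed
  have Γo : IsOpen Γᶜ := ar.closed.isOpen_compl
  have hwt : ∀ x, wt d Γ x = weightW n d Γ x := fun x => by simp [wt, weightW]
  rw [ae_restrict_iff' Oo.measurableSet] at hpos hae
  set U := O.indicator fun x => φ x * uc x with hU
  have hphi0 : ∀ x ∉ ball xz (2 * r), φ x = 0 := fun x hx => offs fun h => hx (f3 h)
  have hU0 : ∀ x, φ x = 0 → U x = 0 := fun x hx => by
    classical rw [hU, indicator_apply, hx, zero_mul, ite_self]
  have hUae : ∀ᵐ x, U x = φ x * u x := by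
    filter_upwards [hae, ar.aeΩ] with x h1 h2
    by_cases hx : x ∈ ball xz (2 * r)
    · rw [hU, iom (show x ∈ O from ⟨hx, h2⟩), h1 ⟨hx, h2⟩]
    · rw [hU, ion (fun h : x ∈ O => hx h.1), hphi0 x hx, zero_mul]
  have hucpos : ∀ x ∈ O, 0 ≤ uc x := fun x hx => by
    by_contra hlt
    rw [not_le] at hlt
    have h1 : ∀ᶠ y in 𝓝 x, uc y < 0 ∧ y ∈ O := ((huc.continuousAt (Oo.mem_nhds hx)).eventually (gt_mem_nhds hlt)).and (Oo.mem_nhds hx)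
    have h2 : volume {y | uc y < 0 ∧ y ∈ O} = 0 := by
      rw [measure_eq_zero_iff_ae_notMem]
      filter_upwards [hpos, hae] with y h3 h4 h5
      linarith [h3 h5.2, h4 h5.2, h5.1]
    exact (Measure.measure_pos_of_mem_nhds volume h1).ne' h2
  have hint : Integrable (fun x => φ x * u x) volume :=
    (((hu.mono_set f3).integrableOn_isCompact f2).continuousOn_mul f1.continuous.continuousOn f2).integrable_of_forall_notMem_eq_zero
      fun x hx => by rw [offs hx, zero_mul]
  have hUn : ∀ x, 0 ≤ U x := fun x => indicator_nonneg (fun y hy => mul_nonneg (f5 y).1 (hucpos y hy)) x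
  have hwm := hw.gradLocInt.aestronglyMeasurable
  have weak : ∀ ψ : Euc n → ℝ, Sm ψ → Hcs ψ → tsupport ψ ⊆ Γᶜ → ∫ x, U x • gradient ψ x = -∫ x, ψ x • Γᶜ.indicator w x := fun ψ p1 p2 p3 => by
    have e1 := hw.isGrad ψ p1 p2 p3
    have e2 : ∫ x, ψ x • Γᶜ.indicator w x = ∫ x in Γᶜ, ψ x • w x := by
      rw [← integral_indicator Γo.measurableSet]
      congr 1; ext1 x
      by_cases hx : x ∈ Γᶜ <;> simp [hx]
    rw [e2, ← e1, off_int p3 fun x hx => by rw [grad_off hx, smul_zero]]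
    exact integral_congr_ae (by filter_upwards [hUae] with x hx; rw [hx])
  refine
    { closed := ar.closed, ne := ar.ne, cont := ?_, nonneg := hUn, zeroΓ := fun x hx => ion (fun h => h.2 hx) _,
      cs := ⟨tsupport φ, f2, fun x hx => ?_⟩, integ := hint.congr (by filter_upwards [hUae] with x hx using hx.symm), trace := ?_,
      Gm := (aestronglyMeasurable_indicator_iff Γo.measurableSet).2 hwm, Gfin := ?_, weak := weak, C1 := hC₁, Am := hA
      bd := fun x hx ξ ζ => by rw [← euc_inner, hwt]; exact (hell x hx).1 ξ ζ
      ell := fun x hx ξ => by rw [← euc_inner, hwt]; exact (hell x hx).2 ξ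
      Bo := isOpen_ball, sol := ?_ }
  · intro x hx
    refine ContinuousAt.continuousWithinAt ?_
    by_cases h1 : x ∈ tsupport φ
    · have hxO : x ∈ O := ⟨f3 h1, hx⟩
      refine (f1.continuous.continuousAt.mul (huc.continuousAt (Oo.mem_nhds hxO))).congr ?_
      filter_upwards [Oo.mem_nhds hxO] with y hy
      rw [hU, iom hy]; rfl
    · refine (continuousAt_const (y := (0:ℝ))).congr ?_
      filter_upwards [(isClosed_tsupport φ).isOpen_compl.mem_nhds h1] with y hy
      exact (hU0 y (offs hy)).symm
  · exact hU0 x (offs hx)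
  · have htr' : ∀ᵐ z ∂(μH[d].restrict Γ), z ∈ ball xz (2 * r) → HasTraceAt u z 0 := by
      rw [inter_comm, ← Measure.restrict_restrict msb, ae_restrict_iff' msb] at htr
      exact htr
    filter_upwards [htr'] with z hz
    by_cases hzb : z ∈ ball xz (2 * r)
    · refine tendsto_of_tendsto_of_tendsto_of_le_of_le' tendsto_const_nhds (hz hzb) (Eventually.of_forall fun ρ => ?_) ?_
      · exact integral_nonneg hUn
      · obtain ⟨ρ₀, hρ₀, hsub⟩ := nhds_basis_closedBall.mem_iff.1 (isOpen_ball.mem_nhds hzb)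
        filter_upwards [Ioo_mem_nhdsGT hρ₀] with ρ hρ
        have hs2 : ball z ρ ⊆ closedBall z ρ₀ := ball_subset_closedBall.trans (closedBall_subset_closedBall hρ.2.le)
        have hi : IntegrableOn u (ball z ρ) volume := ((hu.mono_set hsub).integrableOn_isCompact (isCompact_closedBall _ _)).mono_set hs2
        rw [setAverage_eq, setAverage_eq]
        refine smul_le_smul_of_nonneg_left ?_ pz
        refine integral_mono_ae (hint.integrableOn.congr (ae_restrict_of_ae (by filter_upwards [hUae] with x hx using hx.symm))) hi ?_
        filter_upwards [ae_restrict_of_ae hUae, ae_restrict_of_ae hpos, ae_restrict_of_ae ar.aeΩ, ae_restrict_mem msb] with x h1 h2 h3 h4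
        rw [h1]
        exact mul_le_of_le_one_left (h2 ⟨hsub (hs2 h4), h3⟩) (f5 x).2
    · have hzt : z ∉ tsupport φ := fun h => hzb (f3 h)
      obtain ⟨ρ₀, hρ₀, hsub⟩ := Metric.isOpen_iff.1 (isClosed_tsupport φ).isOpen_compl z hzt
      refine tendsto_const_nhds.congr' ?_
      filter_upwards [Ioo_mem_nhdsGT hρ₀] with ρ hρ
      rw [setAverage_eq, setIntegral_eq_zero_of_forall_eq_zero, smul_zero]
      intro x hx
      exact hU0 x (offs (hsub (bsb hρ.2.le hx)))
  · have h1 := hw.l2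
    have wm : Measurable fun x => ofReal (weightW n d Γ x) := by
      have : Measurable (wt d Γ) := wt_meas
      rw [funext hwt] at this; exact this.ennreal_ofReal
    have wm2 : AEMeasurable (fun x => ofReal (‖w x‖ ^ 2)) (volume.restrict Γᶜ) := (hwm.norm.aemeasurable.pow_const 2).ennreal_ofReal
    rw [measW, restrict_withDensity Γo.measurableSet, lintegral_withDensity_eq_lintegral_mul₀ wm.aemeasurable wm2, ← lintegral_indicator Γo.measurableSet] at h1
    refine lt_of_le_of_lt (lintegral_mono fun x => ?_) h1
    by_cases hx : x ∈ Γᶜ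
    · rw [iom hx, iom hx, Pi.mul_apply, hwt, ofReal_mul pz, mul_comm]
    · rw [ion hx]; simp
  · have hVO : ball xz (15 * r / 8) \ Γ ⊆ O := by
      rintro x ⟨h1, h2⟩
      refine ⟨?_, h2⟩
      by_contra h3
      have := hphi0 x h3; rw [f6 x h1] at this; exact one_ne_zero this
    refine solG (isOpen_ball.sdiff ar.closed) Oo hVO (hu.mono_set diff_subset) (v := v) (fun ψ p1 p2 p3 => ?_) (fun ψ p1 p2 p3 => ?_) ?_ (fun ψ p1 p2 p3 => ?_)
    · have := hgr ψ p1 p2 p3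
      rwa [off_int p3 fun x hx => by rw [grad_off hx, smul_zero], off_int p3 fun x hx => by rw [offs hx, zero_smul]] at this
    · rw [← weak ψ p1 p2 (p3.trans fun x hx => hx.2)]
      refine integral_congr_ae ?_
      filter_upwards [hUae] with x hx
      by_cases h1 : x ∈ tsupport ψ
      · rw [hx, f6 x (p3 h1).1, one_mul]
      · rw [grad_off h1, smul_zero, smul_zero]
    · have : LocallyIntegrableOn w (ball xz (15 * r / 8) \ Γ) volume := hw.gradLocInt.mono_set fun x hx => hx.2
      intro x hx
      obtain ⟨s, hs, hi⟩ := this x hx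
      refine ⟨s ∩ (ball xz (15 * r / 8) \ Γ), inter_mem hs self_mem_nhdsWithin, ?_⟩
      exact (hi.integrable.indicator Γo.measurableSet).mono_measure (Measure.restrict_mono inter_subset_left le_rfl)
    · have := hsol ψ p1 p2 p3
      simp only [euc_inner] at this
      rwa [off_int (show tsupport ψ ⊆ Γᶜ from p3.trans fun x hx => hx.2) fun x hx => by rw [grad_off hx, inner_zero_right]] at this

end

/-- boundary Harnack-type bound at a corkscrew point. -/
theorem statement17 (n : ℕ) (hn : 2 ≤ n) (d : ℝ) (hd0 : 0 < d) (hdn : d < (n : ℝ) - 1)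
    (C₀ C₁ : ℝ) (hC₀ : 1 ≤ C₀) (hC₁ : 1 ≤ C₁) (ε : ℝ) (hε0 : 0 < ε) (hε1 : ε ≤ 1) :
    ∃ C : ℝ, 0 < C ∧
      ∀ Γ : Set (Euc n), Γ.Nonempty → IsClosed Γ → AhlforsRegular n d C₀ Γ →
      ∀ A : Euc n → Euc n →L[ℝ] Euc n, AEStronglyMeasurable A volume →
        EllipticOn n d Γ A C₁ →
      ∀ x₀ ∈ Γ, ∀ r : ℝ, 0 < r →
      ∀ X₀ : Euc n, X₀ ∉ Γ → dist X₀ x₀ ≤ r → ε * r ≤ infDist X₀ Γ →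
      ∀ u : Euc n → ℝ, ∀ v : Euc n → Euc n, ∀ uc : Euc n → ℝ,
        MemWrOn n d Γ (ball x₀ (2 * r)) u →
        IsDistribGradOn u v (ball x₀ (2 * r) \ Γ) →
        (∀ᵐ y ∂(volume.restrict (ball x₀ (2 * r) \ Γ)), 0 ≤ u y) →
        ¬(∀ᵐ y ∂(volume.restrict (ball x₀ (2 * r) \ Γ)), u y = 0) →
        SolOn Γ A v (ball x₀ (2 * r) \ Γ) →
        (∀ᵐ z ∂(μH[d].restrict (Γ ∩ ball x₀ (2 * r))), HasTraceAt u z 0) →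
        ContinuousOn uc (ball x₀ (2 * r) \ Γ) →
        (∀ᵐ y ∂(volume.restrict (ball x₀ (2 * r) \ Γ)), uc y = u y) →
        ∀ X ∈ ball x₀ r \ Γ, uc X ≤ C * uc X₀ := by
  have hfr : Module.finrank ℝ (Euc n) = n := finrank_euclideanSpace_fin
  have hdn' : d < (Module.finrank ℝ (Euc n) : ℝ) - 1 := by rw [hfr]; exact hdn
  obtain ⟨C, hC, H⟩ := main4 (E := Euc n) d C₀ C₁ ε hd0 hdn' hC₀ hε0
  refine ⟨C, hC, fun Γ hne hcl hAR A hA hell x₀ hx₀ r hr X₀ hX₀Γ hX₀ hX₀' u v uc hW hgr hpos _ hsol htr huc hae X hX => ?_⟩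
  have ar : AR d C₀ Γ := ⟨hcl, hne, hd0, hdn', hC₀, hAR⟩
  obtain ⟨φ, f1, f2, f3, f4, f5⟩ := exists_cutoff (isCompact_closedBall x₀ (15 * r / 8)) (isOpen_ball (x := x₀) (ε := 2 * r)) (closedBall_subset_ball (by linarith))
  obtain ⟨w, hw⟩ := hW.2 φ f1 f2 f3
  have core := core_of hd0 hC₁ ar hA hell f1 f2 f3 f5 (fun x hx => f4.self_of_nhdsSet x (ball_subset_closedBall hx)) hW.1 hw hgr hpos hsol htr huc hae
  have hX0b : X₀ ∈ ball x₀ (15 * r / 8) := by rw [mem_ball]; linarith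
  have hXb : X ∈ ball x₀ (15 * r / 8) := ball_subset_ball (by linarith) hX.1
  have := H ar core hx₀ hr Subset.rfl X₀ hX₀ hX₀' X hX.1
  rw [indicator_of_mem (show X₀ ∈ ball x₀ (2 * r) \ Γ from ⟨ball_subset_ball (by linarith) hX0b, hX₀Γ⟩),
    indicator_of_mem (show X ∈ ball x₀ (2 * r) \ Γ from ⟨ball_subset_ball (by linarith) hXb, hX.2⟩),
    f4.self_of_nhdsSet _ (ball_subset_closedBall hX0b), f4.self_of_nhdsSet _ (ball_subset_closedBall hXb), one_mul, one_mul] at this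
  exact this
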